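/- Let T and U be computable consistent extensions of PA and n ≥ 1. The following are equivalent: (1) (T,U) is a B_n-pair; (2) there is a Π_n sentence in Cons(Σ_n,T) ∩ Cons(Σ_n,U) \ (Th(T) ∪ Th(U)); (3) there is a Σ_n ∧ Π_n sentence in Cons(Σ_n,T) ∩ Cons(Σ_n,U) \ (Th(T) ∪ Th(U)); (4) there exist sentences φ and ψ such that φ ∈ Cons(Σ_n,T) ∩ Cons(Σ_n,U), ψ is a Π_n sentence, T + φ ⊢ ψ, U + φ ⊢ ψ, T ⊬ ψ, and U ⊬ ψ. -/

import Mathlib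

open FirstOrder Language
open scoped FirstOrder

namespace Guaspari

/-- The first-order language of arithmetic: a constant `0`, a unary function `S`,
binary functions `+` (coded `false`) and `·` (coded `true`), and a binary relation `≤`. -/
def LA : FirstOrder.Language :=
  ⟨fun n => match n with | 0 => Unit | 1 => Unit | 2 => Bool | _ => Empty,
   fun n => match n with | 2 => Unit | _ => Empty⟩

/-- Sentences of the language of arithmetic. -/
abbrev Snt : Type := LA.Sentence

/-- Theories (sets of sentences) in the language of arithmetic. -/
abbrev Thy : Type := LA.Theory

/-- The term `0`. -/
def zeroT {α : Type} {n : ℕ} : LA.Term (α ⊕ Fin n) :=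
  Constants.term (show LA.Constants from Unit.unit)

/-- The term `S t`. -/
def succT {α : Type} {n : ℕ} (t : LA.Term (α ⊕ Fin n)) : LA.Term (α ⊕ Fin n) :=
  Functions.apply₁ (show LA.Functions 1 from Unit.unit) t

/-- The term `t + u`. -/
def addT {α : Type} {n : ℕ} (t u : LA.Term (α ⊕ Fin n)) : LA.Term (α ⊕ Fin n) :=
  Functions.apply₂ (show LA.Functions 2 from false) t u

/-- The term `t * u`. -/
def mulT {α : Type} {n : ℕ} (t u : LA.Term (α ⊕ Fin n)) : LA.Term (α ⊕ Fin n) :=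
  Functions.apply₂ (show LA.Functions 2 from true) t u

/-- The atomic formula `t ≤ u`. -/
def leF {α : Type} {n : ℕ} (t u : LA.Term (α ⊕ Fin n)) : LA.BoundedFormula α n :=
  Relations.boundedFormula₂ (show LA.Relations 2 from Unit.unit) t u

/-- The `i`-th (de Bruijn-indexed) bound variable as a term. -/
def vT {m : ℕ} (i : Fin m) : LA.Term (Empty ⊕ Fin m) := Term.var (Sum.inr i)

/-- The induction axiom for the formula `φ(x₀,…,x_{k-1}, x_k)` with induction on `x_k`,
universally closed over the parameters `x₀,…,x_{k-1}`. -/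
def indAxiom {k : ℕ} (φ : LA.BoundedFormula Empty (k + 1)) : Snt :=
  let base := ∀' ((vT (Fin.last k) =' zeroT) ⟹ φ)
  let step := ∀' (φ ⟹
    ∀' ((vT (Fin.last (k + 1)) =' succT (vT (Fin.castSucc (Fin.last k)))) ⟹ φ.liftAt 1 k))
  ((base ⊓ step) ⟹ ∀' φ).alls

/-- The axioms of Peano arithmetic `PA`: the basic axioms for `0`, `S`, `+`, `·`, `≤`,
together with the full induction scheme. -/
def PAAx : Thy :=
  {∀' ∼(succT (vT 0) =' zeroT),
   ∀' ∀' ((succT (vT 0) =' succT (vT 1)) ⟹ (vT 0 =' vT 1)),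
   ∀' (addT (vT 0) zeroT =' vT 0),
   ∀' ∀' (addT (vT 0) (succT (vT 1)) =' succT (addT (vT 0) (vT 1))),
   ∀' (mulT (vT 0) zeroT =' zeroT),
   ∀' ∀' (mulT (vT 0) (succT (vT 1)) =' addT (mulT (vT 0) (vT 1)) (vT 0)),
   ∀' ∀' (leF (vT 0) (vT 1) ⇔ ∃' (addT (vT 2) (vT 0) =' vT 1))} ∪
  {φ | ∃ (k : ℕ) (ψ : LA.BoundedFormula Empty (k + 1)), φ = indAxiom ψ}

/-- `Prv T φ`: the sentence `φ` is provable from the theory `T` (equivalently, by the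
Gödel completeness theorem, `φ` holds in every model of `T`). -/
def Prv (T : Thy) (φ : Snt) : Prop := T ⊨ᵇ φ

/-- `Th T`: the set of sentences provable from `T`. -/
def Th (T : Thy) : Set Snt := {φ | Prv T φ}

/-- `Con T`: the theory `T` is consistent. -/
def Con (T : Thy) : Prop := ¬ Prv T ⊥

/-- The theory `T + φ`. -/
def add (T : Thy) (φ : Snt) : Thy := insert φ T

/-- `T` is an extension of `PA`. -/
def ExtPA (T : Thy) : Prop := ∀ φ ∈ PAAx, Prv T φ

/-- `V` is a subtheory of `T` (containing `PA`, as assumed throughout the paper). -/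
def SubThy (V T : Thy) : Prop := ExtPA V ∧ ∀ φ, Prv V φ → Prv T φ

/-- Δ₀ (bounded) formulas. -/
inductive IsDelta0 : ∀ {m : ℕ}, LA.BoundedFormula Empty m → Prop
  | falsum {m : ℕ} : IsDelta0 (⊥ : LA.BoundedFormula Empty m)
  | equal {m : ℕ} (t u : LA.Term (Empty ⊕ Fin m)) : IsDelta0 (t =' u)
  | le {m : ℕ} (t u : LA.Term (Empty ⊕ Fin m)) : IsDelta0 (leF t u)
  | imp {m : ℕ} {φ ψ : LA.BoundedFormula Empty m} :
      IsDelta0 φ → IsDelta0 ψ → IsDelta0 (φ ⟹ ψ)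
  | ball {m : ℕ} (t : LA.Term (Empty ⊕ Fin m)) {φ : LA.BoundedFormula Empty (m + 1)} :
      IsDelta0 φ →
      IsDelta0 (∀' (leF (vT (Fin.last m)) (t.relabel (Sum.map id Fin.castSucc)) ⟹ φ))
  | bex {m : ℕ} (t : LA.Term (Empty ⊕ Fin m)) {φ : LA.BoundedFormula Empty (m + 1)} :
      IsDelta0 φ →
      IsDelta0 (∃' (leF (vT (Fin.last m)) (t.relabel (Sum.map id Fin.castSucc)) ⊓ φ))

mutual
  /-- `Σ_k` formulas (cumulatively: every `Π_k` formula is `Σ_{k+1}`). -/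
  inductive IsSigmaFml : ℕ → ∀ {m : ℕ}, LA.BoundedFormula Empty m → Prop
    | ofDelta0 {m : ℕ} {φ : LA.BoundedFormula Empty m} : IsDelta0 φ → IsSigmaFml 0 φ
    | ofPi {k : ℕ} {m : ℕ} {φ : LA.BoundedFormula Empty m} :
        IsPiFml k φ → IsSigmaFml (k + 1) φ
    | ex {k : ℕ} {m : ℕ} {φ : LA.BoundedFormula Empty (m + 1)} :
        IsSigmaFml (k + 1) φ → IsSigmaFml (k + 1) (∃' φ)
  /-- `Π_k` formulas (cumulatively: every `Σ_k` formula is `Π_{k+1}`). -/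
  inductive IsPiFml : ℕ → ∀ {m : ℕ}, LA.BoundedFormula Empty m → Prop
    | ofDelta0 {m : ℕ} {φ : LA.BoundedFormula Empty m} : IsDelta0 φ → IsPiFml 0 φ
    | ofSigma {k : ℕ} {m : ℕ} {φ : LA.BoundedFormula Empty m} :
        IsSigmaFml k φ → IsPiFml (k + 1) φ
    | all {k : ℕ} {m : ℕ} {φ : LA.BoundedFormula Empty (m + 1)} :
        IsPiFml (k + 1) φ → IsPiFml (k + 1) (∀' φ)
end

/-- The set of `Σ_k` sentences. -/
def SigmaS (k : ℕ) : Set Snt := {φ | IsSigmaFml k φ}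

/-- The set of `Π_k` sentences. -/
def PiS (k : ℕ) : Set Snt := {φ | IsPiFml k φ}

/-- The set of `Σ_k ∧ Π_k` sentences, i.e. sentences of the form `σ ∧ π` with
`σ` a `Σ_k` sentence and `π` a `Π_k` sentence. -/
def SigAndPiS (k : ℕ) : Set Snt :=
  {φ | ∃ σ ∈ SigmaS k, ∃ π ∈ PiS k, φ = σ ⊓ π}

/-- `B(Σ_k)` sentences: Boolean combinations of `Σ_k` sentences. -/
inductive IsBoolSigma (k : ℕ) : Snt → Prop
  | base {φ : Snt} : φ ∈ SigmaS k → IsBoolSigma k φ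
  | not {φ : Snt} : IsBoolSigma k φ → IsBoolSigma k (∼φ)
  | imp {φ ψ : Snt} : IsBoolSigma k φ → IsBoolSigma k ψ → IsBoolSigma k (φ ⟹ ψ)
  | inf {φ ψ : Snt} : IsBoolSigma k φ → IsBoolSigma k ψ → IsBoolSigma k (φ ⊓ ψ)
  | sup {φ ψ : Snt} : IsBoolSigma k φ → IsBoolSigma k ψ → IsBoolSigma k (φ ⊔ ψ)

/-- The set of `B(Σ_k)` sentences. -/
def BSigmaS (k : ℕ) : Set Snt := {φ | IsBoolSigma k φ}

/-- The set of `Γ` sentences provable in `T`, `Th_Γ(T)`. -/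
def ThIn (Γ : Set Snt) (T : Thy) : Set Snt := Γ ∩ Th T

instance (i : ℕ) : Encodable (LA.Functions i) :=
  match i with
  | 0 => inferInstanceAs (Encodable Unit)
  | 1 => inferInstanceAs (Encodable Unit)
  | 2 => inferInstanceAs (Encodable Bool)
  | (_ + 3) => inferInstanceAs (Encodable Empty)

instance (i : ℕ) : Encodable (LA.Relations i) :=
  match i with
  | 0 => inferInstanceAs (Encodable Empty)
  | 1 => inferInstanceAs (Encodable Empty)
  | 2 => inferInstanceAs (Encodable Unit)
  | (_ + 3) => inferInstanceAs (Encodable Empty)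

/-- A Gödel numbering of sentences, via Mathlib's encoding of bounded formulas. -/
def gnum (φ : Snt) : ℕ :=
  Encodable.encode
    (show List ((Σ k, LA.Term (Empty ⊕ Fin k)) ⊕ ((Σ n, LA.Relations n) ⊕ ℕ)) from
      BoundedFormula.encoding.encode (⟨0, φ⟩ : Σ n, LA.BoundedFormula Empty n))

/-- The (axiom set of the) theory `T` is computable. -/
def CompThy (T : Thy) : Prop :=
  ComputablePred (fun m : ℕ => ∃ φ ∈ T, gnum φ = m)

/-- `T` is a computable consistent extension of `PA`. -/
def GoodThy (T : Thy) : Prop := CompThy T ∧ Con T ∧ ExtPA T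

/-- `φ` is `Γ`-conservative over `T` for a class of sentences `Γ`:
every `Γ` sentence provable in `T + φ` is provable in `T`. -/
def ConsIn (Γ : Set Snt) (T : Thy) (φ : Snt) : Prop :=
  ∀ γ ∈ Γ, Prv (add T φ) γ → Prv T γ

/-- `φ` is hereditarily `Γ`-conservative over `T`: `Γ`-conservative over every
subtheory of `T` (containing `PA`). -/
def HConsIn (Γ : Set Snt) (T : Thy) (φ : Snt) : Prop :=
  ∀ V : Thy, SubThy V T → ConsIn Γ V φ

/-- `φ` is `Σ_k↓Π_k`-conservative over `V`. -/
def SPCons (k : ℕ) (V : Thy) (φ : Snt) : Prop :=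
  ∀ σ ∈ SigmaS k, ∀ π ∈ PiS k, Prv (add V φ) (σ ⊓ π) → Prv V (σ ⊔ π)

/-- `φ` is hereditarily `Σ_k↓Π_k`-conservative over `T`. -/
def HSPCons (k : ℕ) (T : Thy) (φ : Snt) : Prop :=
  ∀ V : Thy, SubThy V T → SPCons k V φ

/-- The theory `S` is `Σ_k↓Π_k`-conservative over `PA`. -/
def ThySPConsPA (k : ℕ) (S : Thy) : Prop :=
  ∀ σ ∈ SigmaS k, ∀ π ∈ PiS k, Prv S (σ ⊓ π) → Prv PAAx (σ ⊔ π)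

/-- `δ` is a `Δ_k(S)` sentence: `S`-provably equivalent to both a `Σ_k` sentence
and a `Π_k` sentence. -/
def IsDeltaIn (k : ℕ) (S : Thy) (δ : Snt) : Prop :=
  (∃ σ ∈ SigmaS k, Prv S (δ ⇔ σ)) ∧ ∃ π ∈ PiS k, Prv S (δ ⇔ π)

/-- `φ` is `Δ_k(S)`-conservative over `V`. -/
def DeltaConsRel (k : ℕ) (S V : Thy) (φ : Snt) : Prop :=
  ∀ δ : Snt, IsDeltaIn k S δ → Prv (add V φ) δ → Prv V δ

/-- `φ` is `Δ_k`-conservative over `T`, i.e. `Δ_k(Th(T))`-conservative over `T`. -/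
def DeltaCons (k : ℕ) (T : Thy) (φ : Snt) : Prop := DeltaConsRel k (Th T) T φ

/-- `φ` is hereditarily `Δ_k`-conservative over `T`. -/
def HDeltaCons (k : ℕ) (T : Thy) (φ : Snt) : Prop :=
  ∀ V : Thy, SubThy V T → DeltaConsRel k (Th V) V φ

/-- `φ` is doubly `Π_k`-conservative over `T`: `φ` is `Π_k`-conservative and `¬φ` is
`Σ_k`-conservative over `T`. -/
def DCons (k : ℕ) (T : Thy) (φ : Snt) : Prop :=
  ConsIn (PiS k) T φ ∧ ConsIn (SigmaS k) T (∼φ)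

/-- `φ` is hereditarily doubly `Π_k`-conservative over `T`. -/
def HDCons (k : ℕ) (T : Thy) (φ : Snt) : Prop :=
  ∀ V : Thy, SubThy V T → DCons k V φ

/-- `(T,U)` is a `B_n`-pair. -/
def Bpair (n : ℕ) (T U : Thy) : Prop :=
  (¬ ThIn (PiS n) T ⊆ Th U ∨ Con (T ∪ ThIn (PiS n) U)) ∧
  (¬ ThIn (PiS n) U ⊆ Th T ∨ Con (U ∪ ThIn (PiS n) T))

/-- `(T,U)` is a `C_n`-pair. -/
def Cpair (n : ℕ) (T U : Thy) : Prop :=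
  Con (T ∪ ThIn (PiS n) U) ∧ Con (U ∪ ThIn (PiS n) T)

/-- `(T,U)` is a `C⁻_n`-pair. -/
def Cmpair (n : ℕ) (T U : Thy) : Prop :=
  Con (T ∪ ThIn (PiS n) U) ∨ Con (U ∪ ThIn (PiS n) T)

/-- `(T,U)` is a `C^∧_n`-pair. -/
def Capair (n : ℕ) (T U : Thy) : Prop :=
  Con (T ∪ ThIn (SigAndPiS n) U) ∧ Con (U ∪ ThIn (SigAndPiS n) T)

/-- `(T,U)` is a `C^B_n`-pair. -/
def CBpair (n : ℕ) (T U : Thy) : Prop :=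
  Con (T ∪ ThIn (BSigmaS n) U)



end Guaspari

open FirstOrder Language
open scoped FirstOrder

namespace Guaspari

/-! ### Realization lemmas -/

section ops
variable (M : Type) [LA.Structure M]

/-- interpretation of zero -/
def z0 : M := Structure.funMap (L := LA) (n := 0) (show LA.Functions 0 from Unit.unit) ![]
variable {M}
/-- interpretation of successor -/
def sc (x : M) : M := Structure.funMap (L := LA) (n := 1) (show LA.Functions 1 from Unit.unit) ![x]
/-- interpretation of addition -/
def pl (x y : M) : M := Structure.funMap (L := LA) (n := 2) (show LA.Functions 2 from false) ![x, y]
/-- interpretation of multiplication -/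
def ti (x y : M) : M := Structure.funMap (L := LA) (n := 2) (show LA.Functions 2 from true) ![x, y]
/-- interpretation of order -/
def lle (x y : M) : Prop :=
  Structure.RelMap (L := LA) (n := 2) (show LA.Relations 2 from Unit.unit) ![x, y]

@[simp] theorem realize_zeroT {α : Type} {n : ℕ} (v : α ⊕ Fin n → M) :
    (zeroT : LA.Term (α ⊕ Fin n)).realize v = z0 M := by
  simp only [zeroT, Constants.term, Term.realize, z0]
  congr 1
  exact Subsingleton.elim _ _

@[simp] theorem realize_succT {α : Type} {n : ℕ} (v : α ⊕ Fin n → M) (t : LA.Term (α ⊕ Fin n)) :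
    (succT t).realize v = sc (t.realize v) := by
  exact Term.realize_functions_apply₁

@[simp] theorem realize_addT {α : Type} {n : ℕ} (v : α ⊕ Fin n → M) (t u : LA.Term (α ⊕ Fin n)) :
    (addT t u).realize v = pl (t.realize v) (u.realize v) := by
  exact Term.realize_functions_apply₂

@[simp] theorem realize_mulT {α : Type} {n : ℕ} (v : α ⊕ Fin n → M) (t u : LA.Term (α ⊕ Fin n)) :
    (mulT t u).realize v = ti (t.realize v) (u.realize v) := by
  exact Term.realize_functions_apply₂

@[simp] theorem realize_leF {α : Type} {n : ℕ} (v : α → M) (xs : Fin n → M)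
    (t u : LA.Term (α ⊕ Fin n)) :
    (leF t u).Realize v xs ↔ lle (t.realize (Sum.elim v xs)) (u.realize (Sum.elim v xs)) := by
  exact BoundedFormula.realize_rel₂

@[simp] theorem realize_vT {n : ℕ} (v : Empty → M) (xs : Fin n → M) (i : Fin n) :
    (vT i).realize (Sum.elim v xs) = xs i := rfl

end ops

/-- Bundled models of `PA`. -/
structure PAM where
  /-- carrier -/
  carrier : Type
  /-- structure -/
  [str : LA.Structure carrier]
  pa : carrier ⊨ PAAx

instance : CoeSort PAM Type := ⟨PAM.carrier⟩
instance (M : PAM) : LA.Structure M := M.str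

/-! ### Tuples -/

/-- nested tuples -/
@[reducible] def Tup : ℕ → Type → Type
  | 0, _ => Unit
  | k + 1, M => Tup k M × M

/-- a tuple as a function -/
def tv {M : Type} : ∀ {k : ℕ}, Tup k M → Fin k → M
  | 0, _ => Fin.elim0
  | _ + 1, p => Fin.snoc (tv p.1) p.2

/-- a function as a tuple -/
def vt {M : Type} : ∀ {k : ℕ}, (Fin k → M) → Tup k M
  | 0, _ => ()
  | _ + 1, v => (vt (fun i => v i.castSucc), v (Fin.last _))

@[simp] theorem tv_vt {M : Type} : ∀ {k : ℕ} (v : Fin k → M), tv (vt v) = v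
  | 0, v => funext fun i => i.elim0
  | k + 1, v => by
    simp only [vt, tv, tv_vt]
    exact Fin.snoc_init_self v

@[simp] theorem vt_tv {M : Type} : ∀ {k : ℕ} (v : Tup k M), vt (tv v) = v
  | 0, _ => rfl
  | k + 1, v => by
    simp only [vt, tv, Fin.snoc_castSucc, Fin.snoc_last]
    rw [vt_tv]

theorem tv_succ {M : Type} {k : ℕ} (p : Tup k M) (y : M) :
    tv (k := k + 1) (p, y) = Fin.snoc (tv p) y := rfl

/-! ### Definability with parameters in a fixed structure -/

section dm
variable {M : Type} [LA.Structure M] {k : ℕ}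

/-- definable with parameters -/
class Dm (P : Tup k M → Prop) : Prop where
  out : ∃ φ : LA.BoundedFormula M k, ∀ p, φ.Realize id (tv p) ↔ P p
/-- given by a term with parameters -/
class Tm (f : Tup k M → M) : Prop where
  out : ∃ t : LA.Term (M ⊕ Fin k), ∀ p, t.realize (Sum.elim id (tv p)) = f p
/-- iterated first projections -/
class Pj {j : ℕ} (f : Tup k M → Tup j M) : Prop where
  out : ∃ g : Fin j → Fin k, ∀ p, tv (f p) = tv p ∘ g

instance Pj.id' : Pj (fun p : Tup k M => p) := ⟨⟨id, fun _ => rfl⟩⟩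
instance Pj.fst {j : ℕ} {f : Tup k M → Tup (j + 1) M} [h : Pj f] :
    Pj (j := j) (fun p => (f p).1) := by
  obtain ⟨g, hg⟩ := h.out
  refine ⟨fun i => g i.castSucc, fun p => ?_⟩
  funext i
  have := congrFun (hg p) i.castSucc
  simp only [Function.comp] at this ⊢
  rw [← this]
  simp [tv]
instance Tm.snd {j : ℕ} {f : Tup k M → Tup (j + 1) M} [h : Pj f] :
    Tm (fun p => (f p).2) := by
  obtain ⟨g, hg⟩ := h.out
  refine ⟨Term.var (Sum.inr (g (Fin.last _))), fun p => ?_⟩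
  have := congrFun (hg p) (Fin.last _)
  simp only [Function.comp, tv, Fin.snoc_last] at this
  simp [this]
instance Tm.const (c : M) : Tm (fun _ : Tup k M => c) :=
  ⟨Term.var (Sum.inl c), fun _ => rfl⟩
theorem Tm.pl {f g : Tup k M → M} [hf : Tm f] [hg : Tm g] : Tm (fun p => pl (f p) (g p)) := by
  obtain ⟨t, ht⟩ := hf.out
  obtain ⟨u, hu⟩ := hg.out
  exact ⟨addT t u, fun p => by simp [ht, hu]⟩
theorem Tm.ti {f g : Tup k M → M} [hf : Tm f] [hg : Tm g] : Tm (fun p => ti (f p) (g p)) := by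
  obtain ⟨t, ht⟩ := hf.out
  obtain ⟨u, hu⟩ := hg.out
  exact ⟨mulT t u, fun p => by simp [ht, hu]⟩
theorem Dm.lle {f g : Tup k M → M} [hf : Tm f] [hg : Tm g] : Dm (fun p => lle (f p) (g p)) := by
  obtain ⟨t, ht⟩ := hf.out
  obtain ⟨u, hu⟩ := hg.out
  exact ⟨leF t u, fun p => by simp [ht, hu]⟩
instance Dm.eq {f g : Tup k M → M} [hf : Tm f] [hg : Tm g] : Dm (fun p => f p = g p) := by
  obtain ⟨t, ht⟩ := hf.out
  obtain ⟨u, hu⟩ := hg.out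
  exact ⟨t =' u, fun p => by simp [ht, hu]⟩
instance Dm.imp {f g : Tup k M → Prop} [hf : Dm f] [hg : Dm g] : Dm (fun p => f p → g p) := by
  obtain ⟨t, ht⟩ := hf.out
  obtain ⟨u, hu⟩ := hg.out
  exact ⟨t ⟹ u, fun p => by simp [ht, hu]⟩
instance Dm.not {f : Tup k M → Prop} [hf : Dm f] : Dm (fun p => ¬ f p) := by
  obtain ⟨t, ht⟩ := hf.out
  exact ⟨∼t, fun p => by simp [ht]⟩
instance Dm.and {f g : Tup k M → Prop} [hf : Dm f] [hg : Dm g] : Dm (fun p => f p ∧ g p) := by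
  obtain ⟨t, ht⟩ := hf.out
  obtain ⟨u, hu⟩ := hg.out
  exact ⟨t ⊓ u, fun p => by simp [ht, hu]⟩
instance Dm.or {f g : Tup k M → Prop} [hf : Dm f] [hg : Dm g] : Dm (fun p => f p ∨ g p) := by
  obtain ⟨t, ht⟩ := hf.out
  obtain ⟨u, hu⟩ := hg.out
  exact ⟨t ⊔ u, fun p => by simp [ht, hu]⟩
instance Dm.all {f : Tup k M → M → Prop} [hf : Dm (k := k + 1) (fun p => f p.1 p.2)] :
    Dm (fun p => ∀ y, f p y) := by
  obtain ⟨t, ht⟩ := hf.out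
  refine ⟨∀' t, fun p => ?_⟩
  simp only [BoundedFormula.realize_all]
  exact forall_congr' fun y => ht (p, y)
instance Dm.ex {f : Tup k M → M → Prop} [hf : Dm (k := k + 1) (fun p => f p.1 p.2)] :
    Dm (fun p => ∃ y, f p y) := by
  obtain ⟨t, ht⟩ := hf.out
  refine ⟨∃' t, fun p => ?_⟩
  simp only [BoundedFormula.realize_ex]
  exact exists_congr fun y => ht (p, y)
end dm

theorem realize_indAxiom {M : Type} [LA.Structure M] {k : ℕ} (φ : LA.BoundedFormula Empty (k + 1)) :
    M ⊨ indAxiom φ ↔ ∀ v : Fin k → M,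
      φ.Realize default (Fin.snoc v (z0 M)) →
      (∀ x, φ.Realize default (Fin.snoc v x) → φ.Realize default (Fin.snoc v (sc x))) →
      ∀ x, φ.Realize default (Fin.snoc v x) := by
  simp only [indAxiom, Sentence.Realize, BoundedFormula.realize_alls]
  refine forall_congr' fun v => ?_
  simp only [BoundedFormula.realize_imp, BoundedFormula.realize_inf, BoundedFormula.realize_all,
    BoundedFormula.realize_bdEqual, realize_vT, realize_succT, realize_zeroT, Fin.snoc_last,
    Fin.snoc_castSucc, forall_eq, and_imp]
  have : ∀ x : M, (φ.liftAt 1 k).Realize default (Fin.snoc (Fin.snoc v x) (sc x) : Fin (k+1+1) → M)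
      ↔ φ.Realize default (Fin.snoc v (sc x)) := by
    intro x
    rw [BoundedFormula.realize_liftAt_one (by omega)]
    have : ((Fin.snoc (Fin.snoc v x) (sc x) : Fin (k+1+1) → M) ∘
        fun i : Fin (k + 1) => if (i : ℕ) < k then i.castSucc else i.succ) = Fin.snoc v (sc x) := by
      funext i
      refine Fin.lastCases ?_ (fun i => ?_) i
      · simp only [Function.comp, Fin.val_last, lt_irrefl, if_false, Fin.snoc_last]
        have : (Fin.last k).succ = Fin.last (k + 1) := rfl
        rw [this, Fin.snoc_last]
      · simp
    rw [this]
  simp only [this]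

theorem PAM.ind0 (M : PAM) (P : M → Prop) (hD : Dm (k := 1) fun p : Tup 1 M => P p.2)
    (h0 : P (z0 M)) (hs : ∀ x, P x → P (sc x)) (x : M) : P x := by
  classical
  obtain ⟨φ, hφ⟩ := hD.out
  let s := φ.freeVarFinset
  let e := s.equivFin
  let ψ : LA.BoundedFormula Empty (s.card + 1) :=
    (φ.restrictFreeVar (β := Fin s.card) e).relabel (fun i => Sum.inr i)
  let c : Fin s.card → M := fun i => (e.symm i : M)
  have hψ : ∀ y : M, ψ.Realize default (Fin.snoc c y) ↔ P y := by
    intro y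
    rw [BoundedFormula.realize_relabel, BoundedFormula.realize_restrictFreeVar (v' := id)]
    · have : ((Fin.snoc c y : Fin (s.card + 1) → M) ∘ Fin.natAdd s.card) =
          tv (k := 1) (((), y) : Tup 1 M) := by
        funext i
        rw [Fin.eq_zero i]
        simp only [Function.comp]
        have h1 : (Fin.natAdd s.card (0 : Fin 1)) = Fin.last _ := rfl
        have h2 : (0 : Fin 1) = Fin.last 0 := rfl
        rw [h1, Fin.snoc_last, h2]
        exact (Fin.snoc_last (α := fun _ => M) _ _).symm
      rw [this]
      exact hφ _
    · intro a
      simp only [Function.comp, Sum.elim_inr]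
      have h1 : (Fin.castAdd 1 (e a)) = (e a).castSucc := rfl
      rw [h1, Fin.snoc_castSucc]
      simp [c]
  have hax : M ⊨ indAxiom ψ := M.pa.realize_of_mem _ (Or.inr ⟨_, ψ, rfl⟩)
  rw [realize_indAxiom] at hax
  have := hax c
  simp only [hψ] at this
  exact this h0 hs x

/-! ### Algebra of PA models -/
namespace PAM
variable {M : PAM}

instance : Zero M := ⟨z0 M⟩
instance : One M := ⟨sc (z0 M)⟩
instance : Add M := ⟨pl⟩
instance : Mul M := ⟨ti⟩
instance : LE M := ⟨lle⟩

instance instTmAdd {k : ℕ} {f g : Tup k M → M} [Tm f] [Tm g] : Tm (fun p => f p + g p) := Tm.pl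
instance instTmMul {k : ℕ} {f g : Tup k M → M} [Tm f] [Tm g] : Tm (fun p => f p * g p) := Tm.ti
instance instDmLe {k : ℕ} {f g : Tup k M → M} [Tm f] [Tm g] : Dm (fun p => f p ≤ g p) := Dm.lle

theorem z0_eq : z0 M = (0 : M) := rfl
theorem pl_eq (x y : M) : pl x y = x + y := rfl
theorem ti_eq (x y : M) : ti x y = x * y := rfl
theorem lle_eq (x y : M) : lle x y ↔ x ≤ y := Iff.rfl

theorem ax (M : PAM) :
    (∀ x : M, sc x ≠ 0) ∧ (∀ x y : M, sc x = sc y → x = y) ∧ (∀ x : M, x + 0 = x) ∧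
    (∀ x y : M, x + sc y = sc (x + y)) ∧ (∀ x : M, x * 0 = 0) ∧
    (∀ x y : M, x * sc y = x * y + x) ∧ (∀ x y : M, x ≤ y ↔ ∃ z, z + x = y) := by
  have h : ∀ φ ∈ PAAx, M ⊨ φ := fun φ hφ => M.pa.realize_of_mem φ hφ
  simp only [PAAx, Set.mem_union, Set.mem_insert_iff, Set.mem_singleton_iff] at h
  have h1 := h _ (Or.inl (Or.inl rfl))
  have h2 := h _ (Or.inl (Or.inr (Or.inl rfl)))
  have h3 := h _ (Or.inl (Or.inr (Or.inr (Or.inl rfl))))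
  have h4 := h _ (Or.inl (Or.inr (Or.inr (Or.inr (Or.inl rfl)))))
  have h5 := h _ (Or.inl (Or.inr (Or.inr (Or.inr (Or.inr (Or.inl rfl))))))
  have h6 := h _ (Or.inl (Or.inr (Or.inr (Or.inr (Or.inr (Or.inr (Or.inl rfl)))))))
  have h7 := h _ (Or.inl (Or.inr (Or.inr (Or.inr (Or.inr (Or.inr (Or.inr rfl)))))))
  clear h
  simp only [Sentence.Realize, Formula.Realize, BoundedFormula.realize_all,
    BoundedFormula.realize_not, BoundedFormula.realize_bdEqual, realize_vT, realize_succT,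
    realize_zeroT, BoundedFormula.realize_imp, realize_addT, realize_mulT,
    BoundedFormula.realize_iff, BoundedFormula.realize_ex, realize_leF] at h1 h2 h3 h4 h5 h6 h7
  exact ⟨h1, h2, h3, h4, h5, h6, h7⟩

theorem add_zero' (x : M) : x + 0 = x := M.ax.2.2.1 x
theorem add_sc (x y : M) : x + sc y = sc (x + y) := M.ax.2.2.2.1 x y
theorem sc_eq (x : M) : sc x = x + 1 := by
  show _ = x + sc (z0 M)
  rw [add_sc]
  exact congrArg sc (add_zero' x).symm

/-- induction -/
theorem ind (P : M → Prop) [hD : Dm (k := 1) fun p : Tup 1 M => P p.2]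
    (h0 : P 0) (hs : ∀ x, P x → P (x + 1)) (x : M) : P x :=
  M.ind0 P hD h0 (fun x hx => by rw [sc_eq]; exact hs x hx) x

theorem add_assoc1 (x y : M) : x + (y + 1) = x + y + 1 := by
  rw [← sc_eq, add_sc, sc_eq]
theorem zero_add' (x : M) : 0 + x = x :=
  ind (fun x : M => 0 + x = x) (add_zero' 0) (fun x hx => by rw [add_assoc1, hx]) x
theorem add_assoc' (x y z : M) : x + y + z = x + (y + z) :=
  ind (fun z : M => x + y + z = x + (y + z)) (by simp only [add_zero'])
    (fun z hz => by rw [add_assoc1, hz, add_assoc1, add_assoc1]) z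
theorem one_add' (x : M) : 1 + x = x + 1 :=
  ind (fun x : M => 1 + x = x + 1) (by rw [add_zero', zero_add'])
    (fun x hx => by rw [add_assoc1, hx]) x
theorem add_comm' (x y : M) : x + y = y + x :=
  ind (fun y : M => x + y = y + x) (by rw [add_zero', zero_add'])
    (fun y hy => by rw [add_assoc1, hy, add_assoc', ← one_add' x, ← add_assoc']) y

instance : AddCommMonoid M where
  add_assoc := add_assoc'
  zero_add := zero_add'
  add_zero := add_zero'
  add_comm := add_comm'
  nsmul := nsmulRec

theorem mul_zero' (x : M) : x * 0 = 0 := M.ax.2.2.2.2.1 x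
theorem mul_add1 (x y : M) : x * (y + 1) = x * y + x := by
  rw [← sc_eq, M.ax.2.2.2.2.2.1 x y]
theorem zero_mul' (x : M) : 0 * x = 0 :=
  ind (fun x : M => 0 * x = 0) (mul_zero' 0) (fun x hx => by rw [mul_add1, hx, add_zero]) x
theorem add1_mul (x y : M) : (x + 1) * y = x * y + y :=
  ind (fun y : M => (x + 1) * y = x * y + y) (by simp only [mul_zero', add_zero])
    (fun y hy => by rw [mul_add1, hy, mul_add1]; abel) y
theorem mul_comm' (x y : M) : x * y = y * x :=
  ind (fun y : M => x * y = y * x) (by rw [mul_zero', zero_mul'])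
    (fun y hy => by rw [mul_add1, hy, add1_mul]) y
theorem mul_add' (x y z : M) : x * (y + z) = x * y + x * z :=
  ind (fun z : M => x * (y + z) = x * y + x * z) (by simp only [mul_zero', add_zero])
    (fun z hz => by rw [add_assoc1, mul_add1, hz, mul_add1]; abel) z
theorem mul_assoc' (x y z : M) : x * y * z = x * (y * z) :=
  ind (fun z : M => x * y * z = x * (y * z)) (by simp only [mul_zero'])
    (fun z hz => by rw [mul_add1, hz, mul_add1, mul_add']) z
theorem one_mul' (x : M) : 1 * x = x :=
  ind (fun x : M => 1 * x = x) (mul_zero' 1) (fun x hx => by rw [mul_add1, hx]) x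

instance : CommSemiring M where
  mul_assoc := mul_assoc'
  one_mul := one_mul'
  mul_one x := by rw [mul_comm', one_mul']
  left_distrib := mul_add'
  right_distrib x y z := by rw [mul_comm', mul_add', mul_comm' z, mul_comm' z]
  zero_mul := zero_mul'
  mul_zero := mul_zero'
  mul_comm := mul_comm'

theorem add1_ne (x : M) : x + 1 ≠ 0 := by rw [← sc_eq]; exact M.ax.1 x
theorem add1_inj {x y : M} (h : x + 1 = y + 1) : x = y := by
  rw [← sc_eq, ← sc_eq] at h; exact M.ax.2.1 x y h
theorem add_cancel' (x y z : M) : x + z = y + z → x = y :=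
  ind (fun z : M => x + z = y + z → x = y) (by simp)
    (fun z hz h => hz (add1_inj (by rw [add_assoc, h, add_assoc]))) z
theorem eq_zero_or (x : M) : x = 0 ∨ ∃ y, x = y + 1 :=
  ind (fun x : M => x = 0 ∨ ∃ y, x = y + 1) (Or.inl rfl) (fun x _ => Or.inr ⟨x, rfl⟩) x
theorem le_iff {x y : M} : x ≤ y ↔ ∃ z, z + x = y := M.ax.2.2.2.2.2.2 x y
theorem add_eq_zero' {x y : M} (h : x + y = 0) : x = 0 := by
  rcases eq_zero_or y with rfl | ⟨z, rfl⟩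
  · simpa using h
  · exact absurd (by rw [← h, add_assoc]) (add1_ne (x + z))
theorem le_total' (x y : M) : x ≤ y ∨ y ≤ x :=
  ind (fun x : M => x ≤ y ∨ y ≤ x) (Or.inl (le_iff.2 ⟨y, by simp⟩))
    (fun x h => by
      rcases h with h | h
      · obtain ⟨z, rfl⟩ := le_iff.1 h
        rcases eq_zero_or z with rfl | ⟨w, rfl⟩
        · exact Or.inr (le_iff.2 ⟨1, by abel⟩)
        · exact Or.inl (le_iff.2 ⟨w, by abel⟩)
      · obtain ⟨z, rfl⟩ := le_iff.1 h
        exact Or.inr (le_iff.2 ⟨z + 1, by abel⟩)) x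

noncomputable instance : LinearOrder M where
  le_refl x := le_iff.2 ⟨0, by simp⟩
  le_trans x y z h1 h2 := by
    obtain ⟨a, rfl⟩ := le_iff.1 h1
    obtain ⟨b, rfl⟩ := le_iff.1 h2
    exact le_iff.2 ⟨b + a, by abel⟩
  le_antisymm x y h1 h2 := by
    obtain ⟨a, rfl⟩ := le_iff.1 h1
    obtain ⟨b, h⟩ := le_iff.1 h2
    have : (b + a) + x = 0 + x := by rw [add_assoc, h, zero_add]
    have := add_cancel' _ _ _ this
    rw [add_comm] at this
    rw [add_eq_zero' this, zero_add]
  le_total := le_total'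
  toDecidableLE := Classical.decRel _

theorem add_le_add_left' (x y : M) (h : x ≤ y) (z : M) : z + x ≤ z + y := by
  obtain ⟨a, rfl⟩ := le_iff.1 h
  exact le_iff.2 ⟨a, by abel⟩

instance : IsOrderedCancelAddMonoid M where
  add_le_add_left x y h z := by
    rw [add_comm x, add_comm y]; exact add_le_add_left' x y h z
  le_of_add_le_add_left x y z h := by
    obtain ⟨a, h⟩ := le_iff.1 h
    exact le_iff.2 ⟨a, add_cancel' _ _ x (by rw [add_assoc, add_comm y, h, add_comm])⟩

instance : CanonicallyOrderedAdd M where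
  exists_add_of_le {x y} h := by
    obtain ⟨a, rfl⟩ := le_iff.1 h
    exact ⟨a, add_comm _ _⟩
  le_add_self x y := le_iff.2 ⟨y, rfl⟩
  le_self_add x y := le_iff.2 ⟨y, add_comm _ _⟩

theorem lt_iff {x y : M} : x < y ↔ x + 1 ≤ y := by
  constructor
  · intro h
    obtain ⟨a, rfl⟩ := le_iff.1 h.le
    rcases eq_zero_or a with rfl | ⟨b, rfl⟩
    · simp at h
    · exact le_iff.2 ⟨b, by abel⟩
  · intro h
    refine lt_of_lt_of_le (lt_of_le_of_ne (le_iff.2 ⟨1, add_comm _ _⟩) ?_) h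
    intro h'
    have : 0 + x = 1 + x := by rw [zero_add, add_comm]; exact h'
    have := add_cancel' _ _ _ this
    exact add1_ne (0 : M) (by rw [zero_add]; exact this.symm)

theorem lt_add1 {x y : M} : x < y + 1 ↔ x ≤ y := by
  rw [lt_iff]; exact add_le_add_iff_right 1

instance : Nontrivial M := ⟨0, 1, by
  have := add1_ne (0 : M)
  rw [zero_add] at this
  exact this.symm⟩

theorem mul_pos' {x y : M} (hx : 0 < x) (hy : 0 < y) : 0 < x * y := by
  rcases eq_zero_or x with rfl | ⟨a, rfl⟩
  · exact absurd hx (lt_irrefl _)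
  rcases eq_zero_or y with rfl | ⟨b, rfl⟩
  · exact absurd hy (lt_irrefl _)
  have : (a + 1) * (b + 1) = (a * b + a + b) + 1 := by ring
  rw [this, lt_iff, zero_add]
  exact le_iff.2 ⟨_, rfl⟩

theorem mul_lt_mul_left' (a b c : M) (h : a < b) (hc : 0 < c) : c * a < c * b := by
  obtain ⟨d, rfl⟩ := le_iff.1 (lt_iff.1 h)
  have : c * (d + (a + 1)) = c * a + (c * d + c) := by ring
  rw [this]
  refine lt_add_of_pos_right _ (lt_of_lt_of_le hc ?_)
  exact le_iff.2 ⟨_, rfl⟩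

instance : ZeroLEOneClass M := ⟨zero_le⟩

instance : IsStrictOrderedRing M where
  mul_lt_mul_of_pos_left c hc a b h := mul_lt_mul_left' a b c h hc
  mul_lt_mul_of_pos_right c hc a b h := by
    simp only [mul_comm _ c]; exact mul_lt_mul_left' a b c h hc
end PAM
end Guaspari

open FirstOrder Language
open scoped FirstOrder

namespace Guaspari

/-! ### Substitution for definability with parameters -/
section dmsub
variable {M : Type} [LA.Structure M]

theorem Tm.sub {k : ℕ} {α : Type} (v : α → M) {j : ℕ} (t : LA.Term (α ⊕ Fin j))
    (g : Fin j → Tup k M → M) (h : ∀ i, Tm (g i)) :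
    Tm (fun p : Tup k M => t.realize (Sum.elim v (fun i => g i p))) := by
  induction t with
  | var x =>
    rcases x with a | i
    · exact Tm.const (v a)
    · exact h i
  | func f ts ih =>
    have := fun i => (ih i).out
    choose u hu using this
    refine ⟨Term.func f u, fun p => ?_⟩
    simp only [Term.realize, hu]

theorem Dm.sub0 {α : Type} (v : α → M) {j : ℕ} (φ : LA.BoundedFormula α j) :
    ∀ {k : ℕ} (g : Fin j → Tup k M → M) (_ : ∀ i, Tm (g i)),
    Dm (fun p : Tup k M => φ.Realize v (fun i => g i p)) := by
  induction φ with
  | falsum => intro k g h; exact ⟨⊥, fun p => Iff.rfl⟩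
  | equal t u =>
    intro k g h
    have := Tm.sub v t g h
    have := Tm.sub v u g h
    exact Dm.eq
  | rel R ts =>
    intro k g h
    have := fun i => (Tm.sub v (ts i) g h).out
    choose u hu using this
    refine ⟨BoundedFormula.rel R u, fun p => ?_⟩
    simp only [BoundedFormula.Realize, hu]
  | imp φ ψ ih1 ih2 =>
    intro k g h
    have := ih1 g h
    have := ih2 g h
    exact Dm.imp (f := fun p : Tup k M => φ.Realize v (fun i => g i p))
      (g := fun p : Tup k M => ψ.Realize v (fun i => g i p))
  | @all j φ ih =>
    intro k g h
    have h1 : ∀ i, Tm (k := k + 1) ((Fin.snoc (α := fun _ => Tup (k+1) M → M)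
        (fun i (p : Tup (k+1) M) => g i p.1) (fun p => p.2) :
        Fin (j + 1) → Tup (k+1) M → M) i) := by
      intro i
      refine Fin.lastCases ?_ (fun i => ?_) i
      · rw [Fin.snoc_last]; infer_instance
      · rw [Fin.snoc_castSucc]
        obtain ⟨t, ht⟩ := (h i).out
        refine ⟨t.relabel (Sum.map id Fin.castSucc), fun p => ?_⟩
        rw [Term.realize_relabel, ← ht]
        congr 1
        funext x
        rcases x with x | x
        · rfl
        · simp [tv]
    have h2 := ih _ h1
    have : Dm (fun p : Tup k M => ∀ y, φ.Realize v (Fin.snoc (fun i => g i p) y)) := by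
      refine @Dm.all _ _ _ _ ?_
      convert h2 using 4 with p
      rename_i i
      refine Fin.lastCases ?_ (fun i => ?_) i <;> simp
    exact this

theorem Dm.sub {j k : ℕ} {P : Tup j M → Prop} (hP : Dm P) (g : Tup k M → Tup j M)
    (hg : ∀ i, Tm (fun p => tv (g p) i)) : Dm (fun p => P (g p)) := by
  obtain ⟨φ, hφ⟩ := hP.out
  have := Dm.sub0 id φ (fun i p => tv (g p) i) hg
  convert this using 2 with p
  exact (hφ _).symm
end dmsub

/-! ### Uniform definability -/

/-- uniform term functions -/
class UT {k : ℕ} (f : ∀ M : PAM, Tup k M → M) : Prop where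
  out : ∃ t : LA.Term (Empty ⊕ Fin k), ∀ (M : PAM) p, t.realize (Sum.elim default (tv p)) = f M p
/-- uniform tuples of term functions -/
class UTT {k j : ℕ} (f : ∀ M : PAM, Tup k M → Tup j M) : Prop where
  out : ∀ i, UT (fun M p => tv (f M p) i)
/-- uniformly Δ0 definable -/
class Dl {k : ℕ} (P : ∀ M : PAM, Tup k M → Prop) : Prop where
  out : ∃ φ : LA.BoundedFormula Empty k, IsDelta0 φ ∧ ∀ (M : PAM) p, φ.Realize default (tv p) ↔ P M p

section ut
variable {k j : ℕ}
instance UTT.id' : UTT (fun (M : PAM) (p : Tup k M) => p) :=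
  ⟨fun i => ⟨Term.var (Sum.inr i), fun _ _ => rfl⟩⟩
instance UTT.fst {f : ∀ M : PAM, Tup k M → Tup (j + 1) M} [h : UTT f] :
    UTT (j := j) (fun M p => (f M p).1) := by
  refine ⟨fun i => ?_⟩
  have := h.out i.castSucc
  simpa [tv] using this
instance UT.snd {f : ∀ M : PAM, Tup k M → Tup (j + 1) M} [h : UTT f] :
    UT (fun M p => (f M p).2) := by
  have := h.out (Fin.last j)
  simpa [tv] using this
instance UTT.unit : UTT (j := 0) (fun (M : PAM) (_ : Tup k M) => ()) := ⟨fun i => i.elim0⟩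
/-- tuple extension -/
def tc {k : ℕ} {M : Type} (p : Tup k M) (y : M) : Tup (k + 1) M := (p, y)
instance UTT.pr {f : ∀ M : PAM, Tup k M → Tup j M} {g : ∀ M : PAM, Tup k M → M}
    [h : UTT f] [hg : UT g] : UTT (j := j + 1) (fun M p => tc (f M p) (g M p)) := by
  refine ⟨fun i => ?_⟩
  refine Fin.lastCases ?_ (fun i => ?_) i
  · simpa [tv, tc] using hg
  · have := h.out i
    simpa [tv, tc] using this
instance UT.zero : UT (fun (M : PAM) (_ : Tup k M) => (0 : M)) :=
  ⟨zeroT, fun _ _ => by rw [realize_zeroT]; rfl⟩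
instance UT.add {f g : ∀ M : PAM, Tup k M → M} [hf : UT f] [hg : UT g] :
    UT (fun M p => f M p + g M p) := by
  obtain ⟨t, ht⟩ := hf.out
  obtain ⟨u, hu⟩ := hg.out
  exact ⟨addT t u, fun M p => by rw [realize_addT, ht, hu]; rfl⟩
instance UT.mul {f g : ∀ M : PAM, Tup k M → M} [hf : UT f] [hg : UT g] :
    UT (fun M p => f M p * g M p) := by
  obtain ⟨t, ht⟩ := hf.out
  obtain ⟨u, hu⟩ := hg.out
  exact ⟨mulT t u, fun M p => by rw [realize_mulT, ht, hu]; rfl⟩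
theorem UT.cast (n : ℕ) : UT (fun (M : PAM) (_ : Tup k M) => (n : M)) := by
  induction n with
  | zero => simpa using UT.zero
  | succ n ih =>
    obtain ⟨t, ht⟩ := ih.out
    refine ⟨succT t, fun M p => ?_⟩
    rw [realize_succT, ht, PAM.sc_eq, Nat.cast_succ]
instance UT.cast' (n : ℕ) : UT (fun (M : PAM) (_ : Tup k M) => (n : M)) := UT.cast n
instance UT.one : UT (fun (M : PAM) (_ : Tup k M) => (1 : M)) := by
  simpa using UT.cast (k := k) 1
instance UT.ofNat (n : ℕ) [n.AtLeastTwo] : UT (fun (M : PAM) (_ : Tup k M) => (OfNat.ofNat n : M)) := by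
  exact UT.cast (k := k) n

theorem UT.sub {f : ∀ M : PAM, Tup j M → M} (hf : UT f) (g : ∀ M : PAM, Tup k M → Tup j M)
    [hg : UTT g] : UT (fun M p => f M (g M p)) := by
  obtain ⟨t, ht⟩ := hf.out
  have := fun i => (hg.out i).out
  choose u hu using this
  refine ⟨t.subst (Sum.elim (fun a => a.elim) u), fun M p => ?_⟩
  rw [Term.realize_subst, ← ht]
  congr 1
  funext x
  rcases x with x | x
  · exact x.elim
  · simp [hu]

theorem UTT.comp {i : ℕ} {f : ∀ M : PAM, Tup j M → Tup i M} (hf : UTT f)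
    (g : ∀ M : PAM, Tup k M → Tup j M)
    [hg : UTT g] : UTT (fun M p => f M (g M p)) := ⟨fun i => UT.sub (hf.out i) g⟩

/-- lifting of a term function as the bound in a quantifier -/
theorem relabel_castSucc {t : LA.Term (Empty ⊕ Fin k)} {M : PAM} (p : Tup k M) (y : M) :
    (t.relabel (Sum.map id Fin.castSucc)).realize
      (Sum.elim (default : Empty → M) (Fin.snoc (tv p) y : Fin (k+1) → M)) =
      t.realize (Sum.elim default (tv p)) := by
  rw [Term.realize_relabel]
  congr 1
  funext x
  rcases x with x | x
  · rfl
  · simp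

instance Dl.eq {f g : ∀ M : PAM, Tup k M → M} [hf : UT f] [hg : UT g] :
    Dl (fun M p => f M p = g M p) := by
  obtain ⟨t, ht⟩ := hf.out
  obtain ⟨u, hu⟩ := hg.out
  exact ⟨t =' u, .equal _ _, fun M p => by rw [BoundedFormula.realize_bdEqual, ht, hu]⟩
instance Dl.le {f g : ∀ M : PAM, Tup k M → M} [hf : UT f] [hg : UT g] :
    Dl (fun M p => f M p ≤ g M p) := by
  obtain ⟨t, ht⟩ := hf.out
  obtain ⟨u, hu⟩ := hg.out
  exact ⟨leF t u, .le _ _, fun M p => by rw [realize_leF, ht, hu]; rfl⟩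
instance Dl.fls : Dl (fun (M : PAM) (_ : Tup k M) => False) :=
  ⟨⊥, .falsum, fun _ _ => Iff.rfl⟩
instance Dl.imp {P Q : ∀ M : PAM, Tup k M → Prop} [hP : Dl P] [hQ : Dl Q] :
    Dl (fun M p => P M p → Q M p) := by
  obtain ⟨φ, h1, h2⟩ := hP.out
  obtain ⟨ψ, h3, h4⟩ := hQ.out
  exact ⟨φ ⟹ ψ, .imp h1 h3, fun M p => by rw [BoundedFormula.realize_imp, h2, h4]⟩
instance Dl.not {P : ∀ M : PAM, Tup k M → Prop} [hP : Dl P] : Dl (fun M p => ¬ P M p) :=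
  Dl.imp (Q := fun _ _ => False)
instance Dl.and {P Q : ∀ M : PAM, Tup k M → Prop} [hP : Dl P] [hQ : Dl Q] :
    Dl (fun M p => P M p ∧ Q M p) := by
  have : Dl (fun M p => ¬ (P M p → ¬ Q M p)) := inferInstance
  simpa using this
instance Dl.or {P Q : ∀ M : PAM, Tup k M → Prop} [hP : Dl P] [hQ : Dl Q] :
    Dl (fun M p => P M p ∨ Q M p) := by
  have : Dl (fun M p => (¬ P M p → Q M p)) := inferInstance
  simpa only [or_iff_not_imp_left] using this
instance Dl.iff {P Q : ∀ M : PAM, Tup k M → Prop} [hP : Dl P] [hQ : Dl Q] :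
    Dl (fun M p => (P M p ↔ Q M p)) := by
  have : Dl (fun M p => (P M p → Q M p) ∧ (Q M p → P M p)) := inferInstance
  simpa only [iff_iff_implies_and_implies] using this
instance Dl.lt {f g : ∀ M : PAM, Tup k M → M} [hf : UT f] [hg : UT g] :
    Dl (fun M p => f M p < g M p) := by
  simp only [PAM.lt_iff]
  infer_instance
instance Dl.ball {f : ∀ M : PAM, Tup k M → M} {Q : ∀ M : PAM, Tup k M → M → Prop} [hf : UT f]
    [hQ : Dl (k := k + 1) (fun M p => Q M p.1 p.2)] : Dl (fun M p => ∀ y, y ≤ f M p → Q M p y) := by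
  obtain ⟨t, ht⟩ := hf.out
  obtain ⟨ψ, h3, h4⟩ := hQ.out
  refine ⟨_, .ball t h3, fun M p => ?_⟩
  simp only [BoundedFormula.realize_all]
  refine forall_congr' fun y => ?_
  rw [BoundedFormula.realize_imp, realize_leF, relabel_castSucc, ht, realize_vT, Fin.snoc_last]
  exact imp_congr Iff.rfl (h4 M (p, y))
instance Dl.bex {f : ∀ M : PAM, Tup k M → M} {Q : ∀ M : PAM, Tup k M → M → Prop} [hf : UT f]
    [hQ : Dl (k := k + 1) (fun M p => Q M p.1 p.2)] : Dl (fun M p => ∃ y, y ≤ f M p ∧ Q M p y) := by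
  obtain ⟨t, ht⟩ := hf.out
  obtain ⟨ψ, h3, h4⟩ := hQ.out
  refine ⟨_, .bex t h3, fun M p => ?_⟩
  simp only [BoundedFormula.realize_ex]
  refine exists_congr fun y => ?_
  rw [BoundedFormula.realize_inf, realize_leF, relabel_castSucc, ht, realize_vT, Fin.snoc_last]
  exact and_congr Iff.rfl (h4 M (p, y))
instance Dl.ballt {f : ∀ M : PAM, Tup k M → M} {Q : ∀ M : PAM, Tup k M → M → Prop} [hf : UT f]
    [hQ : Dl (k := k + 1) (fun M p => Q M p.1 p.2)] : Dl (fun M p => ∀ y, y < f M p → Q M p y) := by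
  have h1 : UT (k := k + 1) (fun M p => f M p.1) := UT.sub hf (fun M (p : Tup (k+1) M) => p.1)
  have : Dl (fun M p => ∀ y, y ≤ f M p → (y < f M p → Q M p y)) := inferInstance
  convert this using 4 with M p y
  exact ⟨fun h _ => h, fun h h1 => h h1.le h1⟩
instance Dl.bext {f : ∀ M : PAM, Tup k M → M} {Q : ∀ M : PAM, Tup k M → M → Prop} [hf : UT f]
    [hQ : Dl (k := k + 1) (fun M p => Q M p.1 p.2)] : Dl (fun M p => ∃ y, y < f M p ∧ Q M p y) := by
  have h1 : UT (k := k + 1) (fun M p => f M p.1) := UT.sub hf (fun M (p : Tup (k+1) M) => p.1)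
  have : Dl (fun M p => ∃ y, y ≤ f M p ∧ (y < f M p ∧ Q M p y)) := inferInstance
  convert this using 5 with M p y
  exact ⟨fun h => ⟨h.1.le, h⟩, fun h => h.2⟩

theorem Dl.sub0 {j : ℕ} {φ : LA.BoundedFormula Empty j} (h : IsDelta0 φ) :
    ∀ {k : ℕ} (g : ∀ M : PAM, Tup k M → Tup j M) [UTT g],
    Dl (fun M p => φ.Realize default (tv (g M p))) := by
  induction h with
  | falsum => intro k g _; exact Dl.fls
  | @equal m t u =>
    intro k g _
    have h1 : UT (fun M (p : Tup m M) => t.realize (Sum.elim default (tv p))) := ⟨t, fun _ _ => rfl⟩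
    have h2 : UT (fun M (p : Tup m M) => u.realize (Sum.elim default (tv p))) := ⟨u, fun _ _ => rfl⟩
    have := UT.sub h1 g
    have := UT.sub h2 g
    simp only [BoundedFormula.realize_bdEqual]
    infer_instance
  | @le m t u =>
    intro k g _
    have h1 : UT (fun M (p : Tup m M) => t.realize (Sum.elim default (tv p))) := ⟨t, fun _ _ => rfl⟩
    have h2 : UT (fun M (p : Tup m M) => u.realize (Sum.elim default (tv p))) := ⟨u, fun _ _ => rfl⟩
    have := UT.sub h1 g
    have := UT.sub h2 g
    simp only [realize_leF]
    exact Dl.le (f := fun M (p : Tup k M) => t.realize (Sum.elim default (tv (g M p))))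
      (g := fun M (p : Tup k M) => u.realize (Sum.elim default (tv (g M p))))
  | imp _ _ ih1 ih2 =>
    intro k g _
    have := ih1 g
    have := ih2 g
    simp only [BoundedFormula.realize_imp]
    infer_instance
  | @ball m t ψ h ih =>
    intro k g hg
    have h1 : UT (fun M (p : Tup m M) => t.realize (Sum.elim default (tv p))) := ⟨t, fun _ _ => rfl⟩
    have h1' := UT.sub h1 g
    have hg' : UTT (k := k + 1) (fun M p => g M p.1) := UTT.comp hg (fun M (p : Tup (k+1) M) => p.1)
    have h2 := ih (k := k + 1) (fun M p => tc (g M p.1) p.2)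
    have := Dl.ball (f := fun M (p : Tup k M) => t.realize (Sum.elim default (tv (g M p))))
      (Q := fun M p y => ψ.Realize default (tv (tc (g M p) y)))
    convert this using 3 with M p
    simp only [BoundedFormula.realize_all]
    refine forall_congr' fun y => ?_
    rw [BoundedFormula.realize_imp, realize_leF, relabel_castSucc, realize_vT, Fin.snoc_last]
    rfl
  | @bex m t ψ h ih =>
    intro k g hg
    have h1 : UT (fun M (p : Tup m M) => t.realize (Sum.elim default (tv p))) := ⟨t, fun _ _ => rfl⟩
    have h1' := UT.sub h1 g
    have hg' : UTT (k := k + 1) (fun M p => g M p.1) := UTT.comp hg (fun M (p : Tup (k+1) M) => p.1)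
    have h2 := ih (k := k + 1) (fun M p => tc (g M p.1) p.2)
    have := Dl.bex (f := fun M (p : Tup k M) => t.realize (Sum.elim default (tv (g M p))))
      (Q := fun M p y => ψ.Realize default (tv (tc (g M p) y)))
    convert this using 3 with M p
    simp only [BoundedFormula.realize_ex]
    refine exists_congr fun y => ?_
    rw [BoundedFormula.realize_inf, realize_leF, relabel_castSucc, realize_vT, Fin.snoc_last]
    rfl

theorem Dl.sub {P : ∀ M : PAM, Tup j M → Prop} (hP : Dl P) (g : ∀ M : PAM, Tup k M → Tup j M)
    [hg : UTT g] : Dl (fun M p => P M (g M p)) := by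
  obtain ⟨φ, h1, h2⟩ := hP.out
  have := Dl.sub0 h1 g
  simpa only [h2] using this
end ut
end Guaspari

open FirstOrder Language
open scoped FirstOrder

namespace Guaspari

/-! ### The arithmetical hierarchy, semantically -/

/-- `Σ_n` predicates -/
def NS : ℕ → ∀ {k : ℕ}, (∀ M : PAM, Tup k M → Prop) → Prop
  | 0, _, P => Dl P
  | n + 1, k, P => ∃ Q : ∀ M : PAM, Tup (k + 1) M → Prop, NS n Q ∧ ∀ M p, P M p ↔ ∃ y, ¬ Q M (p, y)

theorem NS.congr {n k : ℕ} {P Q : ∀ M : PAM, Tup k M → Prop} (h : NS n P)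
    (e : ∀ M p, Q M p ↔ P M p) : NS n Q := by
  have : Q = P := funext fun M => funext fun p => propext (e M p)
  rwa [this]

theorem Dl.dm {k : ℕ} {P : ∀ M : PAM, Tup k M → Prop} (h : Dl P) (M : PAM) : Dm (P M) := by
  obtain ⟨φ, _, h2⟩ := h.out
  have := Dm.sub0 (default : Empty → M) φ (k := k) (fun i p => tv p i)
    (fun i => ⟨Term.var (Sum.inr i), fun _ => rfl⟩)
  convert this using 2 with p
  exact (h2 M p).symm

theorem NS.dm {n : ℕ} : ∀ {k : ℕ} {P : ∀ M : PAM, Tup k M → Prop} (_ : NS n P) (M : PAM), Dm (P M) := by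
  induction n with
  | zero => intro k P h M; exact Dl.dm h M
  | succ n ih =>
    intro k P h M
    obtain ⟨Q, h1, h2⟩ := h
    have := ih h1 M
    have h3 : Dm (fun p : Tup k M => ∃ y, ¬ Q M (p, y)) :=
      @Dm.ex _ _ _ _ (@Dm.not _ _ _ _ this)
    convert h3 using 2 with p
    exact h2 M p

/-- collection -/
theorem PAM.coll {M : PAM} (R : M → M → Prop) (hR : Dm (k := 2) (fun p : Tup 2 M => R p.1.2 p.2))
    (a : M) (h : ∀ x, x ≤ a → ∃ y, R x y) : ∃ b, ∀ x, x ≤ a → ∃ y, y ≤ b ∧ R x y := by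
  have hR' : Dm (k := 4) (fun p : Tup 4 M => R p.1.2 p.2) := by
    refine Dm.sub (j := 2) hR (fun p : Tup 4 M => (((), p.1.2), p.2)) (fun i => ?_)
    fin_cases i
    · exact (inferInstance : Tm (k := 4) (fun p : Tup 4 M => p.1.2))
    · exact (inferInstance : Tm (k := 4) (fun p : Tup 4 M => p.2))
  refine (PAM.ind (fun c : M => c ≤ a → ∃ b, ∀ x, x ≤ c → ∃ y, y ≤ b ∧ R x y) ?_ ?_ a) le_rfl
  · intro _
    obtain ⟨y, hy⟩ := h 0 (zero_le)
    refine ⟨y, fun x hx => ⟨y, le_rfl, ?_⟩⟩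
    have : x = 0 := le_antisymm hx zero_le
    rwa [this]
  · intro c ih hc
    obtain ⟨b, hb⟩ := ih (le_trans le_self_add hc)
    obtain ⟨y, hy⟩ := h _ hc
    refine ⟨b + y, fun x hx => ?_⟩
    rcases hx.eq_or_lt with rfl | hx
    · exact ⟨y, le_add_self, hy⟩
    · obtain ⟨z, h1, h2⟩ := hb x (PAM.lt_add1.1 hx)
      exact ⟨z, h1.trans le_self_add, h2⟩

/-- the closure properties of `NS n` -/
structure Clos (n : ℕ) : Prop where
  sub : ∀ {k j : ℕ} {P : ∀ M : PAM, Tup j M → Prop} (_ : NS n P)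
    (g : ∀ M : PAM, Tup k M → Tup j M) [UTT g], NS n (fun M p => P M (g M p))
  and : ∀ {k : ℕ} {P Q : ∀ M : PAM, Tup k M → Prop} (_ : NS n P) (_ : NS n Q),
    NS n (fun M p => P M p ∧ Q M p)
  or : ∀ {k : ℕ} {P Q : ∀ M : PAM, Tup k M → Prop} (_ : NS n P) (_ : NS n Q),
    NS n (fun M p => P M p ∨ Q M p)
  ball : ∀ {k : ℕ} {f : ∀ M : PAM, Tup k M → M} {Q : ∀ M : PAM, Tup (k + 1) M → Prop} [UT f]
    (_ : NS n Q), NS n (fun M p => ∀ y, y ≤ f M p → Q M (p, y))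
  bex : ∀ {k : ℕ} {f : ∀ M : PAM, Tup k M → M} {Q : ∀ M : PAM, Tup (k + 1) M → Prop} [UT f]
    (_ : NS n Q), NS n (fun M p => ∃ y, y ≤ f M p ∧ Q M (p, y))

theorem clos : ∀ n, Clos n
  | 0 =>
    { sub := fun h g _ => Dl.sub h g
      and := fun h1 h2 => @Dl.and _ _ _ h1 h2
      or := fun h1 h2 => @Dl.or _ _ _ h1 h2
      ball := fun {k} {f} {Q} _ h => @Dl.ball k f (fun M p y => Q M (p, y)) _ h
      bex := fun {k} {f} {Q} _ h => @Dl.bex k f (fun M p y => Q M (p, y)) _ h }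
  | n + 1 => by
    have C := clos n
    refine ⟨?_, ?_, ?_, ?_, ?_⟩
    · intro k j P ⟨Q, h1, h2⟩ g hg
      have : UTT (fun M (p : Tup (k+1) M) => g M p.1) := UTT.comp hg (fun M (p : Tup (k+1) M) => p.1)
      exact ⟨_, C.sub h1 (fun M (p : Tup (k+1) M) => tc (g M p.1) p.2),
        fun M p => h2 M _⟩
    · intro k P P' ⟨Q, h1, h2⟩ ⟨Q', h1', h2'⟩
      have a1 := C.sub h1 (fun M (p : Tup (k+3) M) => tc (p.1.1.1) p.1.2)
      have a2 := C.sub h1' (fun M (p : Tup (k+3) M) => tc (p.1.1.1) p.2)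
      have a3 := C.ball (f := fun M (p : Tup (k + 2) M) => p.1.2) (C.or a1 a2)
      have a4 := C.ball (f := fun M (p : Tup (k + 1) M) => p.2) a3
      refine ⟨_, a4, fun M p => ?_⟩
      simp only [h2, h2']
      constructor
      · rintro ⟨⟨y, hy⟩, ⟨z, hz⟩⟩
        exact ⟨y + z, fun h => by
          rcases h y le_self_add z le_add_self with h | h
          · exact hy h
          · exact hz h⟩
      · rintro ⟨w, h⟩
        push Not at h
        obtain ⟨y, _, z, _, h3, h4⟩ := h
        exact ⟨⟨y, h3⟩, ⟨z, h4⟩⟩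
    · intro k P P' ⟨Q, h1, h2⟩ ⟨Q', h1', h2'⟩
      refine ⟨_, C.and h1 h1', fun M p => ?_⟩
      simp only [h2, h2']
      rw [← exists_or]
      refine exists_congr fun y => ?_
      tauto
    · intro k f Q hf ⟨R, h1, h2⟩
      have hf' := UT.sub hf (fun M (p : Tup (k+1) M) => p.1)
      have a1 := C.sub h1 (fun M (p : Tup (k+3) M) => tc (tc p.1.1.1 p.1.2) p.2)
      have a2 := C.ball (f := fun M (p : Tup (k + 2) M) => p.1.2) a1
      have a3 := C.bex (f := fun M (p : Tup (k + 1) M) => f M p.1) a2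
      refine ⟨_, a3, fun M p => ?_⟩
      simp only [h2]
      constructor
      · intro h
        have hd : Dm (k := 2) (fun q : Tup 2 M => ¬ R M ((p, q.1.2), q.2)) := by
          have := Dm.sub (k := 2) (h1.dm M) (fun q : Tup 2 M => ((p, q.1.2), q.2)) (fun i => by
            refine Fin.lastCases ?_ (fun i => ?_) i
            · simp only [tv, Fin.snoc_last]; infer_instance
            · simp only [tv, Fin.snoc_castSucc]
              refine Fin.lastCases ?_ (fun i => ?_) i
              · simp only [Fin.snoc_last]; infer_instance
              · simp only [Fin.snoc_castSucc]; infer_instance)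
          exact Dm.not
        obtain ⟨b, hb⟩ := PAM.coll (fun x y => ¬ R M ((p, x), y)) hd _ h
        refine ⟨b, ?_⟩
        push Not
        exact hb
      · rintro ⟨b, hb⟩ x hx
        push Not at hb
        obtain ⟨y, _, hy⟩ := hb x hx
        exact ⟨y, hy⟩
    · intro k f Q hf ⟨R, h1, h2⟩
      have hf' := UT.sub hf (fun M (p : Tup (k+1) M) => p.1)
      have a1 := C.sub h1 (fun M (p : Tup (k+2) M) => tc (tc p.1.1 p.2) p.1.2)
      have a2 := C.ball (f := fun M (p : Tup (k + 1) M) => f M p.1) a1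
      refine ⟨_, a2, fun M p => ?_⟩
      simp only [h2]
      push Not
      constructor
      · rintro ⟨y, h, z, hz⟩
        exact ⟨z, y, h, hz⟩
      · rintro ⟨z, y, h, hz⟩
        exact ⟨y, h, z, hz⟩

theorem NS.ex {n k : ℕ} {P : ∀ M : PAM, Tup (k + 1) M → Prop} (h : NS (n + 1) P) :
    NS (n + 1) (fun M p => ∃ y, P M (p, y)) := by
  obtain ⟨Q, h1, h2⟩ := h
  have C := clos n
  have a1 := C.sub h1 (fun M (p : Tup (k+3) M) => tc (tc p.1.1.1 p.1.2) p.2)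
  have a2 := C.ball (f := fun M (p : Tup (k + 2) M) => p.1.2) a1
  have a3 := C.ball (f := fun M (p : Tup (k + 1) M) => p.2) a2
  refine ⟨_, a3, fun M p => ?_⟩
  simp only [h2]
  push Not
  constructor
  · rintro ⟨y, z, h⟩
    exact ⟨y + z, y, le_self_add, z, le_add_self, h⟩
  · rintro ⟨w, y, _, z, _, h⟩
    exact ⟨y, z, h⟩

theorem NS.not {n k : ℕ} {P : ∀ M : PAM, Tup k M → Prop} (h : NS n P) :
    NS (n + 1) (fun M p => ¬ P M p) :=
  ⟨_, (clos n).sub h (fun M (p : Tup (k+1) M) => p.1), fun M p => by simp⟩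

theorem NS.succ {n : ℕ} : ∀ {k : ℕ} {P : ∀ M : PAM, Tup k M → Prop} (_ : NS n P), NS (n + 1) P := by
  induction n with
  | zero =>
    intro k P h
    have : Dl (fun M p => ¬ P M p) := @Dl.not _ _ h
    exact (NS.not (n := 0) this).congr (fun M p => by simp)
  | succ n ih =>
    intro k P ⟨Q, h1, h2⟩
    exact ⟨Q, ih h1, h2⟩

theorem NS.ofDl {k : ℕ} {P : ∀ M : PAM, Tup k M → Prop} (h : Dl P) : ∀ n, NS n P
  | 0 => h
  | n + 1 => (NS.ofDl h n).succ

theorem NS.ofFml {n k : ℕ} {φ : LA.BoundedFormula Empty k} :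
    (IsSigmaFml n φ → NS n (fun M (p : Tup k M) => φ.Realize default (tv p))) ∧
    (IsPiFml n φ → NS n (fun M (p : Tup k M) => ¬ φ.Realize default (tv p))) := by
  constructor
  · intro h
    refine IsSigmaFml.rec
      (motive_1 := fun n k φ _ => NS n (fun M (p : Tup k M) => φ.Realize default (tv p)))
      (motive_2 := fun n k φ _ => NS n (fun M (p : Tup k M) => ¬ φ.Realize default (tv p)))
      ?_ ?_ ?_ ?_ ?_ ?_ h
    · intro m φ h; exact ⟨φ, h, fun _ _ => Iff.rfl⟩
    · intro k m φ _ ih; exact (NS.not ih).congr (fun M p => by simp)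
    · intro k m φ _ ih; exact (NS.ex ih).congr (fun M p => by
        rw [BoundedFormula.realize_ex]; rfl)
    · intro m φ h; exact @Dl.not _ _ ⟨φ, h, fun _ _ => Iff.rfl⟩
    · intro k m φ _ ih; exact (NS.not ih)
    · intro k m φ _ ih; exact (NS.ex ih).congr (fun M p => by
        rw [BoundedFormula.realize_all, not_forall]; rfl)
  · intro h
    refine IsPiFml.rec
      (motive_1 := fun n k φ _ => NS n (fun M (p : Tup k M) => φ.Realize default (tv p)))
      (motive_2 := fun n k φ _ => NS n (fun M (p : Tup k M) => ¬ φ.Realize default (tv p)))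
      ?_ ?_ ?_ ?_ ?_ ?_ h
    · intro m φ h; exact ⟨φ, h, fun _ _ => Iff.rfl⟩
    · intro k m φ _ ih; exact (NS.not ih).congr (fun M p => by simp)
    · intro k m φ _ ih; exact (NS.ex ih).congr (fun M p => by
        rw [BoundedFormula.realize_ex]; rfl)
    · intro m φ h; exact @Dl.not _ _ ⟨φ, h, fun _ _ => Iff.rfl⟩
    · intro k m φ _ ih; exact (NS.not ih)
    · intro k m φ _ ih; exact (NS.ex ih).congr (fun M p => by
        rw [BoundedFormula.realize_all, not_forall]; rfl)

theorem NS.toFml {n : ℕ} : ∀ {k : ℕ} {P : ∀ M : PAM, Tup k M → Prop} (_ : NS n P),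
    (∃ φ : LA.BoundedFormula Empty k, IsSigmaFml n φ ∧
      ∀ (M : PAM) p, φ.Realize default (tv p) ↔ P M p) ∧
    (∃ φ : LA.BoundedFormula Empty k, IsPiFml n φ ∧
      ∀ (M : PAM) p, φ.Realize default (tv p) ↔ ¬ P M p) := by
  induction n with
  | zero =>
    intro k P h
    obtain ⟨φ, h1, h2⟩ := Dl.out (self := h)
    obtain ⟨ψ, h3, h4⟩ := (@Dl.not _ _ h).out
    exact ⟨⟨φ, .ofDelta0 h1, h2⟩, ⟨ψ, .ofDelta0 h3, h4⟩⟩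
  | succ n ih =>
    intro k P ⟨Q, h1, h2⟩
    obtain ⟨⟨φ, h3, h4⟩, ⟨ψ, h5, h6⟩⟩ := ih h1
    refine ⟨⟨∃' ψ, .ex (.ofPi h5), fun M p => ?_⟩, ⟨∀' φ, .all (.ofSigma h3), fun M p => ?_⟩⟩
    · rw [h2, BoundedFormula.realize_ex]
      exact exists_congr fun y => h6 M (p, y)
    · rw [h2, BoundedFormula.realize_all, not_exists]
      simp only [not_not]
      exact forall_congr' fun y => h4 M (p, y)
end Guaspari

open FirstOrder Language
open scoped FirstOrder

namespace Guaspari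
open PAM

/-! ### Pairing and coded sets in models of PA -/

/-- pairing -/
def pr {M : PAM} (x y : M) : M := (x + y) * (x + y) + x
/-- membership in coded sets -/
def Mem {M : PAM} (s i : M) : Prop :=
  ∃ a, a ≤ s ∧ ∃ m, m ≤ s ∧ ∃ b, b ≤ s ∧ s = pr (pr a m) b ∧ i ≤ b ∧
    ∃ q, q ≤ a ∧ a = (1 + (i + 1) * m) * q

section inst
variable {k : ℕ}
instance UT.pr {f g : ∀ M : PAM, Tup k M → M} [UT f] [UT g] : UT (fun M p => pr (f M p) (g M p)) := by
  unfold Guaspari.pr; infer_instance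
instance Tm.pr {M : PAM} {f g : Tup k M → M} [Tm f] [Tm g] : Tm (fun p => pr (f p) (g p)) := by
  unfold Guaspari.pr; infer_instance

theorem Dl.mem0 : Dl (fun (M : PAM) (p : Tup 2 M) => Mem p.1.2 p.2) := by
  unfold Mem; infer_instance

theorem Dl.bin {R : ∀ {M : PAM}, M → M → Prop} (h : Dl (fun (M : PAM) (p : Tup 2 M) => R p.1.2 p.2))
    (f g : ∀ M : PAM, Tup k M → M) [UT f] [UT g] : Dl (fun M p => R (f M p) (g M p)) :=
  Dl.sub h (fun M p => tc (tc (k := 0) () (f M p)) (g M p))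

theorem Dm.bin {R : ∀ {M : PAM}, M → M → Prop} (h : Dl (fun (M : PAM) (p : Tup 2 M) => R p.1.2 p.2))
    {M : PAM} (f g : Tup k M → M) [hf : Tm f] [hg : Tm g] : Dm (fun p => R (f p) (g p)) := by
  refine Dm.sub (j := 2) (h.dm M) (fun p : Tup k M => (((), f p), g p)) (fun i => ?_)
  fin_cases i
  · exact hf
  · exact hg

instance Dl.mem {f g : ∀ M : PAM, Tup k M → M} [UT f] [UT g] : Dl (fun M p => Mem (f M p) (g M p)) :=
  Dl.bin Dl.mem0 f g
instance Dm.mem {M : PAM} {f g : Tup k M → M} [Tm f] [Tm g] : Dm (fun p => Mem (f p) (g p)) :=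
  Dm.bin Dl.mem0 f g
instance Dm.dvd {M : PAM} {f g : Tup k M → M} [hf : Tm f] [hg : Tm g] : Dm (fun p => f p ∣ g p) := by
  have h : Dl (fun (M : PAM) (p : Tup 2 M) => p.1.2 ∣ p.2) := by
    have : Dl (fun (M : PAM) (p : Tup 2 M) => (p.2 = 0) ∨ ∃ q, q ≤ p.2 ∧ p.2 = p.1.2 * q) :=
      inferInstance
    convert this using 3 with M p
    constructor
    · rintro ⟨q, hq⟩
      rcases eq_zero_or p.1.2 with h | ⟨w, h⟩
      · left; rw [hq, h, zero_mul]
      · right; exact ⟨q, by rw [hq, h, add_mul, one_mul]; exact le_add_self, hq⟩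
    · rintro (h | ⟨q, _, hq⟩)
      · rw [h]; exact dvd_zero _
      · exact ⟨q, hq⟩
  exact Dm.bin h f g
instance Dm.lt {M : PAM} {f g : Tup k M → M} [hf : Tm f] [hg : Tm g] : Dm (fun p => f p < g p) := by
  simp only [PAM.lt_iff]; infer_instance
instance Dm.iff {M : PAM} {f g : Tup k M → Prop} [hf : Dm f] [hg : Dm g] :
    Dm (fun p => (f p ↔ g p)) := by
  simp only [iff_iff_implies_and_implies]; infer_instance
instance Dm.const {M : PAM} {P : Prop} : Dm (fun _ : Tup k M => P) := by
  by_cases h : P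
  · exact ⟨⊤, fun p => by simp [h]⟩
  · exact ⟨⊥, fun p => by simp [h]⟩
end inst

section coding
variable {M : PAM}

theorem le_pr_left (x y : M) : x ≤ pr x y := le_add_self
theorem le_pr_right (x y : M) : y ≤ pr x y := by
  unfold pr
  rcases eq_zero_or y with rfl | ⟨z, rfl⟩
  · exact zero_le
  · have : (x + (z + 1)) * (x + (z + 1)) + x = (z + 1) + ((x + z) * (x + z) + 2 * x + x + z) := by ring
    rw [this]; exact le_self_add
theorem pr_mono {x y x' y' : M} (h : x ≤ x') (h' : y ≤ y') : pr x y ≤ pr x' y' := by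
  unfold pr; gcongr
theorem pr_sum {x y x' y' : M} (h : pr x y = pr x' y') : x + y ≤ x' + y' := by
  by_contra hlt
  push Not at hlt
  have h1 : x' + y' + 1 ≤ x + y := lt_iff.1 hlt
  have h2 : pr x' y' < pr x y := by
    calc pr x' y' ≤ (x' + y') * (x' + y') + (x' + y') := by unfold pr; gcongr; exact le_self_add
      _ < (x' + y' + 1) * (x' + y' + 1) := by
        have : (x' + y' + 1) * (x' + y' + 1) = ((x' + y') * (x' + y') + (x' + y')) + (x' + y') + 1 := by ring
        rw [this, lt_add1]; exact le_self_add
      _ ≤ (x + y) * (x + y) := by gcongr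
      _ ≤ _ := le_self_add
  exact absurd h (ne_of_gt h2)
@[simp] theorem pr_inj {x y x' y' : M} : pr x y = pr x' y' ↔ x = x' ∧ y = y' := by
  constructor
  · intro h
    have hs : x + y = x' + y' := le_antisymm (pr_sum h) (pr_sum h.symm)
    unfold pr at h
    rw [hs] at h
    have hx := add_left_cancel h
    subst hx
    exact ⟨rfl, add_left_cancel hs⟩
  · rintro ⟨rfl, rfl⟩; rfl

theorem mem_iff {a m b i : M} :
    Mem (pr (pr a m) b) i ↔ i ≤ b ∧ (1 + (i + 1) * m) ∣ a := by
  constructor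
  · rintro ⟨a', _, m', _, b', _, h, h1, q, _, h2⟩
    simp only [pr_inj] at h
    obtain ⟨⟨rfl, rfl⟩, rfl⟩ := h
    exact ⟨h1, q, h2⟩
  · rintro ⟨h1, q, h2⟩
    refine ⟨a, (le_pr_left _ _).trans (le_pr_left _ _), m, (le_pr_right _ _).trans (le_pr_left _ _), b,
      le_pr_right _ _, rfl, h1, q, ?_, h2⟩
    rw [h2, add_mul, one_mul]
    exact le_self_add

theorem mem_le {s i : M} (h : Mem s i) : i ≤ s := by
  obtain ⟨a', _, m', _, b', hb, h, h1, _⟩ := h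
  exact h1.trans hb

theorem dvd_cancel {d x y : M} (hd : 0 < d) (h1 : d ∣ x) (h2 : d ∣ x + y) : d ∣ y := by
  obtain ⟨q, rfl⟩ := h1
  obtain ⟨r, h⟩ := h2
  have : q ≤ r := by
    by_contra hlt
    push Not at hlt
    have := mul_lt_mul_of_pos_left hlt hd
    rw [← h] at this
    exact absurd le_self_add (not_le.2 this)
  obtain ⟨w, rfl⟩ := exists_add_of_le this
  exact ⟨w, by rw [mul_add] at h; exact add_left_cancel h⟩

theorem dvd_aux {a m i t : M} (ht : t ∣ m) (h : (1 + (i + 1) * m) ∣ a * (t * m)) :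
    (1 + (i + 1) * m) ∣ a := by
  obtain ⟨k, hk⟩ := ht
  set x := (i + 1) * m with hx
  have hd : 0 < 1 + x := by rw [lt_iff, zero_add]; exact le_self_add
  have h1 : (1 + x) ∣ a * x * x := by
    have : a * x * x = a * (t * m) * (k * (i + 1) * (i + 1)) := by
      rw [hx]; nth_rw 2 [hk]; ring
    rw [this]; exact Dvd.dvd.mul_right h _
  have h2 : (1 + x) ∣ a * x := dvd_cancel hd h1 ⟨a * x, by ring⟩
  exact dvd_cancel hd h2 ⟨a, by ring⟩

theorem coprime_aux {a m b i j : M} (hm : ∀ t, t ≤ b → (t + 1) ∣ m) (hi : i ≤ b) (hj : j ≤ b)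
    (hij : i ≠ j) (h : (1 + (i + 1) * m) ∣ a * (1 + (j + 1) * m)) : (1 + (i + 1) * m) ∣ a := by
  have hd : 0 < 1 + (i + 1) * m := by rw [lt_iff, zero_add]; exact le_self_add
  rcases lt_or_gt_of_ne hij with hlt | hlt
  · obtain ⟨u, hu⟩ := le_iff.1 (lt_iff.1 hlt)
    have hu' : u ≤ b := by rw [← hu] at hj; exact le_self_add.trans hj
    refine dvd_aux (hm u hu') ?_
    refine dvd_cancel (x := a * (1 + (i + 1) * m)) hd ⟨a, by ring⟩ ?_
    convert h using 1
    rw [← hu]; ring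
  · obtain ⟨u, hu⟩ := le_iff.1 (lt_iff.1 hlt)
    have hu' : u ≤ b := by rw [← hu] at hi; exact le_self_add.trans hi
    refine dvd_aux (hm u hu') ?_
    refine dvd_cancel hd h ⟨a, ?_⟩
    rw [← hu]; ring

theorem exists_lcm (b : M) : ∃ m : M, 0 < m ∧ ∀ t, t ≤ b → (t + 1) ∣ m := by
  refine PAM.ind (fun b : M => ∃ m : M, 0 < m ∧ ∀ t, t ≤ b → (t + 1) ∣ m) ?_ ?_ b
  · refine ⟨1, zero_lt_one, fun t ht => ?_⟩
    have : t = 0 := le_antisymm ht zero_le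
    rw [this, zero_add]
  · rintro b ⟨m, h1, h2⟩
    refine ⟨m * (b + 1 + 1), mul_pos h1 (lt_of_lt_of_le zero_lt_one le_add_self), fun t ht => ?_⟩
    rcases ht.eq_or_lt with rfl | ht
    · exact dvd_mul_left _ _
    · exact Dvd.dvd.mul_right (h2 t (lt_add1.1 ht)) _

/-- comprehension -/
theorem compr (P : M → Prop) (hP : Dm (k := 1) fun p : Tup 1 M => P p.2) (b : M) :
    ∃ s : M, b ≤ s ∧ ∀ i, Mem s i ↔ i ≤ b ∧ P i := by
  obtain ⟨m, hm, hm'⟩ := exists_lcm b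
  have hP' : Dm (k := 3) fun p : Tup 3 M => P p.2 := Dm.sub hP (fun p : Tup 3 M => ((), p.2)) (fun i => by
    fin_cases i
    exact (inferInstance : Tm (k := 3) (fun p : Tup 3 M => p.2)))
  have key : ∀ c : M, ∃ a : M, 0 < a ∧ ∀ i, i ≤ b → ((1 + (i + 1) * m) ∣ a ↔ i < c ∧ P i) := by
    refine PAM.ind (fun c : M => ∃ a : M, 0 < a ∧ ∀ i, i ≤ b → ((1 + (i + 1) * m) ∣ a ↔ i < c ∧ P i)) ?_ ?_
    · refine ⟨1, zero_lt_one, fun i _ => ⟨fun h => ?_, fun h => absurd h.1 (by simp)⟩⟩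
      obtain ⟨q, hq⟩ := h
      exfalso
      have h1 : 0 < q := by
        rcases eq_zero_or q with rfl | ⟨r, rfl⟩
        · simp at hq
        · rw [lt_iff, zero_add]; exact le_add_self
      have h2 : 0 < (i + 1) * m * q :=
        mul_pos (mul_pos (lt_of_lt_of_le zero_lt_one le_add_self) hm) h1
      rw [add_mul, one_mul] at hq
      have : (1 : M) < 1 := by
        calc (1 : M) ≤ q := by rwa [lt_iff, zero_add] at h1
          _ < q + (i + 1) * m * q := lt_add_of_pos_right _ h2
          _ = 1 := hq.symm
      exact lt_irrefl _ this
    · rintro c ⟨a, ha, h⟩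
      by_cases hc : c ≤ b ∧ P c
      · have hd : 0 < 1 + (c + 1) * m := by rw [lt_iff, zero_add]; exact le_self_add
        refine ⟨a * (1 + (c + 1) * m), mul_pos ha hd, fun i hi => ?_⟩
        by_cases hic : i = c
        · subst hic
          exact ⟨fun _ => ⟨lt_add1.2 le_rfl, hc.2⟩, fun _ => dvd_mul_left _ _⟩
        · have e1 : (i < c + 1 ∧ P i) ↔ (i < c ∧ P i) := by
            rw [lt_add1, le_iff_lt_or_eq]; simp [hic]
          rw [e1, ← h i hi]
          exact ⟨fun h => coprime_aux hm' hi hc.1 hic h, fun h => Dvd.dvd.mul_right h _⟩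
      · refine ⟨a, ha, fun i hi => ?_⟩
        rw [h i hi]
        constructor
        · rintro ⟨h1, h2⟩; exact ⟨h1.trans (lt_add1.2 le_rfl), h2⟩
        · rintro ⟨h1, h2⟩
          rw [lt_add1] at h1
          rcases h1.eq_or_lt with rfl | h1
          · exact absurd ⟨hi, h2⟩ hc
          · exact ⟨h1, h2⟩
  obtain ⟨a, ha, h⟩ := key (b + 1)
  refine ⟨pr (pr a m) b, le_pr_right _ _, fun i => ?_⟩
  rw [mem_iff]
  constructor
  · rintro ⟨h1, h2⟩; exact ⟨h1, ((h i h1).1 h2).2⟩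
  · rintro ⟨h1, h2⟩; exact ⟨h1, (h i h1).2 ⟨lt_add1.2 h1, h2⟩⟩

end coding
end Guaspari

open FirstOrder Language
open scoped FirstOrder

namespace Guaspari
open PAM

/-! ### Evaluation certificates -/

/-- value of the binary operations -/
def Op {M : PAM} (tag v1 v2 v : M) : Prop :=
  (tag = 3 ∧ v = v1 + v2) ∨ (tag = 4 ∧ v = v1 * v2) ∨
  (tag = 5 ∧ ((v1 = v2 ∧ v = 1) ∨ (¬ v1 = v2 ∧ v = 0))) ∨
  (tag = 6 ∧ ((v1 ≤ v2 ∧ v = 1) ∨ (¬ v1 ≤ v2 ∧ v = 0))) ∨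
  (tag = 7 ∧ (((v1 = 1 → v2 = 1) ∧ v = 1) ∨ (¬ (v1 = 1 → v2 = 1) ∧ v = 0)))

/-- evaluation rules -/
def Rule {M : PAM} (s w c env v : M) : Prop :=
  (c = pr 0 0 ∧ ∃ e', e' ≤ w ∧ env = pr v e') ∨
  (∃ c1, c1 ≤ w ∧ ∃ a, a ≤ w ∧ ∃ e', e' ≤ w ∧ c = pr 1 c1 ∧ env = pr a e' ∧ Mem s (pr c1 (pr e' v))) ∨
  (c = pr 2 v) ∨
  (∃ tag, tag ≤ w ∧ ∃ c1, c1 ≤ w ∧ ∃ c2, c2 ≤ w ∧ ∃ v1, v1 ≤ s ∧ ∃ v2, v2 ≤ s ∧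
    c = pr tag (pr c1 c2) ∧ Mem s (pr c1 (pr env v1)) ∧ Mem s (pr c2 (pr env v2)) ∧ Op tag v1 v2 v) ∨
  (∃ c0, c0 ≤ w ∧ ∃ c1, c1 ≤ w ∧ ∃ v0, v0 ≤ s ∧
    c = pr 8 (pr c0 c1) ∧ Mem s (pr c0 (pr env v0)) ∧
    (((∀ y, y ≤ v0 → Mem s (pr c1 (pr (pr y env) 1))) ∧ v = 1) ∨
      ((∃ y, y ≤ v0 ∧ Mem s (pr c1 (pr (pr y env) 0))) ∧ v = 0)))

/-- justification of a claim -/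
def Just {M : PAM} (s w : M) : Prop :=
  ∃ c, c ≤ w ∧ ∃ env, env ≤ w ∧ ∃ v, v ≤ w ∧ w = pr c (pr env v) ∧ Rule s w c env v

/-- certificates -/
def Cert {M : PAM} (s : M) : Prop := ∀ w, w ≤ s → Mem s w → Just s w

instance Dl.op {k : ℕ} {f g h i : ∀ M : PAM, Tup k M → M} [UT f] [UT g] [UT h] [UT i] :
    Dl (fun M p => Op (f M p) (g M p) (h M p) (i M p)) := by
  unfold Op
  infer_instance

theorem Dl.rule1 : Dl (fun (M : PAM) (p : Tup 5 M) =>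
  (p.1.1.2 = pr 0 0 ∧ ∃ e', e' ≤ p.1.1.1.2 ∧ p.1.2 = pr p.2 e')) := by infer_instance
theorem Dl.rule2 : Dl (fun (M : PAM) (p : Tup 5 M) =>
  (∃ c1, c1 ≤ p.1.1.1.2 ∧ ∃ a, a ≤ p.1.1.1.2 ∧ ∃ e', e' ≤ p.1.1.1.2 ∧
    p.1.1.2 = pr 1 c1 ∧ p.1.2 = pr a e' ∧ Mem p.1.1.1.1.2 (pr c1 (pr e' p.2)))) := by infer_instance
theorem Dl.rule3 : Dl (fun (M : PAM) (p : Tup 5 M) => p.1.1.2 = pr 2 p.2) := by infer_instance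
set_option synthInstance.maxHeartbeats 1000000 in
set_option synthInstance.maxSize 2000 in
theorem Dl.rule4 : Dl (fun (M : PAM) (p : Tup 5 M) =>
  (∃ tag, tag ≤ p.1.1.1.2 ∧ ∃ c1, c1 ≤ p.1.1.1.2 ∧ ∃ c2, c2 ≤ p.1.1.1.2 ∧ ∃ v1, v1 ≤ p.1.1.1.1.2 ∧
    ∃ v2, v2 ≤ p.1.1.1.1.2 ∧
    p.1.1.2 = pr tag (pr c1 c2) ∧ Mem p.1.1.1.1.2 (pr c1 (pr p.1.2 v1)) ∧
    Mem p.1.1.1.1.2 (pr c2 (pr p.1.2 v2)) ∧ Op tag v1 v2 p.2)) := by infer_instance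
set_option synthInstance.maxHeartbeats 1000000 in
set_option synthInstance.maxSize 2000 in
theorem Dl.rule5 : Dl (fun (M : PAM) (p : Tup 5 M) =>
  (∃ c0, c0 ≤ p.1.1.1.2 ∧ ∃ c1, c1 ≤ p.1.1.1.2 ∧ ∃ v0, v0 ≤ p.1.1.1.1.2 ∧
    p.1.1.2 = pr 8 (pr c0 c1) ∧ Mem p.1.1.1.1.2 (pr c0 (pr p.1.2 v0)) ∧
    (((∀ y, y ≤ v0 → Mem p.1.1.1.1.2 (pr c1 (pr (pr y p.1.2) 1))) ∧ p.2 = 1) ∨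
      ((∃ y, y ≤ v0 ∧ Mem p.1.1.1.1.2 (pr c1 (pr (pr y p.1.2) 0))) ∧ p.2 = 0)))) := by infer_instance

theorem Dl.rule0 : Dl (fun (M : PAM) (p : Tup 5 M) => Rule p.1.1.1.1.2 p.1.1.1.2 p.1.1.2 p.1.2 p.2) := by
  have h1 := Dl.rule1
  have h2 := Dl.rule2
  have h3 := Dl.rule3
  have h4 := Dl.rule4
  have h5 := Dl.rule5
  exact @Dl.or _ _ _ h1 (@Dl.or _ _ _ h2 (@Dl.or _ _ _ h3 (@Dl.or _ _ _ h4 h5)))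
instance Dl.rule {k : ℕ} {a f g h i : ∀ M : PAM, Tup k M → M} [UT a] [UT f] [UT g] [UT h] [UT i] :
    Dl (fun M p => Rule (a M p) (f M p) (g M p) (h M p) (i M p)) :=
  Dl.sub Dl.rule0 (fun M p => tc (tc (tc (tc (tc (k := 0) () (a M p)) (f M p)) (g M p)) (h M p)) (i M p))

theorem Dl.just0 : Dl (fun (M : PAM) (p : Tup 2 M) => Just p.1.2 p.2) := by
  have h := Dl.rule0
  unfold Just; infer_instance
instance Dl.just {k : ℕ} {f g : ∀ M : PAM, Tup k M → M} [UT f] [UT g] :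
    Dl (fun M p => Just (f M p) (g M p)) :=
  Dl.bin Dl.just0 f g
instance Dm.just {k : ℕ} {M : PAM} {f g : Tup k M → M} [Tm f] [Tm g] : Dm (fun p => Just (f p) (g p)) :=
  Dm.bin Dl.just0 f g
instance Dl.cert {k : ℕ} {f : ∀ M : PAM, Tup k M → M} [hf : UT f] :
    Dl (fun M p => Cert (f M p)) := by
  have := UT.sub hf (fun M (p : Tup (k+1) M) => p.1)
  unfold Cert; infer_instance

section cert
variable {M : PAM}

theorem Rule.mono {s s' w c env v : M} (h : s ≤ s') (hm : ∀ i, Mem s i → Mem s' i)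
    (hr : Rule s w c env v) : Rule s' w c env v := by
  rcases hr with h1 | h1 | h1 | h1 | h1
  · exact Or.inl h1
  · obtain ⟨c1, a1, a, a2, e', a3, a4, a5, a6⟩ := h1
    exact Or.inr (Or.inl ⟨c1, a1, a, a2, e', a3, a4, a5, hm _ a6⟩)
  · exact Or.inr (Or.inr (Or.inl h1))
  · obtain ⟨t, a1, c1, a2, c2, a3, v1, a4, v2, a5, a6, a7, a8, a9⟩ := h1
    exact Or.inr (Or.inr (Or.inr (Or.inl ⟨t, a1, c1, a2, c2, a3, v1, a4.trans h, v2, a5.trans h, a6,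
      hm _ a7, hm _ a8, a9⟩)))
  · obtain ⟨c0, a1, c1, a2, v0, a3, a4, a5, a6⟩ := h1
    refine Or.inr (Or.inr (Or.inr (Or.inr ⟨c0, a1, c1, a2, v0, a3.trans h, a4, hm _ a5, ?_⟩)))
    rcases a6 with ⟨a6, a7⟩ | ⟨⟨y, a6, a8⟩, a7⟩
    · exact Or.inl ⟨fun y hy => hm _ (a6 y hy), a7⟩
    · exact Or.inr ⟨⟨y, a6, hm _ a8⟩, a7⟩

theorem Just.mono {s s' w : M} (h : s ≤ s') (hm : ∀ i, Mem s i → Mem s' i)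
    (hr : Just s w) : Just s' w := by
  obtain ⟨c, a1, e, a2, v, a3, a4, a5⟩ := hr
  exact ⟨c, a1, e, a2, v, a3, a4, a5.mono h hm⟩

theorem Cert.step {s : M} (hs : Cert s) (W : M) : ∃ s', Cert s' ∧ s ≤ s' ∧ (∀ i, Mem s i → Mem s' i) ∧
    ∀ w, w ≤ W → Just s w → Mem s' w := by
  obtain ⟨s', h1, h2⟩ := compr (fun w => Mem s w ∨ (w ≤ W ∧ Just s w)) inferInstance (s + W)
  have h3 : s ≤ s' := le_self_add.trans h1
  have h4 : ∀ i, Mem s i → Mem s' i := fun i hi => (h2 i).2 ⟨(mem_le hi).trans le_self_add, Or.inl hi⟩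
  refine ⟨s', ?_, h3, h4, fun w hw hj => (h2 w).2 ⟨hw.trans le_add_self, Or.inr ⟨hw, hj⟩⟩⟩
  intro w _ hm
  refine Just.mono h3 h4 ?_
  rcases ((h2 w).1 hm).2 with h | h
  · exact hs w (mem_le h) h
  · exact h.2

theorem Cert.union {s t : M} (hs : Cert s) (ht : Cert t) : ∃ u, Cert u ∧ (∀ i, Mem s i → Mem u i) ∧
    (∀ i, Mem t i → Mem u i) := by
  obtain ⟨u, h1, h2⟩ := compr (fun w => Mem s w ∨ Mem t w) inferInstance (s + t)
  have h4 : ∀ i, Mem s i → Mem u i := fun i hi => (h2 i).2 ⟨(mem_le hi).trans le_self_add, Or.inl hi⟩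
  have h5 : ∀ i, Mem t i → Mem u i := fun i hi => (h2 i).2 ⟨(mem_le hi).trans le_add_self, Or.inr hi⟩
  refine ⟨u, fun w _ hm => ?_, h4, h5⟩
  rcases ((h2 w).1 hm).2 with h | h
  · exact (hs w (mem_le h) h).mono (le_self_add.trans h1) h4
  · exact (ht w (mem_le h) h).mono (le_add_self.trans h1) h5

theorem Cert.empty : ∃ s : M, Cert s := by
  obtain ⟨u, h1, h2⟩ := compr (M := M) (fun w => (w < 0)) inferInstance 0
  exact ⟨u, fun w _ hm => absurd ((h2 w).1 hm).2 (by simp)⟩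

theorem Cert.inv {s c env v : M} (hs : Cert s) (h : Mem s (pr c (pr env v))) :
    Rule s (pr c (pr env v)) c env v := by
  obtain ⟨c', a1, e, a2, v', a3, a4, a5⟩ := hs _ (mem_le h) h
  simp only [pr_inj] at a4
  obtain ⟨rfl, rfl, rfl⟩ := a4
  exact a5

theorem Just.intro {s c env v : M} (h : Rule s (pr c (pr env v)) c env v) :
    Just s (pr c (pr env v)) :=
  ⟨c, le_pr_left _ _, env, (le_pr_left _ _).trans (le_pr_right _ _), v,
    (le_pr_right _ _).trans (le_pr_right _ _), rfl, h⟩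

/-- environments -/
def env : ∀ {k : ℕ}, Tup k M → M
  | 0, _ => 0
  | _ + 1, p => pr p.2 (env p.1)

/-- bounded tuples -/
def Bd : ∀ {k : ℕ}, Tup k M → M → Prop
  | 0, _, _ => True
  | _ + 1, p, B => Bd p.1 B ∧ p.2 ≤ B

theorem Bd.mono {B B' : M} (h : B ≤ B') : ∀ {k : ℕ} {p : Tup k M}, Bd p B → Bd p B'
  | 0, _, _ => trivial
  | _ + 1, _, hp => ⟨Bd.mono h hp.1, hp.2.trans h⟩

theorem exists_Bd : ∀ {k : ℕ} (p : Tup k M), ∃ B, Bd p B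
  | 0, _ => ⟨0, trivial⟩
  | k + 1, p => by
    obtain ⟨B, hB⟩ := exists_Bd p.1
    exact ⟨B + p.2, hB.mono le_self_add, le_add_self⟩

theorem env_bd (B : M) : ∀ k : ℕ, ∃ E, ∀ p : Tup k M, Bd p B → env p ≤ E
  | 0 => ⟨0, fun _ _ => le_rfl⟩
  | k + 1 => by
    obtain ⟨E, hE⟩ := env_bd B k
    exact ⟨pr B E, fun p hp => pr_mono hp.2 (hE _ hp.1)⟩
end cert

/-- evaluable uniform functions -/
def Ev {k : ℕ} (F : ∀ M : PAM, Tup k M → M) : Prop :=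
  ∃ e : ℕ, ∀ M : PAM,
    (∀ s : M, Cert s → ∀ p v, Mem s (pr (e : M) (pr (env p) v)) → v = F M p) ∧
    (∀ B : M, ∃ s : M, Cert s ∧ ∀ p : Tup k M, Bd p B → Mem s (pr (e : M) (pr (env p) (F M p))))

/-- pairing on ℕ -/
def prN (x y : ℕ) : ℕ := (x + y) * (x + y) + x
theorem prN_cast {M : PAM} (x y : ℕ) : ((prN x y : ℕ) : M) = pr (x : M) (y : M) := by
  simp [prN, pr]

theorem Ev.var0 {k : ℕ} : Ev (fun M (p : Tup (k + 1) M) => p.2) := by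
  refine ⟨prN 0 0, fun M => ⟨fun s hs p v h => ?_, fun B => ?_⟩⟩
  · have := hs.inv h
    simp [Rule, Op, prN_cast, env] at this
    exact this.2.symm
  · obtain ⟨s, hs⟩ := Cert.empty (M := M)
    obtain ⟨E, hE⟩ := env_bd B (k + 1)
    obtain ⟨s', h1, _, _, h4⟩ := hs.step (pr ((prN 0 0 : ℕ) : M) (pr E B))
    refine ⟨s', h1, fun p hp => h4 _ ?_ ?_⟩
    · exact pr_mono le_rfl (pr_mono (hE _ hp) hp.2)
    · refine Just.intro (Or.inl ⟨by rw [prN_cast]; simp, env p.1, ?_, rfl⟩)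
      exact (le_pr_right _ _).trans ((le_pr_left _ _).trans (le_pr_right _ _))

theorem Ev.shift {k : ℕ} {F : ∀ M : PAM, Tup k M → M} (hF : Ev F) :
    Ev (fun M (p : Tup (k + 1) M) => F M p.1) := by
  obtain ⟨e, he⟩ := hF
  refine ⟨prN 1 e, fun M => ⟨fun s hs p v h => ?_, fun B => ?_⟩⟩
  · have := hs.inv h
    simp [Rule, Op, prN_cast, env] at this
    exact (he M).1 s hs p.1 v this.2.2.2
  · obtain ⟨s, hs, hs'⟩ := (he M).2 B
    obtain ⟨E, hE⟩ := env_bd B (k + 1)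
    obtain ⟨s', h1, _, _, h4⟩ := hs.step (pr ((prN 1 e : ℕ) : M) (pr E s))
    refine ⟨s', h1, fun p hp => h4 _ ?_ ?_⟩
    · refine pr_mono le_rfl (pr_mono (hE _ hp) ?_)
      exact ((le_pr_right _ _).trans (le_pr_right _ _)).trans (mem_le (hs' p.1 hp.1))
    · refine Just.intro (Or.inr (Or.inl ⟨e, ?_, p.2, ?_, env p.1, ?_, ?_, rfl, hs' _ hp.1⟩))
      · rw [prN_cast]; exact (le_pr_right _ _).trans (le_pr_left _ _)
      · exact (le_pr_left _ (env p.1)).trans ((le_pr_left _ _).trans (le_pr_right _ _))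
      · exact (le_pr_right p.2 _).trans ((le_pr_left _ _).trans (le_pr_right _ _))
      · rw [prN_cast]; simp

theorem Ev.const {k : ℕ} (n : ℕ) : Ev (fun M (_ : Tup k M) => (n : M)) := by
  refine ⟨prN 2 n, fun M => ⟨fun s hs p v h => ?_, fun B => ?_⟩⟩
  · have := hs.inv h
    simp [Rule, Op, prN_cast] at this
    exact this.symm
  · obtain ⟨s, hs⟩ := Cert.empty (M := M)
    obtain ⟨E, hE⟩ := env_bd B k
    obtain ⟨s', h1, _, _, h4⟩ := hs.step (pr ((prN 2 n : ℕ) : M) (pr E n))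
    refine ⟨s', h1, fun p hp => h4 _ ?_ ?_⟩
    · exact pr_mono le_rfl (pr_mono (hE _ hp) le_rfl)
    · exact Just.intro (Or.inr (Or.inr (Or.inl (by rw [prN_cast]; simp))))

theorem Ev.bin {k : ℕ} {F G H : ∀ M : PAM, Tup k M → M} (hF : Ev F) (hG : Ev G) (tag : ℕ)
    (h3 : 3 ≤ tag) (h7 : tag ≤ 7)
    (hop : ∀ (M : PAM) p v, Op (tag : M) (F M p) (G M p) v ↔ v = H M p)
    (hbd : ∀ (M : PAM) p, H M p ≤ F M p + G M p + F M p * G M p + 1) : Ev H := by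
  obtain ⟨e, he⟩ := hF
  obtain ⟨e', he'⟩ := hG
  refine ⟨prN tag (prN e e'), fun M => ⟨fun s hs p v h => ?_, fun B => ?_⟩⟩
  · have := hs.inv h
    rw [prN_cast, prN_cast] at this
    rcases this with h1 | h1 | h1 | h1 | h1
    · have := (pr_inj.1 h1.1).1
      norm_cast at this
      omega
    · obtain ⟨c1, _, a, _, e', _, h1, _⟩ := h1
      have := (pr_inj.1 h1).1
      norm_cast at this
      omega
    · have := (pr_inj.1 h1).1
      norm_cast at this
      omega
    · obtain ⟨t, a1, c1, a2, c2, a3, v1, a4, v2, a5, a6, a7, a8, a9⟩ := h1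
      simp only [pr_inj] at a6
      obtain ⟨rfl, rfl, rfl⟩ := a6
      rw [(he M).1 s hs _ _ a7, (he' M).1 s hs _ _ a8] at a9
      exact (hop _ _ _).1 a9
    · obtain ⟨c0, a1, c1, a2, v0, a3, a4, a5, a6⟩ := h1
      have := (pr_inj.1 a4).1
      norm_cast at this
      omega
  · obtain ⟨s1, hs1, hs1'⟩ := (he M).2 B
    obtain ⟨s2, hs2, hs2'⟩ := (he' M).2 B
    obtain ⟨s, hs, hu1, hu2⟩ := hs1.union hs2
    obtain ⟨E, hE⟩ := env_bd B k
    obtain ⟨s', h1, _, _, h4⟩ := hs.step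
      (pr ((prN tag (prN e e') : ℕ) : M) (pr E (s + s + s * s + 1)))
    refine ⟨s', h1, fun p hp => h4 _ ?_ ?_⟩
    · refine pr_mono le_rfl (pr_mono (hE _ hp) ((hbd M p).trans ?_))
      have b1 := ((le_pr_right _ _).trans (le_pr_right _ _)).trans (mem_le (hu1 _ (hs1' p hp)))
      have b2 := ((le_pr_right _ _).trans (le_pr_right _ _)).trans (mem_le (hu2 _ (hs2' p hp)))
      gcongr
    · have b1 := ((le_pr_right _ _).trans (le_pr_right _ _)).trans (mem_le (hu1 _ (hs1' p hp)))
      have b2 := ((le_pr_right _ _).trans (le_pr_right _ _)).trans (mem_le (hu2 _ (hs2' p hp)))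
      refine Just.intro (Or.inr (Or.inr (Or.inr (Or.inl ⟨tag, ?_, e, ?_, e', ?_, F M p, b1, G M p, b2,
        ?_, hu1 _ (hs1' p hp), hu2 _ (hs2' p hp), (hop _ _ _).2 rfl⟩))))
      · rw [prN_cast]; exact (le_pr_left _ _).trans (le_pr_left _ _)
      · rw [prN_cast, prN_cast]
        exact (le_pr_left _ _).trans ((le_pr_right _ _).trans (le_pr_left _ _))
      · rw [prN_cast, prN_cast]
        exact (le_pr_right _ _).trans ((le_pr_right _ _).trans (le_pr_left _ _))
      · rw [prN_cast, prN_cast]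

open Classical in
/-- indicator -/
noncomputable def ind1 {M : PAM} (P : Prop) : M := if P then 1 else 0

theorem ind1_eq {M : PAM} {P : Prop} {v : M} : v = ind1 P ↔ ((P ∧ v = 1) ∨ (¬ P ∧ v = 0)) := by
  unfold ind1
  split_ifs with h <;> simp [h]
theorem ind1_le {M : PAM} {P : Prop} : (ind1 P : M) ≤ 1 := by
  unfold ind1
  split_ifs with h <;> simp
theorem ind1_one {M : PAM} {P : Prop} : (ind1 P : M) = 1 ↔ P := by
  unfold ind1
  split_ifs with h <;> simp [h]

theorem Ev.ball {k : ℕ} {F : ∀ M : PAM, Tup k M → M} {Q : ∀ M : PAM, Tup (k + 1) M → Prop}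
    (hF : Ev F) (hQ : Ev (fun M p => ind1 (Q M p))) :
    Ev (fun M p => ind1 (∀ y, y ≤ F M p → Q M (p, y))) := by
  obtain ⟨e, he⟩ := hF
  obtain ⟨e', he'⟩ := hQ
  refine ⟨prN 8 (prN e e'), fun M => ⟨fun s hs p v h => ?_, fun B => ?_⟩⟩
  · have := hs.inv h
    simp only [Rule, Op, prN_cast, pr_inj] at this
    norm_num at this
    rcases this with ⟨t, _, c1, _, c2, _, v1, _, v2, _, ⟨a1, _⟩, _, _, a2⟩ | this
    · exfalso
      subst a1
      norm_num at a2
    obtain ⟨c0, _, c1, _, v0, a3, ⟨rfl, rfl⟩, a4, a5⟩ := this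
    rw [(he M).1 s hs _ _ a4] at a5
    rw [ind1_eq]
    rcases a5 with ⟨a5, a6⟩ | ⟨⟨y, hy, a5⟩, a6⟩
    · refine Or.inl ⟨fun y hy => ?_, a6⟩
      have := (he' M).1 s hs (p, y) 1 (a5 y hy)
      exact ind1_one.1 this.symm
    · refine Or.inr ⟨fun h => ?_, a6⟩
      have := (he' M).1 s hs (p, y) 0 a5
      have h2 := h y hy
      rw [ind1_eq] at this
      simp [h2] at this
  · obtain ⟨s1, hs1, hs1'⟩ := (he M).2 B
    obtain ⟨s2, hs2, hs2'⟩ := (he' M).2 (B + s1)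
    obtain ⟨s, hs, hu1, hu2⟩ := hs1.union hs2
    obtain ⟨E, hE⟩ := env_bd B k
    obtain ⟨s', h1, _, _, h4⟩ := hs.step
      (pr ((prN 8 (prN e e') : ℕ) : M) (pr E 1))
    refine ⟨s', h1, fun p hp => h4 _ ?_ ?_⟩
    · exact pr_mono le_rfl (pr_mono (hE _ hp) ind1_le)
    · have b0 := ((le_pr_right _ _).trans (le_pr_right _ _)).trans (mem_le (hs1' p hp))
      have b1 := ((le_pr_right _ _).trans (le_pr_right _ _)).trans (mem_le (hu1 _ (hs1' p hp)))
      have b2 : ∀ y, y ≤ F M p → Bd (k := k + 1) (p, y) (B + s1) := fun y hy =>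
        ⟨hp.mono le_self_add, (hy.trans b0).trans le_add_self⟩
      refine Just.intro (Or.inr (Or.inr (Or.inr (Or.inr ⟨e, ?_, e', ?_, F M p, b1,
        ?_, hu1 _ (hs1' p hp), ?_⟩))))
      · rw [prN_cast, prN_cast]
        exact (le_pr_left _ _).trans ((le_pr_right _ _).trans (le_pr_left _ _))
      · rw [prN_cast, prN_cast]
        exact (le_pr_right _ _).trans ((le_pr_right _ _).trans (le_pr_left _ _))
      · rw [prN_cast, prN_cast]; simp
      · by_cases hall : ∀ y, y ≤ F M p → Q M (p, y)
        · refine Or.inl ⟨fun y hy => ?_, ind1_one.2 hall⟩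
          have := hu2 _ (hs2' (p, y) (b2 y hy))
          beta_reduce at this
          rw [ind1_one.2 (hall y hy)] at this
          exact this
        · refine Or.inr ⟨?_, (ind1_eq.2 (Or.inr ⟨hall, rfl⟩)).symm⟩
          push Not at hall
          obtain ⟨y, hy, hq⟩ := hall
          have := hu2 _ (hs2' (p, y) (b2 y hy))
          beta_reduce at this
          rw [← ind1_eq.2 (Or.inr ⟨hq, rfl⟩)] at this
          exact ⟨y, hy, this⟩

theorem Ev.congr {k : ℕ} {F G : ∀ M : PAM, Tup k M → M} (hF : Ev F) (h : ∀ M p, G M p = F M p) : Ev G := by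
  have : G = F := funext fun M => funext fun p => h M p
  rwa [this]

theorem Ev.add {k : ℕ} {F G : ∀ M : PAM, Tup k M → M} (hF : Ev F) (hG : Ev G) :
    Ev (fun M p => F M p + G M p) :=
  Ev.bin hF hG 3 (by norm_num) (by norm_num) (fun M p v => by simp [Op])
    (fun M p => by rw [add_assoc]; exact le_self_add)
theorem Ev.mul {k : ℕ} {F G : ∀ M : PAM, Tup k M → M} (hF : Ev F) (hG : Ev G) :
    Ev (fun M p => F M p * G M p) :=
  Ev.bin hF hG 4 (by norm_num) (by norm_num) (fun M p v => by simp [Op])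
    (fun M p => by rw [add_comm _ (F M p * G M p), add_assoc]; exact le_self_add)
theorem Ev.eq {k : ℕ} {F G : ∀ M : PAM, Tup k M → M} (hF : Ev F) (hG : Ev G) :
    Ev (fun M p => ind1 (F M p = G M p)) :=
  Ev.bin hF hG 5 (by norm_num) (by norm_num) (fun M p v => by simp [Op, ind1_eq])
    (fun M p => ind1_le.trans le_add_self)
theorem Ev.le {k : ℕ} {F G : ∀ M : PAM, Tup k M → M} (hF : Ev F) (hG : Ev G) :
    Ev (fun M p => ind1 (F M p ≤ G M p)) :=
  Ev.bin hF hG 6 (by norm_num) (by norm_num) (fun M p v => by simp [Op, ind1_eq])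
    (fun M p => ind1_le.trans le_add_self)
theorem Ev.imp {k : ℕ} {P Q : ∀ M : PAM, Tup k M → Prop} (hF : Ev (fun M p => ind1 (P M p)))
    (hG : Ev (fun M p => ind1 (Q M p))) :
    Ev (fun M p => ind1 (P M p → Q M p)) :=
  Ev.bin hF hG 7 (by norm_num) (by norm_num) (fun M p v => by simp [Op, ind1_eq (P := P M p → Q M p), ind1_one])
    (fun M p => ind1_le.trans le_add_self)

theorem Ev.fls {k : ℕ} : Ev (fun M (_ : Tup k M) => ind1 False) :=
  (Ev.const 0).congr (fun M p => by simp [ind1])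

theorem Ev.var : ∀ {k : ℕ} (i : Fin k), Ev (fun M (p : Tup k M) => tv p i)
  | 0, i => i.elim0
  | k + 1, i => by
    refine Fin.lastCases ?_ (fun i => ?_) i
    · exact Ev.var0.congr (fun M p => by simp [tv])
    · exact (Ev.shift (Ev.var i)).congr (fun M p => by simp [tv])

theorem Ev.term {k : ℕ} (t : LA.Term (Empty ⊕ Fin k)) :
    Ev (fun M (p : Tup k M) => t.realize (Sum.elim default (tv p))) := by
  induction t with
  | var x =>
    rcases x with x | i
    · exact x.elim
    · exact Ev.var i
  | @func l f ts ih =>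
    match l, f, ts, ih with
    | 0, f, ts, ih =>
      refine (Ev.const 0).congr (fun M p => ?_)
      rw [Nat.cast_zero]
      simp only [Term.realize]
      show _ = z0 M
      unfold z0
      congr 1
      exact Subsingleton.elim _ _
    | 1, f, ts, ih =>
      refine ((ih 0).add (Ev.const 1)).congr (fun M p => ?_)
      rw [Nat.cast_one, ← sc_eq]
      simp only [Term.realize]
      unfold sc
      congr 1
      funext i
      fin_cases i
      rfl
    | 2, (false : Bool), ts, ih =>
      refine ((ih 0).add (ih 1)).congr (fun M p => ?_)
      rw [← pl_eq]
      simp only [Term.realize]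
      unfold pl
      congr 1
      funext i
      fin_cases i <;> rfl
    | 2, (true : Bool), ts, ih =>
      refine ((ih 0).mul (ih 1)).congr (fun M p => ?_)
      rw [← ti_eq]
      simp only [Term.realize]
      unfold ti
      congr 1
      funext i
      fin_cases i <;> rfl
    | (n + 3), f, ts, ih => exact f.elim

theorem Ev.delta0 {k : ℕ} {φ : LA.BoundedFormula Empty k} (h : IsDelta0 φ) :
    Ev (fun M (p : Tup k M) => ind1 (φ.Realize default (tv p))) := by
  induction h with
  | falsum => exact Ev.fls
  | equal t u =>
    exact ((Ev.term t).eq (Ev.term u)).congr (fun M p => by rw [BoundedFormula.realize_bdEqual])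
  | le t u =>
    exact ((Ev.term t).le (Ev.term u)).congr (fun M p => by rw [realize_leF]; rfl)
  | imp _ _ ih1 ih2 =>
    exact (ih1.imp ih2).congr (fun M p => by rw [BoundedFormula.realize_imp])
  | @ball m t ψ _ ih =>
    refine (Ev.ball (Ev.term t) ih).congr (fun M p => congrArg ind1 (propext ?_))
    simp only [BoundedFormula.realize_all]
    refine forall_congr' fun y => ?_
    rw [BoundedFormula.realize_imp, realize_leF, relabel_castSucc, realize_vT, Fin.snoc_last]
    rfl
  | @bex m t ψ _ ih =>
    have h1 := ((Ev.ball (Ev.term t) (ih.imp Ev.fls)).imp Ev.fls)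
    refine h1.congr (fun M p => congrArg ind1 (propext ?_))
    simp only [BoundedFormula.realize_ex]
    rw [show ((∀ y, y ≤ Term.realize (Sum.elim default (tv p)) t → ψ.Realize default (tv (k := m+1) (p, y)) → False) → False) ↔
      ∃ y, y ≤ Term.realize (Sum.elim default (tv p)) t ∧ ψ.Realize default (tv (k := m+1) (p, y)) by
        simp]
    refine exists_congr fun y => ?_
    rw [BoundedFormula.realize_inf, realize_leF, relabel_castSucc, realize_vT, Fin.snoc_last]
    rfl

/-! ### Universal predicates -/

/-- witnessing for the universal `Σ_1` predicate -/
def DD {M : PAM} (e x N : M) : Prop :=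
  ∃ y, y ≤ N ∧ ∃ s, s ≤ N ∧ Cert s ∧ Mem s (pr e (pr (pr y (pr x 0)) 1))

instance Dl.DD {k : ℕ} {f g h : ∀ M : PAM, Tup k M → M} [hf : UT f] [hg : UT g] [hh : UT h] :
    Dl (fun M p => DD (f M p) (g M p) (h M p)) := by
  have : Dl (fun (M : PAM) (p : Tup 3 M) => Guaspari.DD p.1.1.2 p.1.2 p.2) := by
    unfold Guaspari.DD; infer_instance
  exact Dl.sub this (fun M p => tc (tc (tc (k := 0) () (f M p)) (g M p)) (h M p))

theorem DD.mono {M : PAM} {e x N N' : M} (h : N ≤ N') (hd : DD e x N) : DD e x N' := by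
  obtain ⟨y, h1, s, h2, h3⟩ := hd
  exact ⟨y, h1.trans h, s, h2.trans h, h3⟩

/-- universal `Σ_{n+1}` predicates -/
def UU : ℕ → ∀ {M : PAM}, M → M → Prop
  | 0, _, e, x => ∃ N, DD e x N
  | n + 1, _, e, x => ∃ y, ¬ UU n e (pr x y)

theorem NS.UU (n : ℕ) : NS (n + 1) (fun M (p : Tup 2 M) => UU n p.1.2 p.2) := by
  induction n with
  | zero =>
    have : Dl (fun M (p : Tup 3 M) => DD p.1.1.2 p.1.2 p.2) := inferInstance
    exact NS.ex (NS.ofDl this 1)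
  | succ n ih =>
    exact ⟨_, (clos _).sub ih (fun M (p : Tup 3 M) => tc (tc (k := 0) () p.1.1.2) (pr p.1.2 p.2)),
      fun M p => Iff.rfl⟩

theorem UU.univ (n : ℕ) : ∀ {P : ∀ M : PAM, Tup 1 M → Prop}, NS (n + 1) P →
    ∃ e : ℕ, ∀ (M : PAM) (x : M), P M ((), x) ↔ UU n (e : M) x := by
  induction n with
  | zero =>
    rintro P ⟨Q, hQ, h⟩
    obtain ⟨φ, h1, h2⟩ := (@Dl.not _ _ hQ).out
    obtain ⟨e, he⟩ := Ev.delta0 h1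
    refine ⟨e, fun M x => ?_⟩
    simp only [h2] at he
    rw [h]
    constructor
    · rintro ⟨y, hy⟩
      obtain ⟨B, hB⟩ := exists_Bd (k := 2) (((), x), y)
      obtain ⟨s, hs, hs'⟩ := (he M).2 B
      have := hs' _ hB
      rw [ind1_one.2 hy] at this
      exact ⟨y + s, y, le_self_add, s, le_add_self, hs, this⟩
    · rintro ⟨N, y, _, s, _, hs, hm⟩
      have := (he M).1 s hs (((), x), y) 1 hm
      exact ⟨y, ind1_one.1 this.symm⟩
  | succ n ih =>
    rintro P ⟨Q, hQ, h⟩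
    have q1 := (clos _).sub hQ (fun M (p : Tup 3 M) => tc (tc (k := 0) () p.1.2) p.2)
    have q2 : Dl (fun M (p : Tup 3 M) => p.1.1.2 = pr p.1.2 p.2) := inferInstance
    have q3 := (clos _).and (NS.ofDl q2 _) q1
    have q4 := (clos _).bex (f := fun M (p : Tup 2 M) => p.1.2) q3
    have q5 := (clos _).bex (f := fun M (p : Tup 1 M) => p.2) q4
    obtain ⟨e, he⟩ := ih q5
    refine ⟨e, fun M x => ?_⟩
    rw [h]
    refine exists_congr fun y => not_congr ?_
    rw [← he]
    constructor
    · intro hq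
      exact ⟨x, le_pr_left _ _, y, le_pr_right _ _, rfl, hq⟩
    · rintro ⟨x', _, y', _, hp, hq⟩
      obtain ⟨rfl, rfl⟩ := pr_inj.1 hp
      exact hq
end Guaspari

open FirstOrder Language
open scoped FirstOrder

namespace Guaspari
open PAM

/-! ### The standard model and absoluteness -/

/-- the standard structure on `ℕ` -/
@[reducible] def natStr : LA.Structure ℕ where
  funMap := fun {n} => match n with
    | 0 => fun _ _ => (0 : ℕ)
    | 1 => fun _ v => v 0 + 1
    | 2 => fun (f : Bool) v => match f with
      | false => v 0 + v 1
      | true => v 0 * v 1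
    | _ + 3 => fun f _ => f.elim
  RelMap := fun {n} => match n with
    | 0 => fun r _ => r.elim
    | 1 => fun r _ => r.elim
    | 2 => fun _ v => v 0 ≤ v 1
    | _ + 3 => fun r _ => r.elim

theorem nat_pa : @Theory.Model LA ℕ natStr PAAx := by
  let _ := natStr
  refine ⟨fun φ hφ => ?_⟩
  have s0 : z0 ℕ = (0 : ℕ) := rfl
  have s1 : ∀ x : ℕ, sc x = x + 1 := fun _ => rfl
  have s2 : ∀ x y : ℕ, pl x y = x + y := fun _ _ => rfl
  have s3 : ∀ x y : ℕ, ti x y = x * y := fun _ _ => rfl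
  have s4 : ∀ x y : ℕ, lle x y ↔ x ≤ y := fun _ _ => Iff.rfl
  rcases hφ with hφ | ⟨k, ψ, rfl⟩
  · simp only [Set.mem_insert_iff, Set.mem_singleton_iff] at hφ
    rcases hφ with rfl | rfl | rfl | rfl | rfl | rfl | rfl <;>
    simp [Sentence.Realize, Formula.Realize, s0, s1, s2, s3, s4, Fin.snoc]
    · intro a b; ring
    · intro a b; ring
    · intro a b
      constructor
      · intro h; exact ⟨b - a, by omega⟩
      · rintro ⟨c, hc⟩; omega
  · rw [realize_indAxiom]
    intro v h0 hs x
    induction x with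
    | zero => exact h0
    | succ x ih => exact hs x ih

/-- the standard model -/
def natM : PAM := @PAM.mk ℕ natStr nat_pa

theorem natM_zero : (0 : natM) = (0 : ℕ) := rfl
theorem natM_one : (1 : natM) = (1 : ℕ) := rfl
theorem natM_add (x y : ℕ) : ((x : natM.carrier) + (y : natM.carrier) : natM) = (Nat.add x y) := rfl
theorem natM_mul (x y : ℕ) : ((x : natM.carrier) * (y : natM.carrier) : natM) = (Nat.mul x y) := rfl
theorem natM_le (x y : ℕ) : @LE.le natM.carrier _ x y ↔ Nat.le x y := Iff.rfl

/-- casts to a model -/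
@[reducible] def cst (M : PAM) (n : ℕ) : M := (n : M)

theorem cst_succ {M : PAM} (n : ℕ) : cst M (n + 1) = cst M n + 1 := Nat.cast_succ n
theorem cst_add {M : PAM} (a b : ℕ) : cst M (Nat.add a b) = pl (cst M a) (cst M b) := Nat.cast_add a b
theorem cst_mul {M : PAM} (a b : ℕ) : cst M (Nat.mul a b) = ti (cst M a) (cst M b) := Nat.cast_mul a b

theorem cst_natM (n : ℕ) : (cst natM n : ℕ) = n := by
  induction n with
  | zero => exact Nat.cast_zero (R := natM)
  | succ n ih =>
    refine (cst_succ (M := natM) n).trans ?_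
    have : ∀ x : ℕ, x = n → @Eq ℕ (@HAdd.hAdd natM natM natM _ x 1) (n + 1) := fun x hx => by
      rw [hx]; rfl
    exact this _ ih

/-- casts of tuples -/
def tcast (M : PAM) : ∀ {k : ℕ}, Tup k ℕ → Tup k M
  | 0, _ => ()
  | _ + 1, p => (tcast M p.1, cst M p.2)

theorem tv_tcast (M : PAM) : ∀ {k : ℕ} (p : Tup k ℕ) (i : Fin k), tv (tcast M p) i = cst M (tv p i)
  | 0, _, i => i.elim0
  | k + 1, p, i => by
    refine Fin.lastCases ?_ (fun i => ?_) i
    · simp [tcast, tv]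
    · simp [tcast, tv, tv_tcast M]

theorem le_cst {M : PAM} (n : ℕ) : ∀ x : M, x ≤ cst M n → ∃ m : ℕ, m ≤ n ∧ x = cst M m := by
  induction n with
  | zero =>
    intro x hx
    refine ⟨0, le_rfl, ?_⟩
    simp [cst] at hx ⊢
    exact hx
  | succ n ih =>
    intro x hx
    rcases hx.eq_or_lt with rfl | hx
    · exact ⟨n + 1, le_rfl, rfl⟩
    · simp only [cst, Nat.cast_succ] at hx
      obtain ⟨m, h1, h2⟩ := ih x (PAM.lt_add1.1 hx)
      exact ⟨m, by omega, h2⟩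

theorem term_abs (M : PAM) {k : ℕ} (t : LA.Term (Empty ⊕ Fin k)) (p : Tup k ℕ) :
    t.realize (Sum.elim default (tv (tcast M p))) =
      cst M (@Term.realize LA natM _ _ (Sum.elim default (tv p)) t) := by
  induction t with
  | var x =>
    rcases x with x | i
    · exact x.elim
    · exact tv_tcast M p i
  | @func l f ts ih =>
    match l, f, ts, ih with
    | 0, f, ts, ih =>
      simp only [Term.realize]
      show _ = cst M 0
      simp only [cst, Nat.cast_zero]
      show _ = z0 M
      unfold z0
      congr 1
      exact Subsingleton.elim _ _
    | 1, f, ts, ih =>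
      simp only [Term.realize, ih]
      refine Eq.trans ?_ ((cst_succ (@Term.realize LA natM _ _ (Sum.elim default (tv p)) (ts 0))).trans
        (sc_eq _).symm).symm
      unfold sc
      congr 1
      funext i
      fin_cases i
      rfl
    | 2, (false : Bool), ts, ih =>
      simp only [Term.realize, ih]
      refine Eq.trans ?_ (cst_add (@Term.realize LA natM _ _ (Sum.elim default (tv p)) (ts 0))
        (@Term.realize LA natM _ _ (Sum.elim default (tv p)) (ts 1))).symm
      unfold pl
      congr 1
      funext i
      fin_cases i <;> rfl
    | 2, (true : Bool), ts, ih =>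
      simp only [Term.realize, ih]
      refine Eq.trans ?_ (cst_mul (@Term.realize LA natM _ _ (Sum.elim default (tv p)) (ts 0))
        (@Term.realize LA natM _ _ (Sum.elim default (tv p)) (ts 1))).symm
      unfold ti
      congr 1
      funext i
      fin_cases i <;> rfl
    | (n + 3), f, ts, ih => exact f.elim

theorem cst_inj {M : PAM} {a b : ℕ} : cst M a = cst M b ↔ a = b := Nat.cast_inj
theorem cst_le {M : PAM} {a b : ℕ} : cst M a ≤ cst M b ↔ a ≤ b := Nat.cast_le

theorem delta_abs (M : PAM) {k : ℕ} {φ : LA.BoundedFormula Empty k} (h : IsDelta0 φ) :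
    ∀ (p : Tup k ℕ), φ.Realize default (tv (tcast M p)) ↔
      @BoundedFormula.Realize LA natM _ _ _ φ default (tv p) := by
  induction h with
  | falsum => intro p; exact Iff.rfl
  | equal t u =>
    intro p
    rw [BoundedFormula.realize_bdEqual, BoundedFormula.realize_bdEqual, term_abs, term_abs]
    exact cst_inj
  | le t u =>
    intro p
    rw [realize_leF, realize_leF, term_abs, term_abs]
    exact cst_le
  | imp _ _ ih1 ih2 =>
    intro p
    rw [BoundedFormula.realize_imp, BoundedFormula.realize_imp, ih1, ih2]
  | @ball m t ψ _ ih =>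
    intro p
    have key : ∀ (N : PAM) (p : Tup m N), (∀' (leF (vT (Fin.last m)) (t.relabel (Sum.map id Fin.castSucc)) ⟹ ψ)).Realize
        default (tv p) ↔ ∀ y, y ≤ t.realize (Sum.elim default (tv p)) → ψ.Realize default (tv (k := m + 1) (p, y)) := by
      intro N p
      rw [BoundedFormula.realize_all]
      refine forall_congr' fun y => ?_
      rw [BoundedFormula.realize_imp, realize_leF, relabel_castSucc, realize_vT, Fin.snoc_last]
      rfl
    refine (key M _).trans (Iff.trans ?_ (key natM p).symm)
    rw [term_abs]
    constructor
    · intro h y hy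
      exact (ih (p, y)).1 (h (cst M y) (cst_le.2 hy))
    · intro h y hy
      obtain ⟨z, hz, rfl⟩ := le_cst _ _ hy
      exact (ih (p, z)).2 (h z hz)
  | @bex m t ψ _ ih =>
    intro p
    have key : ∀ (N : PAM) (p : Tup m N), (∃' (leF (vT (Fin.last m)) (t.relabel (Sum.map id Fin.castSucc)) ⊓ ψ)).Realize
        default (tv p) ↔ ∃ y, y ≤ t.realize (Sum.elim default (tv p)) ∧ ψ.Realize default (tv (k := m + 1) (p, y)) := by
      intro N p
      rw [BoundedFormula.realize_ex]
      refine exists_congr fun y => ?_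
      rw [BoundedFormula.realize_inf, realize_leF, relabel_castSucc, realize_vT, Fin.snoc_last]
      rfl
    refine (key M _).trans (Iff.trans ?_ (key natM p).symm)
    rw [term_abs]
    constructor
    · rintro ⟨y, hy, h⟩
      obtain ⟨z, hz, rfl⟩ := le_cst _ _ hy
      exact ⟨z, hz, (ih (p, z)).1 h⟩
    · rintro ⟨y, hy, h⟩
      exact ⟨cst M y, cst_le.2 hy, (ih (p, y)).2 h⟩

theorem Dl.abs {k : ℕ} {P : ∀ M : PAM, Tup k M → Prop} (h : Dl P) (M : PAM) (p : Tup k ℕ) :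
    P M (tcast M p) ↔ P natM p := by
  obtain ⟨φ, h1, h2⟩ := h.out
  exact (h2 M _).symm.trans ((delta_abs M h1 p).trans (h2 natM p))

theorem DD.abs (M : PAM) (e x N : ℕ) : DD (cst M e) (cst M x) (cst M N) ↔ DD (M := natM) e x N := by
  have : Dl (fun M (p : Tup 3 M) => DD p.1.1.2 p.1.2 p.2) := inferInstance
  exact this.abs M ((((), e), x), N)

/-! ### Σ1 predicates on ℕ -/

/-- Σ1 predicates on `ℕ` -/
class S1 {k : ℕ} (P : Tup k ℕ → Prop) : Prop where
  out : ∃ Q : ∀ M : PAM, Tup k M → Prop, NS 1 Q ∧ ∀ p : Tup k ℕ, P p ↔ Q natM p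
/-- functions with Σ1 graph -/
class NT {k : ℕ} (f : Tup k ℕ → ℕ) : Prop where
  out : S1 (fun p : Tup (k + 1) ℕ => p.2 = f p.1)
/-- projections -/
class NP {k j : ℕ} (f : Tup k ℕ → Tup j ℕ) : Prop where
  out : ∃ g : Fin j → Fin k, ∀ p, tv (f p) = tv p ∘ g

section s1
variable {k j : ℕ}

theorem S1.congr {P Q : Tup k ℕ → Prop} (h : S1 P) (e : ∀ p, Q p ↔ P p) : S1 Q := by
  have : Q = P := funext fun p => propext (e p)
  rwa [this]

instance NP.id' : NP (fun p : Tup k ℕ => p) := ⟨⟨id, fun _ => rfl⟩⟩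
instance NP.fst {f : Tup k ℕ → Tup (j + 1) ℕ} [h : NP f] : NP (j := j) (fun p => (f p).1) := by
  obtain ⟨g, hg⟩ := h.out
  refine ⟨fun i => g i.castSucc, fun p => ?_⟩
  funext i
  have := congrFun (hg p) i.castSucc
  simp only [Function.comp] at this ⊢
  rw [← this]
  simp [tv]

theorem NP.unit : NP (j := 0) (fun _ : Tup k ℕ => ()) :=
  ⟨Fin.elim0, fun _ => funext fun i => i.elim0⟩
theorem NP.cons {f : Tup k ℕ → Tup j ℕ} {i : ℕ} {g : Tup k ℕ → Tup (i + 1) ℕ} (hf : NP f) (hg : NP g) :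
    NP (j := j + 1) (fun p => (f p, (g p).2)) := by
  obtain ⟨a, ha⟩ := hf.out
  obtain ⟨b, hb⟩ := hg.out
  refine ⟨Fin.snoc a (b (Fin.last _)), fun p => ?_⟩
  funext x
  refine Fin.lastCases ?_ (fun x => ?_) x
  · have := congrFun (hb p) (Fin.last _)
    simp only [Function.comp, tv, Fin.snoc_last] at this ⊢
    exact this
  · have := congrFun (ha p) x
    simp only [Function.comp, tv, Fin.snoc_castSucc] at this ⊢
    exact this

theorem S1.sub {P : Tup j ℕ → Prop} (hP : S1 P) (g : Tup k ℕ → Tup j ℕ) [hg : NP g] :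
    S1 (fun p => P (g p)) := by
  obtain ⟨Q, h1, h2⟩ := hP.out
  obtain ⟨r, hr⟩ := hg.out
  have hu : UTT (fun (M : PAM) (p : Tup k M) => (vt (fun i => tv p (r i)) : Tup j M)) :=
    ⟨fun i => ⟨Term.var (Sum.inr (r i)), fun M p => by simp⟩⟩
  refine ⟨_, (clos 1).sub h1 (fun (M : PAM) (p : Tup k M) => (vt (fun i => tv p (r i)) : Tup j M)),
    fun p => ?_⟩
  rw [h2]
  have : g p = vt (fun i => tv p (r i)) := by
    rw [← vt_tv (g p), hr]; rfl
  rw [this]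
  exact Iff.rfl

theorem S1.ofDl {P : Tup k ℕ → Prop} {Q : ∀ M : PAM, Tup k M → Prop} (h : Dl Q)
    (e : ∀ p, P p ↔ Q natM p) : S1 P := ⟨_, NS.ofDl h 1, e⟩

instance S1.and {P Q : Tup k ℕ → Prop} [h1 : S1 P] [h2 : S1 Q] : S1 (fun p => P p ∧ Q p) := by
  obtain ⟨P', h1, h1'⟩ := h1.out
  obtain ⟨Q', h2, h2'⟩ := h2.out
  exact ⟨_, (clos 1).and h1 h2, fun p => and_congr (h1' p) (h2' p)⟩
instance S1.or {P Q : Tup k ℕ → Prop} [h1 : S1 P] [h2 : S1 Q] : S1 (fun p => P p ∨ Q p) := by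
  obtain ⟨P', h1, h1'⟩ := h1.out
  obtain ⟨Q', h2, h2'⟩ := h2.out
  exact ⟨_, (clos 1).or h1 h2, fun p => or_congr (h1' p) (h2' p)⟩
instance S1.ex {Q : Tup k ℕ → ℕ → Prop} [h1 : S1 (k := k + 1) (fun p => Q p.1 p.2)] :
    S1 (fun p => ∃ y, Q p y) := by
  obtain ⟨P', h1, h1'⟩ := h1.out
  exact ⟨_, NS.ex h1, fun p => exists_congr fun y => h1' (p, y)⟩

theorem S1.lt {P : Tup k ℕ → ℕ → Prop} {f : Tup k ℕ → ℕ} (hf : NT f)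
    (h : S1 (k := k + 1) (fun p => P p.1 p.2)) : S1 (fun p => P p (f p)) := by
  have := @S1.and _ _ _ hf.out h
  have h2 := S1.ex (Q := fun p y => y = f p ∧ P p y)
  exact h2.congr fun p => by simp

instance NT.snd {f : Tup k ℕ → Tup (j + 1) ℕ} [h : NP f] : NT (fun p => (f p).2) := by
  refine ⟨?_⟩
  have h0 : Dl (fun M (p : Tup 2 M) => p.2 = p.1.2) := inferInstance
  have h1 : S1 (fun p : Tup 2 ℕ => p.2 = p.1.2) := S1.ofDl h0 (fun p => Iff.rfl)
  obtain ⟨g, hg⟩ := h.out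
  have hh : NP (j := 2) (fun p : Tup (k + 1) ℕ => ((((), (f p.1).2), p.2) : Tup 2 ℕ)) := by
    have hf : NP (fun p : Tup (k + 1) ℕ => f p.1) := by
      refine ⟨fun i => (g i).castSucc, fun p => ?_⟩
      rw [hg]
      funext i
      simp [tv]
    exact NP.cons (NP.cons NP.unit hf) NP.id'
  exact @S1.sub _ _ _ h1 _ hh

theorem S1.rel1 {R : ℕ → Prop} (h : S1 (k := 1) (fun p => R p.2)) {f : Tup k ℕ → ℕ} (hf : NT f) :
    S1 (fun p => R (f p)) :=
  S1.lt (P := fun _ y => R y) hf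
    (@S1.sub (k + 1) 1 _ h (fun p : Tup (k + 1) ℕ => ((), p.2)) (NP.cons NP.unit NP.id'))

theorem NT.wk {f : Tup k ℕ → ℕ} (hf : NT f) : NT (fun p : Tup (k + 1) ℕ => f p.1) :=
  ⟨@S1.sub (k + 2) (k + 1) _ hf.out (fun p : Tup (k + 2) ℕ => (p.1.1, p.2))
    (NP.cons (NP.fst (f := fun p : Tup (k + 2) ℕ => p.1)) NP.id')⟩

theorem S1.rel2 {R : ℕ → ℕ → Prop} (h : S1 (k := 2) (fun p => R p.1.2 p.2)) {f g : Tup k ℕ → ℕ}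
    (hf : NT f) (hg : NT g) : S1 (fun p => R (f p) (g p)) := by
  refine S1.lt (P := fun p y => R (f p) y) hg ?_
  refine S1.lt (k := k + 1) (P := fun p y => R y p.2) hf.wk ?_
  exact @S1.sub (k + 2) 2 _ h (fun p : Tup (k + 2) ℕ => (((), p.2), p.1.2))
    (NP.cons (NP.cons NP.unit NP.id') (NP.fst (f := fun p : Tup (k + 2) ℕ => p)))

theorem NT.fun2 {F : ℕ → ℕ → ℕ} (h : S1 (k := 3) (fun p => p.2 = F p.1.1.2 p.1.2)) {f g : Tup k ℕ → ℕ}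
    (hf : NT f) (hg : NT g) : NT (fun p => F (f p) (g p)) := by
  refine ⟨?_⟩
  refine S1.lt (k := k + 1) (P := fun p y => p.2 = F (f p.1) y) hg.wk ?_
  refine S1.lt (k := k + 2) (P := fun p y => p.1.2 = F y p.2) hf.wk.wk ?_
  exact @S1.sub (k + 3) 3 _ h (fun p : Tup (k + 3) ℕ => ((((), p.2), p.1.2), p.1.1.2))
    (NP.cons (NP.cons (NP.cons NP.unit NP.id') (NP.fst (f := fun p : Tup (k + 3) ℕ => p)))
      (NP.fst (f := fun p : Tup (k + 3) ℕ => p.1)))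

instance NT.const (n : ℕ) : NT (fun _ : Tup k ℕ => n) := by
  have h0 : Dl (fun M (p : Tup (k + 1) M) => p.2 = (n : M)) := inferInstance
  refine ⟨S1.ofDl h0 (fun p => ?_)⟩
  show _ ↔ p.2 = cst natM n
  rw [cst_natM]

instance NT.add {f g : Tup k ℕ → ℕ} [hf : NT f] [hg : NT g] : NT (fun p => f p + g p) := by
  have h0 : Dl (fun M (p : Tup 3 M) => p.2 = p.1.1.2 + p.1.2) := inferInstance
  exact NT.fun2 (F := fun x y => x + y) (S1.ofDl h0 fun p => Iff.rfl) hf hg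
instance NT.mul {f g : Tup k ℕ → ℕ} [hf : NT f] [hg : NT g] : NT (fun p => f p * g p) := by
  have h0 : Dl (fun M (p : Tup 3 M) => p.2 = p.1.1.2 * p.1.2) := inferInstance
  exact NT.fun2 (F := fun x y => x * y) (S1.ofDl h0 fun p => Iff.rfl) hf hg

instance S1.eq {f g : Tup k ℕ → ℕ} [hf : NT f] [hg : NT g] : S1 (fun p => f p = g p) := by
  have h0 : Dl (fun M (p : Tup 2 M) => p.1.2 = p.2) := inferInstance
  exact S1.rel2 (R := fun x y => x = y) (S1.ofDl h0 fun p => Iff.rfl) hf hg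
instance S1.ne {f g : Tup k ℕ → ℕ} [hf : NT f] [hg : NT g] : S1 (fun p => f p ≠ g p) := by
  have h0 : Dl (fun M (p : Tup 2 M) => ¬ p.1.2 = p.2) := inferInstance
  exact S1.rel2 (R := fun x y => x ≠ y) (S1.ofDl h0 fun p => Iff.rfl) hf hg
instance S1.le {f g : Tup k ℕ → ℕ} [hf : NT f] [hg : NT g] : S1 (fun p => f p ≤ g p) := by
  have h0 : Dl (fun M (p : Tup 2 M) => p.1.2 ≤ p.2) := inferInstance
  exact S1.rel2 (R := fun x y => x ≤ y) (S1.ofDl h0 fun p => Iff.rfl) hf hg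
instance S1.slt {f g : Tup k ℕ → ℕ} [hf : NT f] [hg : NT g] : S1 (fun p => f p < g p) := by
  have : S1 (fun p : Tup k ℕ => f p + 1 ≤ g p) := inferInstance
  exact this.congr fun p => Iff.rfl

instance S1.ball {f : Tup k ℕ → ℕ} {Q : Tup k ℕ → ℕ → Prop} [hf : NT f]
    [h1 : S1 (k := k + 1) (fun p => Q p.1 p.2)] : S1 (fun p => ∀ y, y ≤ f p → Q p y) := by
  refine S1.lt (P := fun p z => ∀ y, y ≤ z → Q p y) hf ?_
  have := @S1.sub (k + 2) (k + 1) _ h1 (fun p : Tup (k + 2) ℕ => (p.1.1, p.2))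
    (NP.cons (NP.fst (f := fun p : Tup (k + 2) ℕ => p.1)) NP.id')
  obtain ⟨P', h1, h1'⟩ := this.out
  refine ⟨_, (clos 1).ball (f := fun M (p : Tup (k + 1) M) => p.2) h1, fun p => ?_⟩
  exact forall_congr' fun y => imp_congr Iff.rfl (h1' (p, y))
instance S1.ballt {f : Tup k ℕ → ℕ} {Q : Tup k ℕ → ℕ → Prop} [hf : NT f]
    [h1 : S1 (k := k + 1) (fun p => Q p.1 p.2)] : S1 (fun p => ∀ y, y < f p → Q p y) := by
  have hh := NT.wk hf
  have : S1 (fun p => ∀ y, y ≤ f p → (f p ≤ y ∨ Q p y)) := inferInstance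
  refine this.congr fun p => ⟨fun h y hy => ?_, fun h y hy => ?_⟩
  · by_cases h3 : y < f p
    · exact Or.inr (h y h3)
    · exact Or.inl (by omega)
  · rcases h y hy.le with h | h
    · omega
    · exact h

instance NT.pair {f g : Tup k ℕ → ℕ} [hf : NT f] [hg : NT g] : NT (fun p => Nat.pair (f p) (g p)) := by
  have h0 : S1 (k := 3) (fun p => (p.1.1.2 < p.1.2 ∧ p.2 = p.1.2 * p.1.2 + p.1.1.2) ∨
    (p.1.2 ≤ p.1.1.2 ∧ p.2 = p.1.1.2 * p.1.1.2 + p.1.1.2 + p.1.2)) := inferInstance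
  refine NT.fun2 (F := fun x y => Nat.pair x y) (h0.congr fun p => ?_) hf hg
  unfold Nat.pair
  split_ifs with h
  · constructor
    · intro h1; exact Or.inl ⟨h, h1⟩
    · rintro (h1 | h1)
      · exact h1.2
      · omega
  · constructor
    · intro h1; exact Or.inr ⟨by omega, h1⟩
    · rintro (h1 | h1)
      · omega
      · exact h1.2

instance NT.prN {f g : Tup k ℕ → ℕ} [hf : NT f] [hg : NT g] : NT (fun p => prN (f p) (g p)) := by
  unfold Guaspari.prN; infer_instance
instance S1.dvd {f g : Tup k ℕ → ℕ} [hf : NT f] [hg : NT g] : S1 (fun p => f p ∣ g p) := by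
  have : S1 (k := 2) (fun p => ∃ c, p.2 = p.1.2 * c) := inferInstance
  exact S1.rel2 (R := fun x y => x ∣ y) this hf hg
instance S1.ndvd {f g : Tup k ℕ → ℕ} [hf : NT f] [hg : NT g] : S1 (fun p => ¬ f p ∣ g p) := by
  have : S1 (k := 2) (fun p => (p.1.2 = 0 ∧ p.2 ≠ 0) ∨ ∃ c, ∃ r, r ≠ 0 ∧ r < p.1.2 ∧ p.2 = p.1.2 * c + r) :=
    inferInstance
  refine S1.rel2 (R := fun x y => ¬ x ∣ y) (this.congr fun p => ?_) hf hg
  constructor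
  · intro h
    by_cases h0 : p.1.2 = 0
    · exact Or.inl ⟨h0, fun h1 => h (by rw [h1]; exact dvd_zero _)⟩
    · refine Or.inr ⟨p.2 / p.1.2, p.2 % p.1.2, fun h1 => h (Nat.dvd_of_mod_eq_zero h1),
        Nat.mod_lt _ (Nat.pos_of_ne_zero h0), (Nat.div_add_mod _ _).symm⟩
  · rintro (⟨h1, h2⟩ | ⟨c, r, h1, h2, h3⟩) h
    · rw [h1] at h; exact h2 (Nat.eq_zero_of_zero_dvd h)
    · rw [h3, Nat.dvd_add_right (Dvd.intro _ rfl)] at h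
      exact absurd (Nat.le_of_dvd (Nat.pos_of_ne_zero h1) h) (by omega)
end s1

end Guaspari

open FirstOrder Language
open scoped FirstOrder

namespace Guaspari
open PAM

/-! ### Propositional satisfiability -/

theorem prN_inj {a b c d : ℕ} : prN a b = prN c d ↔ a = c ∧ b = d :=
  pr_inj (M := natM) (x := a) (y := b)
theorem le_prN_left (a b : ℕ) : a ≤ prN a b := by unfold prN; omega
theorem le_prN_right (a b : ℕ) : b ≤ prN a b := by unfold prN; nlinarith

/-- clause codes -/
def cl (p1 p2 p3 p4 q1 q2 : ℕ) : ℕ := prN p1 (prN p2 (prN p3 (prN p4 (prN q1 q2))))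

/-- satisfiability of a set of clauses -/
def Sat (C : ℕ → Prop) : Prop := ∃ X : ℕ → Prop, X 0 ∧ ¬ X 1 ∧
  ∀ p1 p2 p3 p4 q1 q2, C (cl p1 p2 p3 p4 q1 q2) → X p1 → X p2 → X p3 → X p4 → X q1 ∨ X q2

theorem sat_compact {C : ℕ → Prop} (h : ∀ N, ∃ X : ℕ → Prop, X 0 ∧ ¬ X 1 ∧
    ∀ p1, p1 < N → ∀ p2, p2 < N → ∀ p3, p3 < N → ∀ p4, p4 < N → ∀ q1, q1 < N → ∀ q2, q2 < N →
      C (cl p1 p2 p3 p4 q1 q2) → X p1 → X p2 → X p3 → X p4 → X q1 ∨ X q2) : Sat C := by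
  choose X h0 h1 h2 using h
  refine ⟨fun i => ∀ᶠ N in (Filter.hyperfilter ℕ : Filter ℕ), X N i, ?_, ?_, ?_⟩
  · exact Filter.Eventually.of_forall h0
  · rw [Ultrafilter.eventually_not.symm]
    exact Filter.Eventually.of_forall h1
  · intro p1 p2 p3 p4 q1 q2 hc a1 a2 a3 a4
    rw [← Ultrafilter.eventually_or]
    have hb : ∀ᶠ N in (Filter.hyperfilter ℕ : Filter ℕ), p1 + p2 + p3 + p4 + q1 + q2 < N := by
      have := Filter.hyperfilter_le_cofinite (α := ℕ)
      rw [Nat.cofinite_eq_atTop] at this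
      exact this (Filter.eventually_gt_atTop _)
    filter_upwards [a1, a2, a3, a4, hb] with N b1 b2 b3 b4 hb
    exact h2 N p1 (by omega) p2 (by omega) p3 (by omega) p4 (by omega) q1 (by omega) q2 (by omega) hc
      b1 b2 b3 b4

/-- coprime moduli -/
def dd (i m : ℕ) : ℕ := 1 + (i + 1) * m

theorem dd_coprime {N m i j : ℕ} (hm : ∀ i, i < N → (i + 1) ∣ m) (hi : i < N) (hj : j < N) (hij : i ≠ j) :
    Nat.Coprime (dd i m) (dd j m) := by
  have key : ∀ i j, i < N → j < N → i < j → Nat.Coprime (dd i m) (dd j m) := by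
    intro i j hi hj hij
    refine Nat.Coprime.symm (Nat.coprime_of_dvd fun q hq h1 h2 => ?_)
    have hqm : ¬ q ∣ m := by
      intro h
      have h3 : q ∣ 1 := (Nat.dvd_add_left (h.mul_left _)).1 h2
      exact hq.one_lt.ne' (Nat.dvd_one.1 h3)
    have h4 : dd j m = dd i m + (j - i) * m := by
      obtain ⟨c, rfl⟩ := Nat.exists_eq_add_of_lt hij
      unfold dd
      rw [show i + c + 1 - i = c + 1 by omega]
      ring
    rw [h4, Nat.dvd_add_right h2] at h1
    rcases (hq.dvd_mul).1 h1 with h | h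
    · have := hm (j - i - 1) (by omega)
      rw [show j - i - 1 + 1 = j - i by omega] at this
      exact hqm (h.trans this)
    · exact hqm h
  rcases lt_or_gt_of_ne hij with h | h
  · exact key i j hi hj h
  · exact (key j i hj hi h).symm

/-- a violation of a clause -/
def Vio (C : ℕ → Prop) (N m a : ℕ) : Prop :=
  ¬ dd 0 m ∣ a ∨ dd 1 m ∣ a ∨ ∃ p1, p1 < N ∧ ∃ p2, p2 < N ∧ ∃ p3, p3 < N ∧ ∃ p4, p4 < N ∧ ∃ q1, q1 < N ∧
    ∃ q2, q2 < N ∧ C (cl p1 p2 p3 p4 q1 q2) ∧ dd p1 m ∣ a ∧ dd p2 m ∣ a ∧ dd p3 m ∣ a ∧ dd p4 m ∣ a ∧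
    ¬ dd q1 m ∣ a ∧ ¬ dd q2 m ∣ a

theorem unsat_iff {C : ℕ → Prop} : ¬ Sat C ↔ ∃ N m B, 1 < N ∧ m ≠ 0 ∧ B ≠ 0 ∧
    (∀ i, i < N → (i + 1) ∣ m) ∧ (∀ i, i < N → dd i m ∣ B) ∧ ∀ a, a ≤ B → Vio C N m a := by
  classical
  constructor
  · intro h
    have h' := mt sat_compact h
    push Not at h'
    obtain ⟨N, hN⟩ := h'
    refine ⟨N + 2, (N + 2).factorial, ∏ i ∈ Finset.range (N + 2), dd i (N + 2).factorial, by omega,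
      Nat.factorial_ne_zero _, Finset.prod_ne_zero_iff.2 fun i _ => by unfold dd; omega, fun i hi => ?_,
      fun i hi => Finset.dvd_prod_of_mem _ (Finset.mem_range.2 hi), fun a _ => ?_⟩
    · exact Nat.dvd_factorial (by omega) (by omega)
    · by_cases h0 : dd 0 (N + 2).factorial ∣ a
      · by_cases h1 : dd 1 (N + 2).factorial ∣ a
        · exact Or.inr (Or.inl h1)
        · obtain ⟨p1, a1, p2, a2, p3, a3, p4, a4, q1, a5, q2, a6, hc, b1, b2, b3, b4, b5, b6⟩ :=
            hN (fun i => dd i (N + 2).factorial ∣ a) h0 h1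
          exact Or.inr (Or.inr ⟨p1, by omega, p2, by omega, p3, by omega, p4, by omega, q1, by omega, q2,
            by omega, hc, b1, b2, b3, b4, b5, b6⟩)
      · exact Or.inl h0
  · rintro ⟨N, m, B, hN, hm, hB, h1, h2, h3⟩ ⟨X, hX0, hX1, hX⟩
    have cop : ∀ i j, i < N → j < N → i ≠ j → Nat.Coprime (dd i m) (dd j m) :=
      fun i j hi hj hij => dd_coprime h1 hi hj hij
    have hdv : (∏ i ∈ (Finset.range N).filter X, dd i m) ∣ B := by
      refine Finset.prod_dvd_of_isRelPrime ?_ ?_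
      · intro i hi j hj hij
        simp only [Finset.coe_filter, Finset.mem_range, Set.mem_ofPred_eq] at hi hj
        exact (Nat.coprime_iff_isRelPrime.1 (cop i j hi.1 hj.1 hij))
      · intro i hi
        simp only [Finset.mem_filter, Finset.mem_range] at hi
        exact h2 i hi.1
    have hmem : ∀ j, j < N → (dd j m ∣ (∏ i ∈ (Finset.range N).filter X, dd i m) ↔ X j) := by
      intro j hj
      constructor
      · intro h
        by_contra hxj
        have : Nat.Coprime (dd j m) (∏ i ∈ (Finset.range N).filter X, dd i m) := by
          refine Nat.Coprime.prod_right fun i hi => ?_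
          simp only [Finset.mem_filter, Finset.mem_range] at hi
          exact cop j i hj hi.1 (fun e => hxj (e ▸ hi.2))
        have h4 := Nat.Coprime.eq_one_of_dvd this h
        unfold dd at h4
        have : (j + 1) * m = 0 := by omega
        rcases Nat.mul_eq_zero.1 this with h | h <;> omega
      · intro h
        exact Finset.dvd_prod_of_mem _ (Finset.mem_filter.2 ⟨Finset.mem_range.2 hj, h⟩)
    rcases h3 _ (Nat.le_of_dvd (Nat.pos_of_ne_zero hB) hdv) with h | h | h
    · exact h ((hmem 0 (by omega)).2 hX0)
    · exact hX1 ((hmem 1 hN).1 h)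
    · obtain ⟨p1, a1, p2, a2, p3, a3, p4, a4, q1, a5, q2, a6, hc, b1, b2, b3, b4, b5, b6⟩ := h
      rw [hmem _ (by assumption)] at b1 b2 b3 b4 b5 b6
      rcases hX _ _ _ _ _ _ hc b1 b2 b3 b4 with h | h
      · exact b5 h
      · exact b6 h

instance NT.dd {k : ℕ} {f g : Tup k ℕ → ℕ} [hf : NT f] [hg : NT g] : NT (fun p => dd (f p) (g p)) := by
  unfold Guaspari.dd; infer_instance
theorem NT.cl {k : ℕ} {f g h f' g' h' : Tup k ℕ → ℕ} [NT f] [NT g] [NT h] [NT f'] [NT g'] [NT h'] :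
    NT (fun p => cl (f p) (g p) (h p) (f' p) (g' p) (h' p)) := by
  unfold Guaspari.cl; infer_instance

set_option synthInstance.maxHeartbeats 1000000 in
set_option synthInstance.maxSize 2000 in
theorem S1.unsat {k : ℕ} {C : Tup k ℕ → ℕ → Prop} (h : S1 (k := k + 1) (fun p => C p.1 p.2)) :
    S1 (fun p => ¬ Sat (C p)) := by
  have hb : S1 (k := k + 10) (fun p => C p.1.1.1.1.1.1.1.1.1.1
      (cl p.1.1.1.1.1.2 p.1.1.1.1.2 p.1.1.1.2 p.1.1.2 p.1.2 p.2)) := by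
    refine S1.lt (k := k + 10) (P := fun p y => C p.1.1.1.1.1.1.1.1.1.1 y)
      (f := fun p => cl p.1.1.1.1.1.2 p.1.1.1.1.2 p.1.1.1.2 p.1.1.2 p.1.2 p.2) NT.cl ?_
    exact @S1.sub (k + 11) (k + 1) _ h
      (fun p : Tup (k + 11) ℕ => (p.1.1.1.1.1.1.1.1.1.1.1, p.2)) (NP.cons inferInstance NP.id')
  have hv : S1 (k := k + 4) (fun p => Vio (C p.1.1.1.1) p.1.1.1.2 p.1.1.2 p.2) := by
    unfold Vio
    infer_instance
  have : S1 (fun p => ∃ N, ∃ m, ∃ B, 1 < N ∧ m ≠ 0 ∧ B ≠ 0 ∧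
    (∀ i, i < N → (i + 1) ∣ m) ∧ (∀ i, i < N → dd i m ∣ B) ∧ ∀ a, a ≤ B → Vio (C p) N m a) := by
    infer_instance
  exact this.congr fun p => unsat_iff

end Guaspari

open FirstOrder Language
open scoped FirstOrder

namespace Guaspari
open PAM

/-! ### Partial recursive functions have Σ1 graphs -/

/-- atoms for primitive recursion -/
def atN (n v : ℕ) : ℕ := prN n v + 2
instance NT.atN {k : ℕ} {f g : Tup k ℕ → ℕ} [hf : NT f] [hg : NT g] : NT (fun p => atN (f p) (g p)) := by
  unfold Guaspari.atN; infer_instance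
theorem atN_inj {a b c d : ℕ} : atN a b = atN c d ↔ a = c ∧ b = d := by
  unfold atN; rw [Nat.add_right_cancel_iff, prN_inj]

theorem cl_inj {a b c d e f a' b' c' d' e' f' : ℕ} : cl a b c d e f = cl a' b' c' d' e' f' ↔
    a = a' ∧ b = b' ∧ c = c' ∧ d = d' ∧ e = e' ∧ f = f' := by
  unfold cl; simp only [prN_inj]

/-- clauses for primitive recursion -/
def precC (F : ℕ → Prop) (G : ℕ → ℕ → ℕ → Prop) (n w : ℕ) (c : ℕ) : Prop :=
  (∃ v, F v ∧ c = cl 0 0 0 0 (atN 0 v) 1) ∨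
  (∃ y, ∃ i, ∃ v, G y i v ∧ c = cl (atN y i) 0 0 0 (atN (y + 1) v) 1) ∨
  c = cl (atN n w) 0 0 0 1 1

theorem precC_iff (f : ℕ → Part ℕ) (g : ℕ → ℕ → Part ℕ) (a n w : ℕ) :
    w ∈ (Nat.rec (f a) (fun y IH => IH.bind fun i => g y i) n : Part ℕ) ↔
      ¬ Sat (precC (fun v => v ∈ f a) (fun y i v => v ∈ g y i) n w) := by
  constructor
  · rintro h ⟨X, h0, h1, h2⟩
    have key : ∀ n w, w ∈ (Nat.rec (f a) (fun y IH => IH.bind fun i => g y i) n : Part ℕ) → X (atN n w) := by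
      intro n
      induction n with
      | zero =>
        intro w hw
        exact (h2 0 0 0 0 (atN 0 w) 1 (Or.inl ⟨w, hw, rfl⟩) h0 h0 h0 h0).resolve_right h1
      | succ n ih =>
        intro w hw
        obtain ⟨i, hi, hw⟩ := Part.mem_bind_iff.1 hw
        exact (h2 (atN n i) 0 0 0 (atN (n + 1) w) 1 (Or.inr (Or.inl ⟨n, i, w, hw, rfl⟩)) (ih i hi) h0 h0 h0).resolve_right h1
    exact h1 ((h2 (atN n w) 0 0 0 1 1 (Or.inr (Or.inr rfl)) (key n w h) h0 h0 h0).elim id id)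
  · intro h
    by_contra hw
    refine h ⟨fun c => c = 0 ∨ ∃ m v, c = atN m v ∧ v ∈ (Nat.rec (f a) (fun y IH => IH.bind fun i => g y i) m : Part ℕ),
      Or.inl rfl, ?_, ?_⟩
    · rintro (h | ⟨m, v, h, _⟩)
      · omega
      · unfold atN at h; omega
    · rintro p1 p2 p3 p4 q1 q2 (⟨v, hv, hc⟩ | ⟨y, i, v, hv, hc⟩ | hc) a1 _ _ _
      · rw [cl_inj] at hc
        obtain ⟨_, _, _, _, rfl, _⟩ := hc
        exact Or.inl (Or.inr ⟨0, v, rfl, hv⟩)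
      · rw [cl_inj] at hc
        obtain ⟨rfl, _, _, _, rfl, _⟩ := hc
        rcases a1 with a1 | ⟨m, u, h, hu⟩
        · unfold atN at a1; omega
        · obtain ⟨rfl, rfl⟩ := atN_inj.1 h
          exact Or.inl (Or.inr ⟨y + 1, v, rfl, Part.mem_bind_iff.2 ⟨i, hu, hv⟩⟩)
      · rw [cl_inj] at hc
        obtain ⟨rfl, _, _, _, rfl, _⟩ := hc
        rcases a1 with a1 | ⟨m, u, h, hu⟩
        · unfold atN at a1; omega
        · obtain ⟨rfl, rfl⟩ := atN_inj.1 h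
          exact (hw hu).elim

theorem S1.unpair {k : ℕ} {P : Tup k ℕ → ℕ → ℕ → Prop} {f : Tup k ℕ → ℕ} (hf : NT f)
    (h : S1 (k := k + 2) (fun p => P p.1.1 p.1.2 p.2)) :
    S1 (fun p => P p (f p).unpair.1 (f p).unpair.2) := by
  have := hf.wk.wk
  have : S1 (fun p => ∃ a, ∃ b, f p = Nat.pair a b ∧ P p a b) := inferInstance
  refine this.congr fun p => ⟨fun h => ⟨_, _, (Nat.pair_unpair _).symm, h⟩, ?_⟩
  rintro ⟨a, b, h1, h2⟩
  rw [h1]; simpa using h2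

theorem S1.call {F : ℕ → Part ℕ} (h : S1 (k := 2) (fun p => p.2 ∈ F p.1.2)) {k : ℕ} {f g : Tup k ℕ → ℕ}
    (hf : NT f) (hg : NT g) : S1 (fun p => g p ∈ F (f p)) :=
  S1.rel2 (R := fun x y => y ∈ F x) h hf hg

theorem partrec_S1 {f : ℕ →. ℕ} (hf : Nat.Partrec f) : S1 (k := 2) (fun p => p.2 ∈ f p.1.2) := by
  induction hf with
  | zero =>
    have : S1 (k := 2) (fun p => p.2 = 0) := inferInstance
    exact this.congr fun p => Part.mem_some_iff
  | succ =>
    have : S1 (k := 2) (fun p => p.2 = p.1.2 + 1) := inferInstance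
    exact this.congr fun p => Part.mem_some_iff
  | left =>
    have := S1.unpair (k := 2) (P := fun p a b => p.2 = a) (f := fun p => p.1.2) inferInstance inferInstance
    exact this.congr fun p => Part.mem_some_iff
  | right =>
    have := S1.unpair (k := 2) (P := fun p a b => p.2 = b) (f := fun p => p.1.2) inferInstance inferInstance
    exact this.congr fun p => Part.mem_some_iff
  | @pair f g _ _ h1 h2 =>
    have i1 := @S1.call f h1
    have i2 := @S1.call g h2
    have : S1 (k := 2) (fun p => ∃ a, ∃ b, (a ∈ f p.1.2 ∧ b ∈ g p.1.2) ∧ p.2 = Nat.pair a b) := by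
      have j1 : S1 (k := 4) (fun p => p.1.2 ∈ f p.1.1.1.2) := i1 inferInstance inferInstance
      have j2 : S1 (k := 4) (fun p => p.2 ∈ g p.1.1.1.2) := i2 inferInstance inferInstance
      infer_instance
    refine this.congr fun p => ?_
    simp [Seq.seq]
    constructor
    · rintro ⟨a, h1, b, h2, h3⟩; exact ⟨a, b, ⟨h1, h2⟩, h3.symm⟩
    · rintro ⟨a, b, ⟨h1, h2⟩, h3⟩; exact ⟨a, h1, b, h2, h3.symm⟩
  | @comp f g _ _ h1 h2 =>
    have : S1 (k := 2) (fun p => ∃ a, a ∈ g p.1.2 ∧ p.2 ∈ f a) := by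
      have j1 : S1 (k := 3) (fun p => p.1.2 ∈ f p.2) := S1.call h1 inferInstance inferInstance
      have j2 : S1 (k := 3) (fun p => p.2 ∈ g p.1.1.2) := S1.call h2 inferInstance inferInstance
      infer_instance
    exact this.congr fun p => Part.mem_bind_iff
  | @prec f g _ _ h1 h2 =>
    have key : S1 (k := 4) (fun p => ¬ Sat (precC (fun v => v ∈ f p.1.2)
      (fun y i v => v ∈ g (Nat.pair p.1.2 (Nat.pair y i))) p.2 p.1.1.2)) := by
      refine S1.unsat ?_
      unfold precC
      have j1 : S1 (k := 6) (fun p => p.2 ∈ f p.1.1.1.2) := S1.call h1 inferInstance inferInstance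
      have j2 : S1 (k := 8) (fun p => p.2 ∈ g (Nat.pair p.1.1.1.1.1.2 (Nat.pair p.1.1.2 p.1.2))) :=
        S1.call h2 inferInstance inferInstance
      have j3 := @NT.cl
      unfold cl
      infer_instance
    have := S1.unpair (k := 2) (P := fun p a b => ¬ Sat (precC (fun v => v ∈ f a)
      (fun y i v => v ∈ g (Nat.pair a (Nat.pair y i))) b p.2)) (f := fun p => p.1.2) inferInstance key
    refine this.congr fun p => ?_
    rw [← precC_iff f]
    rfl
  | @rfind f _ h =>
    have : S1 (k := 2) (fun p => 0 ∈ f (Nat.pair p.1.2 p.2) ∧ ∀ m, m < p.2 → ∃ w, w ≠ 0 ∧ w ∈ f (Nat.pair p.1.2 m)) := by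
      have j1 : S1 (k := 2) (fun p => 0 ∈ f (Nat.pair p.1.2 p.2)) := S1.call h inferInstance inferInstance
      have j2 : S1 (k := 4) (fun p => p.2 ∈ f (Nat.pair p.1.1.1.2 p.1.2)) := S1.call h inferInstance inferInstance
      infer_instance
    refine this.congr fun p => ?_
    refine Nat.mem_rfind.trans (and_congr ?_ (forall_congr' fun m => imp_congr Iff.rfl ?_))
    · simp
    · refine (Part.mem_map_iff _).trans (exists_congr fun w => ?_)
      rw [decide_eq_false_iff_not, and_comm]

theorem CompThy.S1 {T : Thy} (h : CompThy T) : S1 (k := 1) (fun p => ∃ φ ∈ T, gnum φ = p.2) := by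
  have h1 := ComputablePred.to_re h
  have h2 := partrec_S1 (show Nat.Partrec _ from h1)
  have h3 := @S1.ex 1 (fun p v => v ∈ (↑(Encodable.decode (α := ℕ) p.2) : Part ℕ).bind fun a =>
        Part.map Encodable.encode ((fun a => Part.assert ((fun m => ∃ φ ∈ T, gnum φ = m) a) fun _ => Part.some ()) a)) h2
  refine h3.congr fun p => ?_
  simp
end Guaspari

open FirstOrder Language
open scoped FirstOrder

namespace Guaspari
open PAM

/-! ### Coding of syntax -/

/-- decoding lists -/
def dL (e : ℕ) : List ℕ := (Encodable.decode (α := List ℕ) e).getD []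
theorem dL_encode (l : List ℕ) : dL (Encodable.encode l) = l := by simp [dL]
theorem dL_prim : Primrec dL := Primrec.option_getD.comp Primrec.decode (Primrec.const [])

/-- append of list codes -/
def appN (a b : ℕ) : ℕ := Encodable.encode (dL a ++ dL b)
/-- snoc of list codes -/
def snocN (a b : ℕ) : ℕ := Encodable.encode (dL a ++ [b])
/-- length of list codes -/
def lenN (a : ℕ) : ℕ := (dL a).length
/-- entry of list codes -/
def nthN (a i : ℕ) : ℕ := (dL a).getD i 0

theorem NT.prim2 {F : ℕ → ℕ → ℕ} (h : Primrec₂ F) {k : ℕ} {f g : Tup k ℕ → ℕ} (hf : NT f) (hg : NT g) :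
    NT (fun p => F (f p) (g p)) := by
  refine NT.fun2 (F := F) ?_ hf hg
  have h1 := partrec_S1 (Nat.Partrec.of_primrec (Primrec₂.unpaired'.2 h))
  have h2 : S1 (k := 3) _ := S1.call (k := 3) h1 (f := fun p => Nat.pair p.1.1.2 p.1.2) (g := fun p => p.2)
    inferInstance inferInstance
  refine h2.congr fun p => ?_
  simp [Nat.unpaired]

section
variable {k : ℕ} {f g : Tup k ℕ → ℕ} [hf : NT f] [hg : NT g]
instance NT.appN : NT (fun p => appN (f p) (g p)) := by
  refine NT.prim2 (F := Guaspari.appN) ?_ hf hg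
  exact Primrec.encode.comp₂ (Primrec.list_append.comp₂ (dL_prim.comp₂ Primrec₂.left) (dL_prim.comp₂ Primrec₂.right))
instance NT.snocN : NT (fun p => snocN (f p) (g p)) := by
  refine NT.prim2 (F := Guaspari.snocN) ?_ hf hg
  exact Primrec.encode.comp₂ (Primrec.list_concat.comp₂ (dL_prim.comp₂ Primrec₂.left) Primrec₂.right)
instance NT.nthN : NT (fun p => nthN (f p) (g p)) := by
  refine NT.prim2 (F := Guaspari.nthN) ?_ hf hg
  exact (Primrec.list_getD 0).comp₂ (dL_prim.comp₂ Primrec₂.left) Primrec₂.right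
end
instance NT.lenN {k : ℕ} {f : Tup k ℕ → ℕ} [hf : NT f] : NT (fun p => lenN (f p)) := by
  refine NT.prim2 (F := fun x _ => Guaspari.lenN x) ?_ hf hf
  exact Primrec.list_length.comp₂ (dL_prim.comp₂ Primrec₂.left)

/-- codes of environments -/
def eN {n : ℕ} (v : Fin n → ℕ) : ℕ := Encodable.encode (List.ofFn v)

theorem eN_inj {m n : ℕ} {v : Fin m → ℕ} {w : Fin n → ℕ} (h : eN v = eN w) :
    (⟨m, v⟩ : Σ n, Fin n → ℕ) = ⟨n, w⟩ := List.ofFn_inj'.1 (Encodable.encode_injective h)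
theorem eN_surj (e : ℕ) : ∃ (n : ℕ) (v : Fin n → ℕ), eN v = e := by
  refine ⟨(Denumerable.ofNat (List ℕ) e).length, (Denumerable.ofNat (List ℕ) e).get, ?_⟩
  unfold eN
  rw [List.ofFn_get]
  exact Denumerable.encode_ofNat (α := List ℕ) e
theorem lenN_eN {n : ℕ} (v : Fin n → ℕ) : lenN (eN v) = n := by simp [lenN, eN, dL_encode]
theorem nthN_eN {n : ℕ} (v : Fin n → ℕ) (i : Fin n) : nthN (eN v) i = v i := by
  simp [nthN, eN, dL_encode]
theorem snocN_eN {n : ℕ} (v : Fin n → ℕ) (a : ℕ) : snocN (eN v) a = eN (Fin.snoc v a : Fin (n + 1) → ℕ) := by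
  unfold snocN eN
  rw [dL_encode, List.ofFn_succ', List.concat_eq_append]
  simp
theorem lt_eN {n : ℕ} (v : Fin n → ℕ) (i : Fin n) : v i < eN v := by
  have key : ∀ (l : List ℕ) (a : ℕ), a ∈ l → a < Encodable.encode l := by
    intro l
    induction l with
    | nil => simp
    | cons b l ih =>
      intro a ha
      rw [Encodable.encode_list_cons]
      rcases List.mem_cons.1 ha with rfl | ha
      · exact Nat.lt_succ_of_le (Nat.left_le_pair _ _)
      · exact Nat.lt_succ_of_lt ((ih a ha).trans_le (Nat.right_le_pair _ _))
  exact key _ _ (by simp)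
theorem eN_nil (v : Fin 0 → ℕ) : eN v = 0 := by simp [eN]

theorem enc_map {α : Type} [Encodable α] (l : List α) :
    Encodable.encode l = Encodable.encode (l.map (Encodable.encode : α → ℕ)) := by
  induction l with
  | nil => rfl
  | cons a l ih => rw [List.map_cons, Encodable.encode_list_cons, Encodable.encode_list_cons, ← ih]; rfl

theorem appN_enc {α : Type} [Encodable α] (l l' : List α) :
    appN (Encodable.encode l) (Encodable.encode l') = Encodable.encode (l ++ l') := by
  rw [enc_map l, enc_map l', enc_map (l ++ l'), appN, dL_encode, dL_encode, List.map_append]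

/-- cons of list codes -/
@[reducible] def cnN (a b : ℕ) : ℕ := Nat.pair a b + 1
/-- term codes -/
@[reducible] def tvar (i : ℕ) : ℕ := cnN (2 * (2 * i + 1)) 0
/-- term codes -/
@[reducible] def tzero : ℕ := cnN (2 * Nat.pair 0 0 + 1) 0
/-- term codes -/
@[reducible] def tsucc (t : ℕ) : ℕ := cnN (2 * Nat.pair 1 0 + 1) t
/-- term codes -/
@[reducible] def tadd (t u : ℕ) : ℕ := cnN (2 * Nat.pair 2 0 + 1) (appN t u)
/-- term codes -/
@[reducible] def tmul (t u : ℕ) : ℕ := cnN (2 * Nat.pair 2 1 + 1) (appN t u)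
/-- formula codes -/
@[reducible] def ffls (n : ℕ) : ℕ := cnN (2 * (2 * (n + 2) + 1) + 1) 0
/-- formula codes -/
@[reducible] def feq (n t u : ℕ) : ℕ := cnN (2 * Nat.pair n t) (cnN (2 * Nat.pair n u) 0)
/-- formula codes -/
@[reducible] def fle (n t u : ℕ) : ℕ := cnN (2 * (2 * Nat.pair 2 0) + 1) (cnN (2 * (2 * n + 1) + 1) (feq n t u))
/-- formula codes -/
@[reducible] def fimp (g h : ℕ) : ℕ := cnN (2 * (2 * 0 + 1) + 1) (appN g h)
/-- formula codes -/
@[reducible] def fall (g : ℕ) : ℕ := cnN (2 * (2 * 1 + 1) + 1) g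

/-- code of a term -/
def eT {n : ℕ} (t : LA.Term (Empty ⊕ Fin n)) : ℕ := Encodable.encode t.listEncode
/-- code of a formula -/
def eF {n : ℕ} (φ : LA.BoundedFormula Empty n) : ℕ := Encodable.encode φ.listEncode

theorem eT_inj {n : ℕ} {t u : LA.Term (Empty ⊕ Fin n)} (h : eT t = eT u) : t = u :=
  Term.listEncode_injective (Encodable.encode_injective h)
theorem eF_inj {n : ℕ} {φ ψ : LA.BoundedFormula Empty n} (h : eF φ = eF ψ) : φ = ψ := by
  have := BoundedFormula.listEncode_sigma_injective (a₁ := ⟨n, φ⟩) (a₂ := ⟨n, ψ⟩) (Encodable.encode_injective h)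
  simpa using this
theorem gnum_eF (φ : Snt) : gnum φ = eF φ := rfl

theorem zeroT_eq {n : ℕ} : (zeroT : LA.Term (Empty ⊕ Fin n)) = Term.func (l := 0) (show LA.Functions 0 from Unit.unit) default := rfl

theorem eT_var {n : ℕ} (i : Fin n) : eT (vT i) = tvar i := rfl
theorem eT_zero {n : ℕ} : eT (zeroT : LA.Term (Empty ⊕ Fin n)) = tzero := rfl
theorem eT_succ {n : ℕ} (t : LA.Term (Empty ⊕ Fin n)) : eT (succT t) = tsucc (eT t) := by
  unfold eT succT Functions.apply₁
  rw [Term.listEncode, Encodable.encode_list_cons]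
  have : (List.finRange 1).flatMap (fun i => (![t] i).listEncode) = t.listEncode := by
    simp [List.finRange_succ]
  rw [this]
  rfl
theorem eT_two {n : ℕ} (f : LA.Functions 2) (t u : LA.Term (Empty ⊕ Fin n)) : eT (Functions.apply₂ f t u) =
    cnN (2 * Nat.pair 2 (Encodable.encode f) + 1) (appN (eT t) (eT u)) := by
  unfold eT Functions.apply₂
  rw [Term.listEncode, Encodable.encode_list_cons, appN_enc]
  have : (List.finRange 2).flatMap (fun i => (![t, u] i).listEncode) = t.listEncode ++ u.listEncode := by
    simp [List.finRange_succ]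
  rw [this]
  rfl
theorem eT_add {n : ℕ} (t u : LA.Term (Empty ⊕ Fin n)) : eT (addT t u) = tadd (eT t) (eT u) := by
  unfold addT; rw [eT_two]; rfl
theorem eT_mul {n : ℕ} (t u : LA.Term (Empty ⊕ Fin n)) : eT (mulT t u) = tmul (eT t) (eT u) := by
  unfold mulT; rw [eT_two]; rfl
theorem eF_fls {n : ℕ} : eF (⊥ : LA.BoundedFormula Empty n) = ffls n := rfl
theorem eF_eq {n : ℕ} (t u : LA.Term (Empty ⊕ Fin n)) : eF (BoundedFormula.equal t u) = feq n (eT t) (eT u) := rfl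
theorem eF_le {n : ℕ} (t u : LA.Term (Empty ⊕ Fin n)) : eF (leF t u) = fle n (eT t) (eT u) := by
  unfold eF leF Relations.boundedFormula₂ Relations.boundedFormula
  rw [BoundedFormula.listEncode]
  have : (List.finRange 2).map (fun i => (Sum.inl ⟨n, ![t, u] i⟩ : (Σ k, LA.Term (Empty ⊕ Fin k)) ⊕ ((Σ n, LA.Relations n) ⊕ ℕ))) = [Sum.inl ⟨n, t⟩, Sum.inl ⟨n, u⟩] := by
    simp [List.finRange_succ]
  rw [this]
  rfl
theorem eF_imp {n : ℕ} (φ ψ : LA.BoundedFormula Empty n) : eF (φ ⟹ ψ) = fimp (eF φ) (eF ψ) := by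
  show Encodable.encode (BoundedFormula.listEncode (φ.imp ψ)) = _
  rw [BoundedFormula.listEncode, List.cons_append, Encodable.encode_list_cons]
  unfold eF fimp
  rw [appN_enc]
  rfl
theorem eF_all {n : ℕ} (φ : LA.BoundedFormula Empty (n + 1)) : eF (∀' φ) = fall (eF φ) := rfl

theorem term_cases {n : ℕ} {Q : LA.Term (Empty ⊕ Fin n) → Prop} (h1 : ∀ i, Q (vT i)) (h2 : Q zeroT)
    (h3 : ∀ t, Q t → Q (succT t)) (h4 : ∀ t u, Q t → Q u → Q (addT t u)) (h5 : ∀ t u, Q t → Q u → Q (mulT t u))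
    (t : LA.Term (Empty ⊕ Fin n)) : Q t := by
  induction t with
  | var x =>
    rcases x with x | i
    · exact x.elim
    · exact h1 i
  | @func l f ts ih =>
    match l, f, ts, ih with
    | 0, f, ts, ih =>
      have : Term.func f ts = zeroT := by
        rw [zeroT_eq]; congr 1; exact Subsingleton.elim _ _
      rw [this]; exact h2
    | 1, f, ts, ih =>
      have : Term.func f ts = succT (ts 0) := by
        unfold succT Functions.apply₁; congr 1; funext i; fin_cases i; rfl
      rw [this]; exact h3 _ (ih 0)
    | 2, (false : Bool), ts, ih =>
      have : Term.func (show LA.Functions 2 from false) ts = addT (ts 0) (ts 1) := by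
        unfold addT Functions.apply₂; congr 1; funext i; fin_cases i <;> rfl
      exact this ▸ h4 _ _ (ih 0) (ih 1)
    | 2, (true : Bool), ts, ih =>
      have : Term.func (show LA.Functions 2 from true) ts = mulT (ts 0) (ts 1) := by
        unfold mulT Functions.apply₂; congr 1; funext i; fin_cases i <;> rfl
      exact this ▸ h5 _ _ (ih 0) (ih 1)
    | (n + 3), f, ts, ih => exact f.elim

theorem fml_cases {Q : ∀ n, LA.BoundedFormula Empty n → Prop} (h1 : ∀ n, Q n ⊥)
    (h2 : ∀ n t u, Q n (BoundedFormula.equal t u)) (h3 : ∀ n t u, Q n (leF t u))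
    (h4 : ∀ n φ ψ, Q n φ → Q n ψ → Q n (φ ⟹ ψ)) (h5 : ∀ n φ, Q (n + 1) φ → Q n (∀' φ))
    {n : ℕ} (φ : LA.BoundedFormula Empty n) : Q n φ := by
  induction φ with
  | falsum => exact h1 _
  | equal t u => exact h2 _ t u
  | @rel n l R ts =>
    match l, R, ts with
    | 0, R, ts => exact R.elim
    | 1, R, ts => exact R.elim
    | 2, R, ts =>
      have : BoundedFormula.rel R ts = leF (ts 0) (ts 1) := by
        unfold leF Relations.boundedFormula₂ Relations.boundedFormula; congr 1; funext i; fin_cases i <;> rfl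
      exact this ▸ h3 _ _ _
    | l + 3, R, ts => exact R.elim
  | imp φ ψ a b => exact h4 _ _ _ a b
  | all φ a => exact h5 _ _ a

end Guaspari

open FirstOrder Language
open scoped FirstOrder

namespace Guaspari
open PAM

/-! ### The clauses -/

/-- names -/
@[reducible] def zN : ℕ := prN 0 0
/-- names -/
@[reducible] def sN (a : ℕ) : ℕ := prN 1 a
/-- names -/
@[reducible] def aN (a b : ℕ) : ℕ := prN 2 (prN a b)
/-- names -/
@[reducible] def mN (a b : ℕ) : ℕ := prN 3 (prN a b)
/-- names -/
@[reducible] def wN (g e : ℕ) : ℕ := prN 4 (prN g e)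
/-- names -/
@[reducible] def nN (n : ℕ) : ℕ := prN 5 n

/-- atoms -/
def atom (t x y z : ℕ) : ℕ := prN t (prN x (prN y z)) + 2
instance NT.atom {k : ℕ} {f g h i : Tup k ℕ → ℕ} [NT f] [NT g] [NT h] [NT i] :
    NT (fun p => atom (f p) (g p) (h p) (i p)) := by
  unfold Guaspari.atom; infer_instance
instance NT.icl {k : ℕ} {f g h f' g' h' : Tup k ℕ → ℕ} [NT f] [NT g] [NT h] [NT f'] [NT g'] [NT h'] :
    NT (fun p => Guaspari.cl (f p) (g p) (h p) (f' p) (g' p) (h' p)) := NT.cl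
theorem atom_inj {a b c d a' b' c' d' : ℕ} : atom a b c d = atom a' b' c' d' ↔ a = a' ∧ b = b' ∧ c = c' ∧ d = d' := by
  unfold atom; rw [Nat.add_right_cancel_iff]; simp only [prN_inj]
theorem atom_ne0 {a b c d : ℕ} : atom a b c d ≠ 0 := by unfold atom; omega
theorem atom_ne1 {a b c d : ℕ} : atom a b c d ≠ 1 := by unfold atom; omega

/-- term value atoms -/
@[reducible] def aEv (t e a : ℕ) : ℕ := atom 0 t e a
/-- well-formedness atoms -/
@[reducible] def aWf (g e : ℕ) : ℕ := atom 1 g e 0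
/-- truth atoms -/
@[reducible] def aTr (g e : ℕ) : ℕ := atom 2 g e 0
/-- equality atoms -/
@[reducible] def aEq (a b : ℕ) : ℕ := atom 3 a b 0
/-- order atoms -/
@[reducible] def aLe (a b : ℕ) : ℕ := atom 4 a b 0

/-- clauses for terms -/
def C1 (c : ℕ) : Prop :=
  (∃ e, ∃ i, i < lenN e ∧ c = cl 0 0 0 0 (aEv (tvar i) e (nthN e i)) 1) ∨
  (∃ e, c = cl 0 0 0 0 (aEv tzero e zN) 1) ∨
  (∃ e, ∃ t, ∃ a, c = cl (aEv t e a) 0 0 0 (aEv (tsucc t) e (sN a)) 1) ∨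
  (∃ e, ∃ t, ∃ a, ∃ u, ∃ b, c = cl (aEv t e a) (aEv u e b) 0 0 (aEv (tadd t u) e (aN a b)) 1) ∨
  (∃ e, ∃ t, ∃ a, ∃ u, ∃ b, c = cl (aEv t e a) (aEv u e b) 0 0 (aEv (tmul t u) e (mN a b)) 1)
/-- clauses for well-formedness -/
def C2 (c : ℕ) : Prop :=
  (∃ e, c = cl 0 0 0 0 (aWf (ffls (lenN e)) e) 1) ∨
  (∃ e, ∃ t, ∃ a, ∃ u, ∃ b, c = cl (aEv t e a) (aEv u e b) 0 0 (aWf (feq (lenN e) t u) e) 1) ∨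
  (∃ e, ∃ t, ∃ a, ∃ u, ∃ b, c = cl (aEv t e a) (aEv u e b) 0 0 (aWf (fle (lenN e) t u) e) 1) ∨
  (∃ e, ∃ g, ∃ h, c = cl (aWf g e) (aWf h e) 0 0 (aWf (fimp g h) e) 1) ∨
  (∃ e, ∃ g, c = cl (aWf g (snocN e 0)) 0 0 0 (aWf (fall g) e) 1)
/-- clauses for truth of atomic formulas -/
def C3 (c : ℕ) : Prop :=
  (∃ e, c = cl (aTr (ffls (lenN e)) e) 0 0 0 1 1) ∨
  (∃ e, ∃ t, ∃ a, ∃ u, ∃ b, c = cl (aEv t e a) (aEv u e b) (aTr (feq (lenN e) t u) e) 0 (aEq a b) 1) ∨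
  (∃ e, ∃ t, ∃ a, ∃ u, ∃ b, c = cl (aEv t e a) (aEv u e b) (aEq a b) 0 (aTr (feq (lenN e) t u) e) 1) ∨
  (∃ e, ∃ t, ∃ a, ∃ u, ∃ b, c = cl (aEv t e a) (aEv u e b) (aTr (fle (lenN e) t u) e) 0 (aLe a b) 1) ∨
  (∃ e, ∃ t, ∃ a, ∃ u, ∃ b, c = cl (aEv t e a) (aEv u e b) (aLe a b) 0 (aTr (fle (lenN e) t u) e) 1)
/-- clauses for truth of compound formulas -/
def C4 (c : ℕ) : Prop :=
  (∃ e, ∃ g, ∃ h, c = cl (aWf g e) (aWf h e) (aTr (fimp g h) e) (aTr g e) (aTr h e) 1) ∨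
  (∃ e, ∃ g, ∃ h, c = cl (aWf g e) (aWf h e) 0 0 (aTr (fimp g h) e) (aTr g e)) ∨
  (∃ e, ∃ g, ∃ h, c = cl (aWf g e) (aTr h e) 0 0 (aTr (fimp g h) e) 1) ∨
  (∃ e, ∃ g, ∃ a, c = cl (aWf g (snocN e a)) (aTr (fall g) e) 0 0 (aTr g (snocN e a)) 1) ∨
  (∃ e, ∃ g, c = cl (aWf g (snocN e (wN g e))) (aTr g (snocN e (wN g e))) 0 0 (aTr (fall g) e) 1)
/-- clauses for equality -/
def C5 (c : ℕ) : Prop :=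
  (∃ a, c = cl 0 0 0 0 (aEq a a) 1) ∨
  (∃ a, ∃ b, ∃ d, c = cl (aEq a b) (aEq a d) 0 0 (aEq b d) 1) ∨
  (∃ a, ∃ b, c = cl (aEq a b) 0 0 0 (aEq (sN a) (sN b)) 1) ∨
  (∃ a, ∃ b, ∃ a', ∃ b', c = cl (aEq a a') (aEq b b') 0 0 (aEq (aN a b) (aN a' b')) 1) ∨
  (∃ a, ∃ b, ∃ a', ∃ b', c = cl (aEq a a') (aEq b b') 0 0 (aEq (mN a b) (mN a' b')) 1) ∨
  (∃ a, ∃ b, ∃ a', ∃ b', c = cl (aEq a a') (aEq b b') (aLe a b) 0 (aLe a' b') 1) ∨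
  c = cl 0 0 0 0 (aEq (nN 0) zN) 1 ∨
  (∃ n, c = cl 0 0 0 0 (aEq (nN (n + 1)) (sN (nN n))) 1)
/-- axioms and goal -/
def C6 (Ax : ℕ → Prop) (t a b : ℕ) (c : ℕ) : Prop :=
  (∃ m, Ax m ∧ c = cl 0 0 0 0 (aTr m 0) 1) ∨
  c = cl (aTr t (snocN (snocN 0 (nN a)) (nN b))) 0 0 0 1 1

/-- all clauses -/
def CC (Ax : ℕ → Prop) (t a b : ℕ) (c : ℕ) : Prop := C1 c ∨ C2 c ∨ C3 c ∨ C4 c ∨ C5 c ∨ C6 Ax t a b c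

set_option synthInstance.maxHeartbeats 1000000 in
set_option synthInstance.maxSize 2000 in
theorem S1.C1 : S1 (k := 1) (fun p => C1 p.2) := by unfold Guaspari.C1; infer_instance
set_option synthInstance.maxHeartbeats 1000000 in
set_option synthInstance.maxSize 2000 in
theorem S1.C2 : S1 (k := 1) (fun p => C2 p.2) := by unfold Guaspari.C2; infer_instance
set_option synthInstance.maxHeartbeats 1000000 in
set_option synthInstance.maxSize 2000 in
theorem S1.C3 : S1 (k := 1) (fun p => C3 p.2) := by unfold Guaspari.C3; infer_instance
set_option synthInstance.maxHeartbeats 1000000 in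
set_option synthInstance.maxSize 2000 in
theorem S1.C4 : S1 (k := 1) (fun p => C4 p.2) := by unfold Guaspari.C4; infer_instance
set_option synthInstance.maxHeartbeats 1000000 in
set_option synthInstance.maxSize 2000 in
theorem S1.C5 : S1 (k := 1) (fun p => C5 p.2) := by unfold Guaspari.C5; infer_instance

theorem S1.CC {Ax : ℕ → Prop} (h : S1 (k := 1) (fun p => Ax p.2)) (t : ℕ) :
    S1 (k := 2) (fun p => ¬ Sat (CC Ax t p.1.2 p.2)) := by
  refine S1.unsat ?_
  have h1 : S1 (k := 3) (fun p => Guaspari.C1 p.2) := S1.rel1 S1.C1 inferInstance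
  have h2 : S1 (k := 3) (fun p => Guaspari.C2 p.2) := S1.rel1 S1.C2 inferInstance
  have h3 : S1 (k := 3) (fun p => Guaspari.C3 p.2) := S1.rel1 S1.C3 inferInstance
  have h4 : S1 (k := 3) (fun p => Guaspari.C4 p.2) := S1.rel1 S1.C4 inferInstance
  have h5 : S1 (k := 3) (fun p => Guaspari.C5 p.2) := S1.rel1 S1.C5 inferInstance
  have h6 : S1 (k := 3) (fun p => Guaspari.C6 Ax t p.1.1.2 p.1.2 p.2) := by
    unfold Guaspari.C6
    have : S1 (k := 4) (fun p => Ax p.2) := S1.rel1 h inferInstance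
    infer_instance
  unfold Guaspari.CC
  infer_instance

/-- `X` satisfies the clauses `R` -/
def Ok (X : ℕ → Prop) (R : ℕ → Prop) : Prop :=
  ∀ p1 p2 p3 p4 q1 q2, R (cl p1 p2 p3 p4 q1 q2) → X p1 → X p2 → X p3 → X p4 → X q1 ∨ X q2
section ok
variable {X : ℕ → Prop}
theorem Ok_or {R S : ℕ → Prop} : Ok X (fun c => R c ∨ S c) ↔ Ok X R ∧ Ok X S :=
  ⟨fun h => ⟨fun _ _ _ _ _ _ r => h _ _ _ _ _ _ (Or.inl r), fun _ _ _ _ _ _ r => h _ _ _ _ _ _ (Or.inr r)⟩,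
    fun h _ _ _ _ _ _ r => r.elim (h.1 _ _ _ _ _ _) (h.2 _ _ _ _ _ _)⟩
theorem Ok_ex {R : ℕ → ℕ → Prop} : Ok X (fun c => ∃ y, R y c) ↔ ∀ y, Ok X (R y) :=
  ⟨fun h y _ _ _ _ _ _ r => h _ _ _ _ _ _ ⟨y, r⟩, fun h _ _ _ _ _ _ r => r.elim fun y r => h y _ _ _ _ _ _ r⟩
theorem Ok_and {A : Prop} {R : ℕ → Prop} : Ok X (fun c => A ∧ R c) ↔ (A → Ok X R) :=
  ⟨fun h y _ _ _ _ _ _ r => h _ _ _ _ _ _ ⟨y, r⟩, fun h _ _ _ _ _ _ r => h r.1 _ _ _ _ _ _ r.2⟩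
theorem Ok_eq {p1 p2 p3 p4 q1 q2 : ℕ} : Ok X (fun c => c = cl p1 p2 p3 p4 q1 q2) ↔
    (X p1 → X p2 → X p3 → X p4 → X q1 ∨ X q2) := by
  constructor
  · intro h; exact h _ _ _ _ _ _ rfl
  · intro h a b c d e f r
    rw [cl_inj] at r
    obtain ⟨rfl, rfl, rfl, rfl, rfl, rfl⟩ := r
    exact h
end ok

/-- the rules -/
structure Rules (X : ℕ → Prop) : Prop where
  evar : ∀ e i, i < lenN e → X (aEv (tvar i) e (nthN e i))
  ezero : ∀ e, X (aEv tzero e zN)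
  esucc : ∀ e t a, X (aEv t e a) → X (aEv (tsucc t) e (sN a))
  eadd : ∀ e t a u b, X (aEv t e a) → X (aEv u e b) → X (aEv (tadd t u) e (aN a b))
  emul : ∀ e t a u b, X (aEv t e a) → X (aEv u e b) → X (aEv (tmul t u) e (mN a b))
  wfls : ∀ e, X (aWf (ffls (lenN e)) e)
  weq : ∀ e t a u b, X (aEv t e a) → X (aEv u e b) → X (aWf (feq (lenN e) t u) e)
  wle : ∀ e t a u b, X (aEv t e a) → X (aEv u e b) → X (aWf (fle (lenN e) t u) e)
  wimp : ∀ e g h, X (aWf g e) → X (aWf h e) → X (aWf (fimp g h) e)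
  wall : ∀ e g, X (aWf g (snocN e 0)) → X (aWf (fall g) e)
  tfls : ∀ e, ¬ X (aTr (ffls (lenN e)) e)
  teq : ∀ e t a u b, X (aEv t e a) → X (aEv u e b) → X (aTr (feq (lenN e) t u) e) → X (aEq a b)
  teq' : ∀ e t a u b, X (aEv t e a) → X (aEv u e b) → X (aEq a b) → X (aTr (feq (lenN e) t u) e)
  tle : ∀ e t a u b, X (aEv t e a) → X (aEv u e b) → X (aTr (fle (lenN e) t u) e) → X (aLe a b)
  tle' : ∀ e t a u b, X (aEv t e a) → X (aEv u e b) → X (aLe a b) → X (aTr (fle (lenN e) t u) e)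
  timp : ∀ e g h, X (aWf g e) → X (aWf h e) → X (aTr (fimp g h) e) → X (aTr g e) → X (aTr h e)
  timp1 : ∀ e g h, X (aWf g e) → X (aWf h e) → X (aTr (fimp g h) e) ∨ X (aTr g e)
  timp2 : ∀ e g h, X (aWf g e) → X (aTr h e) → X (aTr (fimp g h) e)
  tall : ∀ e g a, X (aWf g (snocN e a)) → X (aTr (fall g) e) → X (aTr g (snocN e a))
  tall' : ∀ e g, X (aWf g (snocN e (wN g e))) → X (aTr g (snocN e (wN g e))) → X (aTr (fall g) e)
  erefl : ∀ a, X (aEq a a)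
  etrans : ∀ a b d, X (aEq a b) → X (aEq a d) → X (aEq b d)
  ecs : ∀ a b, X (aEq a b) → X (aEq (sN a) (sN b))
  eca : ∀ a b a' b', X (aEq a a') → X (aEq b b') → X (aEq (aN a b) (aN a' b'))
  ecm : ∀ a b a' b', X (aEq a a') → X (aEq b b') → X (aEq (mN a b) (mN a' b'))
  ecl : ∀ a b a' b', X (aEq a a') → X (aEq b b') → X (aLe a b) → X (aLe a' b')
  nz : X (aEq (nN 0) zN)
  ns : ∀ n, X (aEq (nN (n + 1)) (sN (nN n)))

theorem sat_iff {Ax : ℕ → Prop} {t a b : ℕ} : Sat (CC Ax t a b) ↔ ∃ X : ℕ → Prop, X 0 ∧ ¬ X 1 ∧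
    Rules X ∧ (∀ m, Ax m → X (aTr m 0)) ∧ ¬ X (aTr t (snocN (snocN 0 (nN a)) (nN b))) := by
  refine exists_congr fun X => and_congr_right fun h0 => and_congr_right fun h1 => ?_
  show Ok X (CC Ax t a b) ↔ _
  unfold CC C1 C2 C3 C4 C5 C6
  simp only [Ok_or, Ok_ex, Ok_and, Ok_eq, h0, h1, or_false, imp_false, forall_const, not_true_eq_false]
  constructor
  · rintro ⟨⟨a1, a2, a3, a4, a5⟩, ⟨b1, b2, b3, b4, b5⟩, ⟨c1, c2, c3, c4, c5⟩, ⟨d1, d2, d3, d4, d5⟩,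
      ⟨e1, e2, e3, e4, e5, e6, e7, e8⟩, f1, f2⟩
    exact ⟨⟨a1, a2, a3, a4, a5, b1, b2, b3, b4, b5, c1, c2, c3, c4, c5, d1, d2, d3, d4, d5, e1, e2, e3, e4, e5,
      e6, e7, e8⟩, f1, f2⟩
  · rintro ⟨⟨a1, a2, a3, a4, a5, b1, b2, b3, b4, b5, c1, c2, c3, c4, c5, d1, d2, d3, d4, d5, e1, e2, e3, e4, e5,
      e6, e7, e8⟩, f1, f2⟩
    exact ⟨⟨a1, a2, a3, a4, a5⟩, ⟨b1, b2, b3, b4, b5⟩, ⟨c1, c2, c3, c4, c5⟩, ⟨d1, d2, d3, d4, d5⟩,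
      ⟨e1, e2, e3, e4, e5, e6, e7, e8⟩, f1, f2⟩

end Guaspari

open FirstOrder Language
open scoped FirstOrder

namespace Guaspari
open PAM

/-! ### From a satisfying assignment to a model -/
section completeness
variable {X : ℕ → Prop}

/-- the equality of names -/
def rS (R : Rules X) : Setoid ℕ where
  r a b := X (aEq a b)
  iseqv := ⟨R.erefl, fun {a b} h => R.etrans a b a h (R.erefl a),
    fun {a b c} h1 h2 => R.etrans b a c (R.etrans a b a h1 (R.erefl a)) h2⟩

/-- the term model -/
def QM (R : Rules X) : Type := Quotient (rS R)
/-- the class of a name -/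
def mkQ (R : Rules X) (a : ℕ) : QM R := Quotient.mk (rS R) a

theorem mkQ_eq (R : Rules X) {a b : ℕ} : mkQ R a = mkQ R b ↔ X (aEq a b) := by
  unfold mkQ
  exact Quotient.eq (r := rS R)
theorem mkQ_surj (R : Rules X) (q : QM R) : ∃ a, q = mkQ R a := by
  induction q using Quotient.inductionOn with
  | h a => exact ⟨a, rfl⟩
/-- a representative -/
noncomputable def rp (R : Rules X) (q : QM R) : ℕ := (mkQ_surj R q).choose
theorem rp_spec (R : Rules X) (q : QM R) : mkQ R (rp R q) = q := (mkQ_surj R q).choose_spec.symm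
theorem rp_mk (R : Rules X) (a : ℕ) : X (aEq (rp R (mkQ R a)) a) := (mkQ_eq R).1 (rp_spec R _)

/-- the structure -/
noncomputable instance qStr (R : Rules X) : LA.Structure (QM R) where
  funMap := fun {n} => match n with
    | 0 => fun _ _ => mkQ R zN
    | 1 => fun _ v => mkQ R (sN (rp R (v 0)))
    | 2 => fun (f : Bool) v => match f with
      | false => mkQ R (aN (rp R (v 0)) (rp R (v 1)))
      | true => mkQ R (mN (rp R (v 0)) (rp R (v 1)))
    | _ + 3 => fun f _ => f.elim
  RelMap := fun {n} => match n with
    | 0 => fun r _ => r.elim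
    | 1 => fun r _ => r.elim
    | 2 => fun _ v => X (aLe (rp R (v 0)) (rp R (v 1)))
    | _ + 3 => fun r _ => r.elim

variable (R : Rules X)
theorem q_z : z0 (QM R) = mkQ R zN := rfl
theorem q_s (a : ℕ) : sc (mkQ R a) = mkQ R (sN a) := (mkQ_eq R).2 (R.ecs _ _ (rp_mk R a))
theorem q_a (a b : ℕ) : pl (mkQ R a) (mkQ R b) = mkQ R (aN a b) :=
  (mkQ_eq R).2 (R.eca _ _ _ _ (rp_mk R a) (rp_mk R b))
theorem q_m (a b : ℕ) : ti (mkQ R a) (mkQ R b) = mkQ R (mN a b) :=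
  (mkQ_eq R).2 (R.ecm _ _ _ _ (rp_mk R a) (rp_mk R b))
theorem q_l (a b : ℕ) : lle (mkQ R a) (mkQ R b) ↔ X (aLe a b) := by
  have sy : ∀ {a b}, X (aEq a b) → X (aEq b a) := fun {a b} h => R.etrans a b a h (R.erefl a)
  exact ⟨fun h => R.ecl _ _ _ _ (rp_mk R a) (rp_mk R b) h, fun h => R.ecl _ _ _ _ (sy (rp_mk R a)) (sy (rp_mk R b)) h⟩

theorem q_term {n : ℕ} (v : Fin n → ℕ) (t : LA.Term (Empty ⊕ Fin n)) :
    ∃ a, X (aEv (eT t) (eN v) a) ∧ t.realize (Sum.elim default (mkQ R ∘ v)) = mkQ R a := by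
  induction t using term_cases with
  | h1 i =>
    refine ⟨v i, ?_, rfl⟩
    have := R.evar (eN v) i (by rw [lenN_eN]; exact i.2)
    rwa [nthN_eN] at this
  | h2 => exact ⟨zN, R.ezero _, by rw [realize_zeroT, q_z]⟩
  | h3 t ih =>
    obtain ⟨a, h1, h2⟩ := ih
    exact ⟨sN a, eT_succ t ▸ R.esucc _ _ _ h1, by rw [realize_succT, h2, q_s]⟩
  | h4 t u ih1 ih2 =>
    obtain ⟨a, h1, h2⟩ := ih1
    obtain ⟨b, h3, h4⟩ := ih2
    exact ⟨aN a b, eT_add t u ▸ R.eadd _ _ _ _ _ h1 h3, by rw [realize_addT, h2, h4, q_a]⟩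
  | h5 t u ih1 ih2 =>
    obtain ⟨a, h1, h2⟩ := ih1
    obtain ⟨b, h3, h4⟩ := ih2
    exact ⟨mN a b, eT_mul t u ▸ R.emul _ _ _ _ _ h1 h3, by rw [realize_mulT, h2, h4, q_m]⟩

theorem q_fml {n : ℕ} (φ : LA.BoundedFormula Empty n) : ∀ v : Fin n → ℕ, X (aWf (eF φ) (eN v)) ∧
    (X (aTr (eF φ) (eN v)) ↔ φ.Realize default (mkQ R ∘ v)) := by
  induction φ using fml_cases with
  | h1 n =>
    intro v
    have h1 := R.wfls (eN v)
    have h2 := R.tfls (eN v)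
    rw [lenN_eN] at h1 h2
    rw [eF_fls]
    exact ⟨h1, iff_of_false h2 (by simp)⟩
  | h2 n t u =>
    intro v
    obtain ⟨a, h1, h2⟩ := q_term R v t
    obtain ⟨b, h3, h4⟩ := q_term R v u
    have w := R.weq _ _ _ _ _ h1 h3
    have t1 := R.teq _ _ _ _ _ h1 h3
    have t2 := R.teq' _ _ _ _ _ h1 h3
    rw [lenN_eN] at w t1 t2
    rw [eF_eq]
    refine ⟨w, ?_⟩
    rw [BoundedFormula.Realize, h2, h4, mkQ_eq]
    exact ⟨t1, t2⟩
  | h3 n t u =>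
    intro v
    obtain ⟨a, h1, h2⟩ := q_term R v t
    obtain ⟨b, h3, h4⟩ := q_term R v u
    have w := R.wle _ _ _ _ _ h1 h3
    have t1 := R.tle _ _ _ _ _ h1 h3
    have t2 := R.tle' _ _ _ _ _ h1 h3
    rw [lenN_eN] at w t1 t2
    rw [eF_le]
    refine ⟨w, ?_⟩
    rw [realize_leF, h2, h4, q_l]
    exact ⟨t1, t2⟩
  | h4 n φ ψ ih1 ih2 =>
    intro v
    obtain ⟨a1, a2⟩ := ih1 v
    obtain ⟨b1, b2⟩ := ih2 v
    rw [eF_imp]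
    refine ⟨R.wimp _ _ _ a1 b1, ?_⟩
    rw [BoundedFormula.realize_imp, ← a2, ← b2]
    constructor
    · exact R.timp _ _ _ a1 b1
    · intro h
      rcases R.timp1 _ _ _ a1 b1 with h1 | h1
      · exact h1
      · exact R.timp2 _ _ _ a1 (h h1)
  | h5 n φ ih =>
    intro v
    have ih' : ∀ a, X (aWf (eF φ) (snocN (eN v) a)) ∧
        (X (aTr (eF φ) (snocN (eN v) a)) ↔ φ.Realize default (Fin.snoc (mkQ R ∘ v) (mkQ R a))) := by
      intro a
      have := ih (Fin.snoc v a)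
      rw [snocN_eN]
      have h2 : (mkQ R ∘ (Fin.snoc v a : Fin (n + 1) → ℕ)) = Fin.snoc (mkQ R ∘ v) (mkQ R a) := Fin.comp_snoc _ _ _
      rw [h2] at this
      exact this
    rw [eF_all]
    refine ⟨R.wall _ _ (ih' 0).1, ?_⟩
    rw [BoundedFormula.realize_all]
    constructor
    · intro h q
      obtain ⟨a, rfl⟩ := mkQ_surj R q
      exact (ih' a).2.1 (R.tall _ _ _ (ih' a).1 h)
    · intro h
      exact R.tall' _ _ (ih' _).1 ((ih' _).2.2 (h _))

/-- the term model as a model of PA -/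
noncomputable def qPAM (R : Rules X) (hp : QM R ⊨ PAAx) : PAM := ⟨QM R, hp⟩

theorem cst_q (hp : QM R ⊨ PAAx) (n : ℕ) : cst (qPAM R hp) n = mkQ R (nN n) := by
  induction n with
  | zero =>
    have h : cst (qPAM R hp) 0 = z0 (qPAM R hp) := by rw [z0_eq]; exact Nat.cast_zero
    exact h.trans ((mkQ_eq R).2 (R.etrans _ _ _ R.nz (R.erefl _)))
  | succ n ih =>
    rw [cst_succ, ← sc_eq, ih]
    exact (q_s R _).trans ((mkQ_eq R).2 (R.etrans _ _ _ (R.ns n) (R.erefl _)))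

theorem model_of_rules (_ : R = R) {T : Thy} (hE : ExtPA T) (θ : LA.BoundedFormula Empty 2) (a b : ℕ)
    (hA : ∀ m, (∃ φ ∈ T, gnum φ = m) → X (aTr m 0))
    (hg : ¬ X (aTr (eF θ) (snocN (snocN 0 (nN a)) (nN b)))) :
    ∃ M : PAM, M.carrier ⊨ T ∧ ¬ θ.Realize default (tv (k := 2) (((), cst M a), cst M b)) := by
  have h0 : (0 : ℕ) = eN (default : Fin 0 → ℕ) := (eN_nil _).symm
  have hm : QM R ⊨ T := by
    refine ⟨fun φ hφ => ?_⟩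
    have h1 := hA _ ⟨φ, hφ, rfl⟩
    rw [gnum_eF] at h1
    have h3 : X (aTr (eF φ) (eN (default : Fin 0 → ℕ))) := by rw [eN_nil]; exact h1
    have h2 := (q_fml R φ default).2.1 h3
    unfold Sentence.Realize Formula.Realize
    have e : (mkQ R ∘ (default : Fin 0 → ℕ)) = default := Subsingleton.elim _ _
    rw [e] at h2
    exact h2
  have : Nonempty (QM R) := ⟨mkQ R 0⟩
  have hp : QM R ⊨ PAAx := ⟨fun φ hφ => Theory.models_sentence_iff.1 (hE φ hφ) (Theory.ModelType.of T (QM R))⟩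
  refine ⟨qPAM R hp, hm, ?_⟩
  rw [h0, snocN_eN, snocN_eN, (q_fml R θ _).2] at hg
  intro h
  apply hg
  rw [cst_q, cst_q] at h
  have e : (mkQ R ∘ (Fin.snoc (Fin.snoc (default : Fin 0 → ℕ) (nN a) : Fin 1 → ℕ) (nN b) : Fin 2 → ℕ)) =
      tv (k := 2) (M := QM R) (((), mkQ R (nN a)), mkQ R (nN b)) := by
    refine (Fin.comp_snoc _ _ _).trans ?_
    show _ = Fin.snoc (α := fun _ => QM R) (Fin.snoc (α := fun _ => QM R) (tv (k := 0) (M := QM R) ()) (mkQ R (nN a))) (mkQ R (nN b))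
    congr 1
  rw [e]
  exact h
end completeness
end Guaspari

open FirstOrder Language
open scoped FirstOrder

namespace Guaspari
open PAM

/-! ### From a model to a satisfying assignment -/
section soundness

theorem wf_rec {α : Type} [Inhabited α] (F : ℕ → (ℕ → α) → α) :
    ∃ d : ℕ → α, ∀ x, ∃ r : ℕ → α, (∀ y < x, r y = d y) ∧ d x = F x r := by
  classical
  refine ⟨WellFounded.fix (C := fun _ => α) (Nat.lt_wfRel.wf) (fun x r => F x (fun y => if h : y < x then r y h else default)), fun x => ?_⟩
  refine ⟨_, ?_, WellFounded.fix_eq _ _ _⟩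
  intro y hy
  exact dif_pos hy

variable (M : PAM)
/-- the properties of the value of a name -/
def DS (x : ℕ) (r : ℕ → M) (y : M) : Prop :=
  (x = zN → y = z0 M) ∧ (∀ a, x = sN a → y = sc (r a)) ∧ (∀ a b, x = aN a b → y = pl (r a) (r b)) ∧
  (∀ a b, x = mN a b → y = ti (r a) (r b)) ∧ (∀ n, x = nN n → y = cst M n) ∧
  (∀ (m : ℕ) (v : Fin m → ℕ) (φ : LA.BoundedFormula Empty (m + 1)), x = wN (eF φ) (eN v) →
    φ.Realize default (Fin.snoc (r ∘ v) y : Fin (m + 1) → M) → (∀' φ).Realize default (r ∘ v))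

theorem DS.ex (x : ℕ) (r : ℕ → M) : ∃ y, DS M x r y := by
  unfold DS
  by_cases h0 : x = zN
  · subst h0; exact ⟨z0 M, by simp [prN_inj]⟩
  by_cases h1 : ∃ a, x = sN a
  · obtain ⟨a, rfl⟩ := h1; exact ⟨sc (r a), by simp [prN_inj]⟩
  by_cases h2 : ∃ a b, x = aN a b
  · obtain ⟨a, b, rfl⟩ := h2; exact ⟨pl (r a) (r b), by simp [prN_inj]⟩
  by_cases h3 : ∃ a b, x = mN a b
  · obtain ⟨a, b, rfl⟩ := h3; exact ⟨ti (r a) (r b), by simp [prN_inj]⟩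
  by_cases h4 : ∃ n, x = nN n
  · obtain ⟨a, rfl⟩ := h4; exact ⟨cst M a, by simp [prN_inj]⟩
  by_cases h5 : ∃ (m : ℕ) (v : Fin m → ℕ) (φ : LA.BoundedFormula Empty (m + 1)), x = wN (eF φ) (eN v)
  · obtain ⟨m, v, φ, rfl⟩ := h5
    have : ∃ y, φ.Realize default (Fin.snoc (r ∘ v) y : Fin (m + 1) → M) → (∀' φ).Realize default (r ∘ v) := by
      by_cases h : (∀' φ).Realize default (r ∘ v)
      · exact ⟨z0 M, fun _ => h⟩
      · rw [BoundedFormula.realize_all] at h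
        push Not at h
        obtain ⟨y, hy⟩ := h
        exact ⟨y, fun h => absurd h hy⟩
    obtain ⟨y, hy⟩ := this
    refine ⟨y, by simp [prN_inj], by simp [prN_inj], by simp [prN_inj], by simp [prN_inj], by simp [prN_inj], ?_⟩
    intro m' v' φ' h
    simp only [prN_inj, true_and] at h
    obtain ⟨hh1, h2⟩ := h
    cases eN_inj h2
    cases eF_inj hh1
    exact hy
  · refine ⟨z0 M, fun h => absurd h h0, fun a h => absurd ⟨a, h⟩ h1, fun a b h => absurd ⟨a, b, h⟩ h2,
      fun a b h => absurd ⟨a, b, h⟩ h3, fun a h => absurd ⟨a, h⟩ h4, fun m v φ h => absurd ⟨m, v, φ, h⟩ h5⟩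

theorem prN_lt1 (t a : ℕ) : a < prN (t + 1) a := by unfold prN; nlinarith
theorem prN_lt2 (t a b : ℕ) : a < prN (t + 1) (prN a b) := (le_prN_left a b).trans_lt (prN_lt1 _ _)
theorem prN_lt3 (t a b : ℕ) : b < prN (t + 1) (prN a b) := (le_prN_right a b).trans_lt (prN_lt1 _ _)

theorem DS.all : ∃ d : ℕ → M, ∀ x, DS M x d (d x) := by
  choose F hF using DS.ex M
  have : Inhabited M := ⟨z0 M⟩
  obtain ⟨d, hd⟩ := wf_rec F
  refine ⟨d, fun x => ?_⟩
  obtain ⟨r, h1, h2⟩ := hd x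
  have h3 := hF x r
  rw [← h2] at h3
  obtain ⟨a1, a2, a3, a4, a5, a6⟩ := h3
  refine ⟨a1, fun a h => ?_, fun a b h => ?_, fun a b h => ?_, a5, fun m v φ h hh => ?_⟩
  · rw [a2 a h, h1 _ (h ▸ prN_lt1 _ _)]
  · rw [a3 a b h, h1 _ (h ▸ prN_lt2 _ _ _), h1 _ (h ▸ prN_lt3 _ _ _)]
  · rw [a4 a b h, h1 _ (h ▸ prN_lt2 _ _ _), h1 _ (h ▸ prN_lt3 _ _ _)]
  · have e : r ∘ v = d ∘ v := by
      funext i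
      exact h1 _ ((lt_eN v i).trans (h ▸ prN_lt3 _ _ _))
    rw [← e]
    exact a6 m v φ h (e ▸ hh)

variable {M}
/-- the true atoms -/
def XX (d : ℕ → M) (c : ℕ) : Prop :=
  c = 0 ∨
  (∃ (n : ℕ) (v : Fin n → ℕ) (t : LA.Term (Empty ⊕ Fin n)) (a : ℕ), c = aEv (eT t) (eN v) a ∧
    t.realize (Sum.elim default (d ∘ v)) = d a) ∨
  (∃ (n : ℕ) (v : Fin n → ℕ) (φ : LA.BoundedFormula Empty n), c = aWf (eF φ) (eN v)) ∨
  (∃ (n : ℕ) (v : Fin n → ℕ) (φ : LA.BoundedFormula Empty n), c = aTr (eF φ) (eN v) ∧ φ.Realize default (d ∘ v)) ∨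
  (∃ a b, c = aEq a b ∧ d a = d b) ∨
  (∃ a b, c = aLe a b ∧ lle (d a) (d b))

section
variable (d : ℕ → M)
theorem XX.zero : XX d 0 := Or.inl rfl
theorem XX.one : ¬ XX d 1 := by
  unfold XX
  simp [atom_ne1.symm]
theorem XX.ev {n : ℕ} (v : Fin n → ℕ) (c a : ℕ) : XX d (aEv c (eN v) a) ↔
    ∃ t : LA.Term (Empty ⊕ Fin n), c = eT t ∧ t.realize (Sum.elim default (d ∘ v)) = d a := by
  unfold XX
  simp only [atom_ne0, atom_inj, false_or, true_and, and_true]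
  constructor
  · rintro (⟨m, w, t, b, ⟨h1, h2, h3⟩, h4⟩ | h | h | h | h)
    · cases eN_inj h2
      subst h3
      exact ⟨t, h1, h4⟩
    all_goals simp at h
  · rintro ⟨t, h1, h2⟩
    exact Or.inl ⟨n, v, t, a, ⟨h1, rfl, rfl⟩, h2⟩
theorem XX.wf {n : ℕ} (v : Fin n → ℕ) (c : ℕ) : XX d (aWf c (eN v)) ↔
    ∃ φ : LA.BoundedFormula Empty n, c = eF φ := by
  unfold XX
  simp only [atom_ne0, atom_inj, false_or, true_and, and_true]
  constructor
  · rintro (h | ⟨m, w, t, h1, h2⟩ | h | h | h)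
    · simp at h
    · cases eN_inj h2
      exact ⟨t, h1⟩
    all_goals simp at h
  · rintro ⟨t, h1⟩
    exact Or.inr (Or.inl ⟨n, v, t, h1, rfl⟩)
theorem XX.tr {n : ℕ} (v : Fin n → ℕ) (c : ℕ) : XX d (aTr c (eN v)) ↔
    ∃ φ : LA.BoundedFormula Empty n, c = eF φ ∧ φ.Realize default (d ∘ v) := by
  unfold XX
  simp only [atom_ne0, atom_inj, false_or, true_and, and_true]
  constructor
  · rintro (h | h | ⟨m, w, t, ⟨h1, h2⟩, h3⟩ | h | h)
    · simp at h
    · simp at h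
    · cases eN_inj h2
      exact ⟨t, h1, h3⟩
    all_goals simp at h
  · rintro ⟨t, h1, h2⟩
    exact Or.inr (Or.inr (Or.inl ⟨n, v, t, ⟨h1, rfl⟩, h2⟩))
theorem XX.eq (a b : ℕ) : XX d (aEq a b) ↔ d a = d b := by
  unfold XX
  simp only [atom_ne0, atom_inj, false_or, true_and, and_true]
  simp
theorem XX.le (a b : ℕ) : XX d (aLe a b) ↔ lle (d a) (d b) := by
  unfold XX
  simp only [atom_ne0, atom_inj, false_or, true_and, and_true]
  simp
end

theorem XX.trF (d : ℕ → M) {n : ℕ} (v : Fin n → ℕ) (φ : LA.BoundedFormula Empty n) :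
    XX d (aTr (eF φ) (eN v)) ↔ φ.Realize default (d ∘ v) := by
  rw [XX.tr]
  constructor
  · rintro ⟨ψ, h, h'⟩; rwa [eF_inj h]
  · exact fun h => ⟨φ, rfl, h⟩

theorem rules_XX (d : ℕ → M) (hd : ∀ x, DS M x d (d x)) : Rules (XX d) := by
  have hz : d zN = z0 M := (hd _).1 rfl
  have hs : ∀ a, d (sN a) = sc (d a) := fun a => (hd _).2.1 a rfl
  have ha : ∀ a b, d (aN a b) = pl (d a) (d b) := fun a b => (hd _).2.2.1 a b rfl
  have hm : ∀ a b, d (mN a b) = ti (d a) (d b) := fun a b => (hd _).2.2.2.1 a b rfl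
  have hn : ∀ n, d (nN n) = cst M n := fun n => (hd _).2.2.2.2.1 n rfl
  have hw := fun x => (hd x).2.2.2.2.2
  clear hd
  constructor
  case evar =>
    intro e i hi
    obtain ⟨n, v, rfl⟩ := eN_surj e
    rw [lenN_eN] at hi
    rw [XX.ev]
    have := nthN_eN v ⟨i, hi⟩
    simp only at this
    exact ⟨vT ⟨i, hi⟩, rfl, by rw [this]; rfl⟩
  case ezero =>
    intro e
    obtain ⟨n, v, rfl⟩ := eN_surj e
    rw [XX.ev]
    exact ⟨zeroT, rfl, by rw [realize_zeroT, hz]⟩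
  case esucc =>
    intro e t a
    obtain ⟨n, v, rfl⟩ := eN_surj e
    rw [XX.ev, XX.ev]
    rintro ⟨t, rfl, h⟩
    exact ⟨succT t, (eT_succ _).symm, by rw [realize_succT, hs, h]⟩
  case eadd =>
    intro e t a u b
    obtain ⟨n, v, rfl⟩ := eN_surj e
    rw [XX.ev, XX.ev, XX.ev]
    rintro ⟨t, rfl, h⟩ ⟨u, rfl, h'⟩
    exact ⟨addT t u, (eT_add _ _).symm, by rw [realize_addT, ha, h, h']⟩
  case emul =>
    intro e t a u b
    obtain ⟨n, v, rfl⟩ := eN_surj e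
    rw [XX.ev, XX.ev, XX.ev]
    rintro ⟨t, rfl, h⟩ ⟨u, rfl, h'⟩
    exact ⟨mulT t u, (eT_mul _ _).symm, by rw [realize_mulT, hm, h, h']⟩
  case wfls =>
    intro e
    obtain ⟨n, v, rfl⟩ := eN_surj e
    rw [XX.wf, lenN_eN]
    exact ⟨⊥, eF_fls.symm⟩
  case weq =>
    intro e t a u b
    obtain ⟨n, v, rfl⟩ := eN_surj e
    rw [XX.ev, XX.ev, XX.wf, lenN_eN]
    rintro ⟨t, rfl, h⟩ ⟨u, rfl, h'⟩
    exact ⟨_, (eF_eq t u).symm⟩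
  case wle =>
    intro e t a u b
    obtain ⟨n, v, rfl⟩ := eN_surj e
    rw [XX.ev, XX.ev, XX.wf, lenN_eN]
    rintro ⟨t, rfl, h⟩ ⟨u, rfl, h'⟩
    exact ⟨_, (eF_le t u).symm⟩
  case wimp =>
    intro e g h
    obtain ⟨n, v, rfl⟩ := eN_surj e
    rw [XX.wf, XX.wf, XX.wf]
    rintro ⟨t, rfl⟩ ⟨u, rfl⟩
    exact ⟨_, (eF_imp t u).symm⟩
  case wall =>
    intro e g
    obtain ⟨n, v, rfl⟩ := eN_surj e
    rw [snocN_eN, XX.wf, XX.wf]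
    rintro ⟨t, rfl⟩
    exact ⟨_, (eF_all t).symm⟩
  case tfls =>
    intro e
    obtain ⟨n, v, rfl⟩ := eN_surj e
    rw [lenN_eN, ← eF_fls, XX.trF]
    simp
  case teq =>
    intro e t a u b
    obtain ⟨n, v, rfl⟩ := eN_surj e
    rw [XX.ev, XX.ev, lenN_eN]
    rintro ⟨t, rfl, h⟩ ⟨u, rfl, h'⟩
    rw [← eF_eq, XX.trF, BoundedFormula.Realize, h, h', XX.eq]
    exact id
  case teq' =>
    intro e t a u b
    obtain ⟨n, v, rfl⟩ := eN_surj e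
    rw [XX.ev, XX.ev, lenN_eN]
    rintro ⟨t, rfl, h⟩ ⟨u, rfl, h'⟩
    rw [← eF_eq, XX.trF, BoundedFormula.Realize, h, h', XX.eq]
    exact id
  case tle =>
    intro e t a u b
    obtain ⟨n, v, rfl⟩ := eN_surj e
    rw [XX.ev, XX.ev, lenN_eN]
    rintro ⟨t, rfl, h⟩ ⟨u, rfl, h'⟩
    rw [← eF_le, XX.trF, realize_leF, h, h', XX.le]
    exact id
  case tle' =>
    intro e t a u b
    obtain ⟨n, v, rfl⟩ := eN_surj e
    rw [XX.ev, XX.ev, lenN_eN]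
    rintro ⟨t, rfl, h⟩ ⟨u, rfl, h'⟩
    rw [← eF_le, XX.trF, realize_leF, h, h', XX.le]
    exact id
  case timp =>
    intro e g h
    obtain ⟨n, v, rfl⟩ := eN_surj e
    rw [XX.wf, XX.wf]
    rintro ⟨t, rfl⟩ ⟨u, rfl⟩
    rw [← eF_imp, XX.trF, XX.trF, XX.trF]
    exact id
  case timp1 =>
    intro e g h
    obtain ⟨n, v, rfl⟩ := eN_surj e
    rw [XX.wf, XX.wf]
    rintro ⟨t, rfl⟩ ⟨u, rfl⟩
    rw [← eF_imp, XX.trF, XX.trF, BoundedFormula.realize_imp]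
    tauto
  case timp2 =>
    intro e g h
    obtain ⟨n, v, rfl⟩ := eN_surj e
    rw [XX.wf, XX.tr]
    rintro ⟨t, rfl⟩ ⟨u, rfl, hu⟩
    rw [← eF_imp, XX.trF, BoundedFormula.realize_imp]
    exact fun _ => hu
  case tall =>
    intro e g a
    obtain ⟨n, v, rfl⟩ := eN_surj e
    rw [snocN_eN, XX.wf]
    rintro ⟨t, rfl⟩
    rw [← eF_all, XX.trF, XX.trF, BoundedFormula.realize_all]
    intro h
    have e : (d ∘ (Fin.snoc v a : Fin (n + 1) → ℕ)) = Fin.snoc (d ∘ v) (d a) := Fin.comp_snoc _ _ _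
    rw [e]
    exact h _
  case tall' =>
    intro e g
    obtain ⟨n, v, rfl⟩ := eN_surj e
    rw [snocN_eN, XX.wf]
    rintro ⟨t, rfl⟩
    rw [← eF_all, XX.trF, XX.trF]
    have e : (d ∘ (Fin.snoc v (wN (eF t) (eN v)) : Fin (n + 1) → ℕ)) = Fin.snoc (d ∘ v) (d (wN (eF t) (eN v))) := Fin.comp_snoc _ _ _
    rw [e]
    exact hw _ n v t rfl
  case erefl => intro a; rw [XX.eq]
  case etrans =>
    intro a b c
    simp only [XX.eq]
    exact fun h1 h2 => h1.symm.trans h2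
  case ecs =>
    intro a b
    simp only [XX.eq, hs]
    exact fun h => congrArg sc h
  case eca =>
    intro a b a' b'
    simp only [XX.eq, ha]
    exact fun h h' => congrArg₂ pl h h'
  case ecm =>
    intro a b a' b'
    simp only [XX.eq, hm]
    exact fun h h' => congrArg₂ ti h h'
  case ecl =>
    intro a b a' b'
    simp only [XX.eq, XX.le]
    intro h h'
    rw [h, h']
    exact id
  case nz =>
    rw [XX.eq, hz, hn, z0_eq]; exact Nat.cast_zero
  case ns =>
    intro n
    rw [XX.eq, hs, hn, hn, sc_eq, cst_succ]

theorem ret_iff {T : Thy} (hE : ExtPA T) (θ : LA.BoundedFormula Empty 2) (a b : ℕ) :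
    (∀ M : PAM, M.carrier ⊨ T → θ.Realize default (tv (k := 2) (((), cst M a), cst M b))) ↔
      ¬ Sat (CC (fun m => ∃ φ ∈ T, gnum φ = m) (eF θ) a b) := by
  rw [sat_iff]
  have h0 : (0 : ℕ) = eN (default : Fin 0 → ℕ) := (eN_nil _).symm
  constructor
  · rintro h ⟨X, -, -, R, hA, hg⟩
    obtain ⟨M, h1, h2⟩ := model_of_rules R rfl hE θ a b hA hg
    exact h2 (h M h1)
  · intro h M hM
    by_contra hc
    obtain ⟨d, hd⟩ := DS.all M
    have hn : ∀ n, d (nN n) = cst M n := fun n => (hd _).2.2.2.2.1 n rfl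
    refine h ⟨XX d, XX.zero d, XX.one d, rules_XX d hd, ?_, ?_⟩
    · rintro m ⟨φ, hφ, rfl⟩
      rw [gnum_eF]
      have h3 : XX d (aTr (eF φ) (eN (default : Fin 0 → ℕ))) := by
        rw [XX.trF]
        have := hM.realize_of_mem φ hφ
        unfold Sentence.Realize Formula.Realize at this
        have e : (d ∘ (default : Fin 0 → ℕ)) = default := Subsingleton.elim _ _
        rw [e]
        exact this
      rw [eN_nil] at h3
      exact h3
    · rw [h0, snocN_eN, snocN_eN, XX.trF]
      have e : (d ∘ (Fin.snoc (Fin.snoc (default : Fin 0 → ℕ) (nN a) : Fin 1 → ℕ) (nN b) : Fin 2 → ℕ)) =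
          tv (k := 2) (M := M) (((), d (nN a)), d (nN b)) := by
        refine (Fin.comp_snoc _ _ _).trans ?_
        show _ = Fin.snoc (α := fun _ => M) (Fin.snoc (α := fun _ => M) (tv (k := 0) (M := M) ()) (d (nN a))) (d (nN b))
        congr 1
      rw [e, hn, hn]
      exact hc
end soundness

/-- provability of instances of a formula is recursively enumerable -/
def RET (T : Thy) : Prop := ∀ θ : LA.BoundedFormula Empty 2, S1 (k := 2) (fun p =>
  ∀ M : PAM, M.carrier ⊨ T → θ.Realize default (tv (k := 2) (((), cst M p.1.2), cst M p.2)))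

theorem CompThy.ret {T : Thy} (hC : CompThy T) (hE : ExtPA T) : RET T := by
  intro θ
  refine S1.congr (S1.CC (Ax := fun m => ∃ φ ∈ T, gnum φ = m) hC.S1 (eF θ)) ?_
  intro p
  exact ret_iff hE θ _ _

end Guaspari

open FirstOrder Language
open scoped FirstOrder

namespace Guaspari
open PAM

/-! ### Semantic reformulations -/

theorem pam_nonempty (M : PAM) : Nonempty M.carrier := ⟨z0 M⟩

theorem prv_iff {T : Thy} (hE : ExtPA T) {φ : Snt} :
    Prv T φ ↔ ∀ M : PAM, M.carrier ⊨ T → M.carrier ⊨ φ := by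
  unfold Prv
  rw [Theory.models_sentence_iff]
  constructor
  · intro h M hM
    have := pam_nonempty M
    exact h (Theory.ModelType.of T M)
  · intro h M
    have hp : M ⊨ PAAx := ⟨fun φ hφ => Theory.models_sentence_iff.1 (hE φ hφ) M⟩
    exact h (@PAM.mk M _ hp) M.is_model

theorem extPA_mono {T T' : Thy} (hE : ExtPA T) (h : T ⊆ T') : ExtPA T' := by
  intro φ hφ
  have := hE φ hφ
  unfold Prv at *
  rw [Theory.models_sentence_iff] at *
  intro M
  have hM : M ⊨ T := Theory.Model.mono M.is_model h
  exact this (Theory.ModelType.of T M)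

theorem con_iff {T : Thy} (hE : ExtPA T) : Con T ↔ ∃ M : PAM, M.carrier ⊨ T := by
  unfold Con
  rw [prv_iff hE]
  push Not
  refine exists_congr fun M => and_iff_left ?_
  simp [Sentence.Realize, Formula.Realize]

theorem model_add {M : PAM} {T : Thy} {φ : Snt} : M.carrier ⊨ add T φ ↔ M.carrier ⊨ T ∧ M.carrier ⊨ φ := by
  unfold add
  rw [Theory.model_insert_iff]
  exact and_comm

theorem extPA_add {T : Thy} (hE : ExtPA T) (φ : Snt) : ExtPA (add T φ) := extPA_mono hE (Set.subset_insert _ _)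

theorem prv_add_iff {T : Thy} (hE : ExtPA T) {φ ψ : Snt} :
    Prv (add T φ) ψ ↔ ∀ M : PAM, M.carrier ⊨ T → M.carrier ⊨ φ → M.carrier ⊨ ψ := by
  rw [prv_iff (extPA_add hE φ)]
  simp only [model_add, and_imp]

theorem con_union_iff {T S : Thy} (hE : ExtPA T) :
    Con (T ∪ S) ↔ ∃ M : PAM, M.carrier ⊨ T ∧ ∀ φ ∈ S, M.carrier ⊨ φ := by
  rw [con_iff (extPA_mono hE Set.subset_union_left)]
  refine exists_congr fun M => ?_
  rw [Theory.model_union_iff]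
  exact and_congr_right fun _ => Theory.model_iff _

theorem realize0 {M : PAM} {φ : Snt} : M.carrier ⊨ φ ↔ BoundedFormula.Realize φ default (tv (k := 0) (M := M) ()) := by
  unfold Sentence.Realize Formula.Realize
  rw [show (tv (k := 0) (M := M.carrier) ()) = default from Subsingleton.elim _ _]

/-- semantically Σ_n -/
def Sg (n : ℕ) (P : PAM → Prop) : Prop := NS (k := 0) n (fun M _ => P M)

theorem Sg.ofSigma {n : ℕ} {φ : Snt} (h : φ ∈ SigmaS n) : Sg n (fun M => M.carrier ⊨ φ) := by
  refine NS.congr (NS.ofFml.1 h) ?_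
  intro M p
  exact realize0
theorem Sg.ofPi {n : ℕ} {φ : Snt} (h : φ ∈ PiS n) : Sg n (fun M => ¬ M.carrier ⊨ φ) := by
  refine NS.congr (NS.ofFml.2 h) ?_
  intro M p
  exact not_congr realize0
theorem Sg.toSigma {n : ℕ} {P : PAM → Prop} (h : Sg n P) : ∃ φ ∈ SigmaS n, ∀ M : PAM, M.carrier ⊨ φ ↔ P M := by
  obtain ⟨φ, h1, h2⟩ := (NS.toFml h).1
  exact ⟨φ, h1, fun M => realize0.trans (h2 M ())⟩
theorem Sg.toPi {n : ℕ} {P : PAM → Prop} (h : Sg n P) : ∃ φ ∈ PiS n, ∀ M : PAM, M.carrier ⊨ φ ↔ ¬ P M := by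
  obtain ⟨φ, h1, h2⟩ := (NS.toFml h).2
  exact ⟨φ, h1, fun M => realize0.trans (h2 M ())⟩
theorem Sg.and {n : ℕ} {P Q : PAM → Prop} (h : Sg n P) (h' : Sg n Q) : Sg n (fun M => P M ∧ Q M) := (clos n).and h h'
theorem Sg.or {n : ℕ} {P Q : PAM → Prop} (h : Sg n P) (h' : Sg n Q) : Sg n (fun M => P M ∨ Q M) := (clos n).or h h'
theorem Sg.const (n : ℕ) (p : Prop) : Sg n (fun _ => p) := by
  by_cases h : p
  · simp only [h]
    exact NS.ofDl (k := 0) (P := fun M _ => True) (by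
      have : Dl (k := 0) (fun M _ => ¬ False) := inferInstance
      simpa using this) n
  · simp only [h]
    exact NS.ofDl (k := 0) (P := fun M _ => False) inferInstance n

theorem prv_dec {T : Thy} (hE : ExtPA T) {φ : Snt} {P : PAM → Prop} (h : ∀ M : PAM, M.carrier ⊨ φ ↔ P M) :
    Prv T φ ↔ ∀ M : PAM, M.carrier ⊨ T → P M := by
  rw [prv_iff hE]
  simp only [h]

/-- finite conjunctions -/
theorem Sg.ball {n : ℕ} {P : ℕ → PAM → Prop} (h : ∀ i, Sg n (P i)) (N : ℕ) : Sg n (fun M => ∀ i < N, P i M) := by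
  induction N with
  | zero => simpa using Sg.const n True
  | succ N ih =>
    have := ih.and (h N)
    refine NS.congr this ?_
    intro M _
    simp only [Nat.lt_succ_iff_lt_or_eq]
    constructor
    · intro h; exact ⟨fun i hi => h i (Or.inl hi), h N (Or.inr rfl)⟩
    · rintro ⟨h1, h2⟩ i (hi | rfl)
      · exact h1 i hi
      · exact h2

theorem inc_pi {T U : Thy} (hT : ExtPA T) (hU : ExtPA U) (n : ℕ) (h : ¬ Con (T ∪ ThIn (PiS n) U)) :
    ∃ P : PAM → Prop, Sg n (fun M => ¬ P M) ∧ (∀ M : PAM, M.carrier ⊨ U → P M) ∧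
      ∀ M : PAM, M.carrier ⊨ T → ¬ P M := by
  classical
  unfold Con Prv at h
  rw [not_not, Theory.models_iff_finset_models] at h
  obtain ⟨F, h1, h2⟩ := h
  have key : ∀ G : Finset Snt, (∀ φ ∈ G, φ ∈ ThIn (PiS n) U) → Sg n (fun M => ¬ ∀ φ ∈ G, M.carrier ⊨ φ) := by
    intro G
    induction G using Finset.induction_on with
    | empty => intro _; simpa using Sg.const n False
    | insert a s _ ih =>
      intro h
      have := (ih fun φ hφ => h φ (Finset.mem_insert_of_mem hφ)).or (Sg.ofPi (h a (Finset.mem_insert_self _ _)).1)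
      refine NS.congr this ?_
      intro M _
      show (¬ ∀ φ ∈ insert a s, M.carrier ⊨ φ) ↔ ((¬∀ φ ∈ s, M.carrier ⊨ φ) ∨ ¬M.carrier ⊨ a)
      rw [Finset.forall_mem_insert]
      tauto
  have hG : ∀ φ ∈ F.filter (· ∈ ThIn (PiS n) U), φ ∈ ThIn (PiS n) U := fun φ hφ => (Finset.mem_filter.1 hφ).2
  refine ⟨_, key _ hG, ?_, ?_⟩
  · intro M hM φ hφ
    exact (prv_iff hU).1 (hG φ hφ).2 M hM
  · intro M hM h
    have hF : M.carrier ⊨ (F : Thy) := by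
      refine ⟨fun φ hφ => ?_⟩
      rcases h1 hφ with h3 | h3
      · exact hM.realize_of_mem φ h3
      · exact h φ (Finset.mem_filter.2 ⟨hφ, h3⟩)
    have := pam_nonempty M
    have := Theory.models_sentence_iff.1 h2 (Theory.ModelType.of (F : Thy) M)
    exact this

theorem RET.add {T : Thy} (h : RET T) {χ : Snt} {n : ℕ} (hχ : Sg n (fun M => M.carrier ⊨ χ)) : RET (add T χ) := by
  intro θ
  obtain ⟨χ', -, h2⟩ := (NS.toFml ((clos n).sub hχ (fun M (_ : Tup 2 M) => ()))).1
  refine S1.congr (h (χ' ⟹ θ)) ?_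
  intro p
  refine forall_congr' fun M => ?_
  rw [model_add, BoundedFormula.realize_imp, h2, and_imp]
end Guaspari

open FirstOrder Language
open scoped FirstOrder

namespace Guaspari
open PAM

/-! ### The main construction -/

/-- the self-referential sentence -/
def Psi (n : ℕ) {M : PAM} (e : M) : Prop :=
  ∀ y : M, (∃ z, z ≤ y ∧ DD e (pr e 0) z) →
    ∃ k, k ≤ y ∧ ((∃ z, z ≤ y ∧ DD e (pr e (k + 1)) z) ∧ ¬ UU n k 0)

theorem NS.notPsi (n : ℕ) : NS (n + 1) (fun M (p : Tup 1 M) => ¬ Psi n p.2) := by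
  have h1 : Dl (fun M (p : Tup 2 M) => ∃ z, z ≤ p.2 ∧ DD p.1.2 (pr p.1.2 0) z) := inferInstance
  have h2 : Dl (fun M (p : Tup 3 M) => ¬ ∃ z, z ≤ p.1.2 ∧ DD p.1.1.2 (pr p.1.1.2 (p.2 + 1)) z) := inferInstance
  have h3 : NS (n + 1) (fun M (p : Tup 3 M) => Guaspari.UU n p.2 0) :=
    (clos (n + 1)).sub (NS.UU n) (fun M (p : Tup 3 M) => tc (tc (k := 0) () p.2) 0)
  have h4 := NS.ex ((clos (n + 1)).and (NS.ofDl h1 (n + 1))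
    ((clos (n + 1)).ball (f := fun M (p : Tup 2 M) => p.2) ((clos (n + 1)).or (NS.ofDl h2 (n + 1)) h3)))
  refine NS.congr h4 ?_
  intro M p
  unfold Psi
  push Not
  refine exists_congr fun y => and_congr_right fun _ => forall_congr' fun k => imp_congr_right fun _ => ?_
  dsimp only
  constructor
  · intro h
    by_cases hc : ∃ z, z ≤ y ∧ DD p.2 (pr p.2 (k + 1)) z
    · exact Or.inr (h hc)
    · push Not at hc; exact Or.inl hc
  · rintro (h | h) h'
    · obtain ⟨z, a, b⟩ := h'
      exact absurd b (h z a)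
    · exact h

/-- provability of the sentence -/
def PvA (n : ℕ) (T : Thy) (e : ℕ) : Prop := ∀ M : PAM, M.carrier ⊨ T → Psi n (cst M e)
/-- provability of an implication -/
def PvB (n : ℕ) (T : Thy) (e k : ℕ) : Prop := ∀ M : PAM, M.carrier ⊨ T → Psi n (cst M e) → UU n (cst M k) 0

theorem S1.PvA {n : ℕ} {T : Thy} (h : RET T) : S1 (k := 1) (fun p => PvA n T p.2) := by
  obtain ⟨θ, -, h2⟩ := (NS.toFml ((clos (n + 1)).sub (NS.notPsi n) (fun M (p : Tup 2 M) => tc (k := 0) () p.2))).2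
  have h3 : S1 (k := 2) (fun p => Guaspari.PvA n T p.2) := by
    refine S1.congr (h θ) fun p => ?_
    refine forall_congr' fun M => ?_
    rw [h2, not_not]
    exact Iff.rfl
  exact S1.rel2 (R := fun _ b => Guaspari.PvA n T b) h3 (f := fun p : Tup 1 ℕ => p.2) (g := fun p : Tup 1 ℕ => p.2) inferInstance inferInstance

theorem S1.PvB {n : ℕ} {T : Thy} (h : RET T) : S1 (k := 2) (fun p => PvB n T p.1.2 p.2) := by
  have h1 : NS (n + 1) (fun M (p : Tup 2 M) => UU n p.2 0) :=
    (clos (n + 1)).sub (NS.UU n) (fun M (p : Tup 2 M) => tc (tc (k := 0) () p.2) 0)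
  obtain ⟨θ, -, h2⟩ := (NS.toFml ((clos (n + 1)).or ((clos (n + 1)).sub (NS.notPsi n) (fun M (p : Tup 2 M) => tc (k := 0) () p.1.2)) h1)).1
  refine S1.congr (h θ) fun p => ?_
  refine forall_congr' fun M => ?_
  rw [h2]
  exact imp_congr_right fun _ => imp_iff_not_or

/-- the fixed point -/
theorem fixpt (n : ℕ) {T U : Thy} (hT : RET T) (hU : RET U) : ∃ e : ℕ,
    ((PvA n T e ∨ PvA n U e) ↔ ∃ N : ℕ, DD (M := natM) e (prN e 0) N) ∧
    ∀ k : ℕ, (PvB n T e k ∨ PvB n U e k) ↔ ∃ N : ℕ, DD (M := natM) e (prN e (k + 1)) N := by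
  have h1 : S1 (k := 2) (fun p => PvA n T p.2) := S1.rel1 (S1.PvA hT) inferInstance
  have h2 : S1 (k := 2) (fun p => PvA n U p.2) := S1.rel1 (S1.PvA hU) inferInstance
  have h3 : S1 (k := 3) (fun p => PvB n T p.1.2 p.2) := S1.rel2 (S1.PvB hT) inferInstance inferInstance
  have h4 : S1 (k := 3) (fun p => PvB n U p.1.2 p.2) := S1.rel2 (S1.PvB hU) inferInstance inferInstance
  have h5 : S1 (k := 1) (fun p => ∃ e, (p.2 = prN e 0 ∧ (PvA n T e ∨ PvA n U e)) ∨
      ∃ k, p.2 = prN e (k + 1) ∧ (PvB n T e k ∨ PvB n U e k)) := inferInstance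
  obtain ⟨Q, hQ, hQ'⟩ := h5.out
  obtain ⟨e, he⟩ := UU.univ 0 hQ
  have key : ∀ x : ℕ, (∃ N : ℕ, DD (M := natM) e x N) ↔ _ := fun x =>
    Iff.trans (show _ ↔ Q natM ((), x) from by
      rw [he natM x]
      show _ ↔ UU 0 (cst natM e) x
      rw [cst_natM]
      exact Iff.rfl) (hQ' ((), x)).symm
  refine ⟨e, ?_, fun k => ?_⟩
  · rw [key]
    constructor
    · intro h; exact ⟨e, Or.inl ⟨rfl, h⟩⟩
    · rintro ⟨e', ⟨h, h'⟩ | ⟨k, h, h'⟩⟩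
      · rw [prN_inj] at h
        rw [h.1]; exact h'
      · rw [prN_inj] at h
        omega
  · rw [key]
    constructor
    · intro h; exact ⟨e, Or.inr ⟨k, rfl, h⟩⟩
    · rintro ⟨e', ⟨h, h'⟩ | ⟨k', h, h'⟩⟩
      · rw [prN_inj] at h
        omega
      · rw [prN_inj] at h
        have : k = k' := by omega
        rw [this, h.1]; exact h'

theorem sg_idx {n : ℕ} {P : PAM → Prop} (h : Sg (n + 1) P) : ∃ k : ℕ, ∀ M : PAM, P M ↔ UU n (cst M k) 0 := by
  obtain ⟨k, hk⟩ := UU.univ n ((clos (n + 1)).sub h (fun M (_ : Tup 1 M) => ()))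
  exact ⟨k, fun M => hk M 0⟩
theorem sg_UU (n k : ℕ) : Sg (n + 1) (fun M => UU n (cst M k) 0) :=
  (clos (n + 1)).sub (NS.UU n) (fun M (_ : Tup 0 M) => tc (tc (k := 0) () (k : M)) 0)

theorem std_DD {M : PAM} {e x N : ℕ} {z : M} (hz : z ≤ cst M N) (h : DD (cst M e) (cst M x) z) :
    ∃ N' : ℕ, DD (M := natM) e x N' := by
  obtain ⟨m, _, rfl⟩ := le_cst N z hz
  exact ⟨m, (DD.abs M e x m).1 h⟩

theorem cst_pr {M : PAM} (e k : ℕ) : pr (cst M e) (cst M k + 1) = cst M (prN e (k + 1)) := by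
  rw [← cst_succ]; exact (prN_cast _ _).symm
theorem cst_pr0 {M : PAM} (e : ℕ) : pr (cst M e) 0 = cst M (prN e 0) := by
  rw [show cst M (prN e 0) = pr (cst M e) (cst M 0) from prN_cast _ _]
  rw [show cst M 0 = 0 from Nat.cast_zero]

theorem unprov {n e : ℕ} {T U : Thy} (hT : ExtPA T) (hU : ExtPA U)
    (hC : Con (U ∪ ThIn (PiS (n + 1)) T))
    (h1 : (PvA n T e ∨ PvA n U e) ↔ ∃ N : ℕ, DD (M := natM) e (prN e 0) N)
    (h2 : ∀ k : ℕ, (PvB n T e k ∨ PvB n U e k) ↔ ∃ N : ℕ, DD (M := natM) e (prN e (k + 1)) N) :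
    ¬ PvA n T e := by
  intro h
  obtain ⟨N, hN⟩ := h1.1 (Or.inl h)
  have hP : ∀ M : PAM, M.carrier ⊨ T → ¬ ∀ m < N + 1, (PvB n U e m → UU n (cst M m) 0) := by
    intro M hM hc
    obtain ⟨k, hk, ⟨z, hz, hd⟩, hk'⟩ := h M hM (cst M N) ⟨cst M N, le_rfl, by rw [cst_pr0]; exact (DD.abs M _ _ _).2 hN⟩
    obtain ⟨m, hm, rfl⟩ := le_cst N k hk
    rw [cst_pr] at hd
    rcases (h2 m).2 (std_DD hz hd) with h3 | h3
    · exact hk' (h3 M hM (h M hM))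
    · exact hk' (hc m (by omega) h3)
  have hS : Sg (n + 1) (fun M => ∀ m < N + 1, (PvB n U e m → UU n (cst M m) 0)) := by
    refine Sg.ball (fun m => ?_) _
    refine NS.congr ((Sg.const _ (¬ PvB n U e m)).or (sg_UU n m)) ?_
    intro M _
    exact imp_iff_not_or
  obtain ⟨π, hπ, hπ'⟩ := hS.toPi
  have hS2 : Sg (n + 1) (fun M => ¬ Psi n (cst M e)) :=
    (clos (n + 1)).sub (NS.notPsi n) (fun M (_ : Tup 0 M) => tc (k := 0) () (e : M))
  obtain ⟨φ, hφ, hφ'⟩ := hS2.toPi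
  obtain ⟨M, hM, hM'⟩ := (con_union_iff hU).1 hC
  have a1 := hM' π ⟨hπ, (prv_iff hT).2 fun M hM => (hπ' M).2 (hP M hM)⟩
  have a2 := hM' φ ⟨hφ, (prv_iff hT).2 fun M hM => (hφ' M).2 (not_not.2 (h M hM))⟩
  rw [hπ'] at a1
  rw [hφ', not_not] at a2
  exact a1 fun m _ hm => hm M hM a2

theorem consv {n e : ℕ} {T U : Thy} (hT : ExtPA T) {φ : Snt} (hφ : ∀ M : PAM, M.carrier ⊨ φ ↔ Psi n (cst M e))
    (h0 : ¬ ∃ N : ℕ, DD (M := natM) e (prN e 0) N)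
    (h2 : ∀ k : ℕ, (PvB n T e k ∨ PvB n U e k) ↔ ∃ N : ℕ, DD (M := natM) e (prN e (k + 1)) N) :
    ConsIn (SigmaS (n + 1)) T φ := by
  intro σ hσ h
  rw [prv_add_iff hT] at h
  rw [prv_iff hT]
  obtain ⟨k, hk⟩ := sg_idx (Sg.ofSigma hσ)
  obtain ⟨p, hp⟩ := (h2 k).1 (Or.inl fun M hM hM' => (hk M).1 (h M hM ((hφ M).2 hM')))
  intro M hM
  by_contra hc
  refine hc (h M hM ((hφ M).2 ?_))
  rintro y ⟨z, hz, hd⟩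
  have hy : cst M (max p k) ≤ y := by
    by_contra hy
    rw [cst_pr0] at hd
    exact h0 (std_DD (hz.trans (not_le.1 hy).le) hd)
  have hpy : cst M p ≤ y := (cst_le.2 (le_max_left p k)).trans hy
  have hky : cst M k ≤ y := (cst_le.2 (le_max_right p k)).trans hy
  refine ⟨cst M k, hky, ⟨cst M p, hpy, ?_⟩, ?_⟩
  · rw [cst_pr]; exact (DD.abs M _ _ _).2 hp
  · rw [← hk]; exact hc

theorem caseA (n : ℕ) {T U : Thy} (hT : ExtPA T) (hU : ExtPA U) (rT : RET T) (rU : RET U)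
    (hC1 : Con (T ∪ ThIn (PiS (n + 1)) U)) (hC2 : Con (U ∪ ThIn (PiS (n + 1)) T)) :
    ∃ φ ∈ PiS (n + 1), ConsIn (SigmaS (n + 1)) T φ ∧ ConsIn (SigmaS (n + 1)) U φ ∧ φ ∉ Th T ∪ Th U := by
  obtain ⟨e, h1, h2⟩ := fixpt n rT rU
  have h1' := (or_comm (a := PvA n U e)).trans h1
  have h2' := fun k => (or_comm (a := PvB n U e k)).trans (h2 k)
  have u1 := unprov hT hU hC2 h1 h2
  have u2 := unprov hU hT hC1 h1' h2'
  have h0 : ¬ ∃ N : ℕ, DD (M := natM) e (prN e 0) N := by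
    rw [← h1]; tauto
  have hS2 : Sg (n + 1) (fun M => ¬ Psi n (cst M e)) :=
    (clos (n + 1)).sub (NS.notPsi n) (fun M (_ : Tup 0 M) => tc (k := 0) () (e : M))
  obtain ⟨φ, hφ, hφ'⟩ := hS2.toPi
  simp only [not_not] at hφ'
  refine ⟨φ, hφ, consv hT hφ' h0 h2, consv hU hφ' h0 h2', ?_⟩
  rintro (h | h)
  · exact u1 ((prv_dec hT hφ').1 h)
  · exact u2 ((prv_dec hU hφ').1 h)

end Guaspari

open FirstOrder Language
open scoped FirstOrder

namespace Guaspari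
open PAM

/-- witness comparison -/
theorem wcmp {n : ℕ} {Q1 Q2 : ∀ M : PAM, Tup 1 M → Prop} (h1 : NS n Q1) (h2 : NS n Q2) :
    Sg (n + 1) (fun M => ∃ x : M, ¬ Q2 M ((), x) ∧ ∀ y, y ≤ x → Q1 M ((), y)) := by
  have a1 : NS n (fun M (p : Tup 2 M) => Q1 M ((), p.2)) :=
    (clos n).sub h1 (fun M (p : Tup 2 M) => tc (k := 0) () p.2)
  have a2 : NS n (fun M (p : Tup 1 M) => ∀ y, y ≤ p.2 → Q1 M ((), y)) :=
    (clos n).ball (f := fun M (p : Tup 1 M) => p.2) a1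
  exact NS.ex ((clos (n + 1)).and h2.not a2.succ)

theorem half {n : ℕ} {T U : Thy} (hT : ExtPA T) (hU : ExtPA U) {φ ψ : Snt}
    (hc : ConsIn (SigmaS (n + 1)) T φ) (hψ : ψ ∈ PiS (n + 1)) (h1 : Prv (add T φ) ψ) (h2 : ¬ Prv U ψ) :
    ¬ ThIn (PiS (n + 1)) T ⊆ Th U ∨ Con (T ∪ ThIn (PiS (n + 1)) U) := by
  by_contra hh
  push Not at hh
  obtain ⟨hs, hcon⟩ := hh
  obtain ⟨P, p1, p2, p3⟩ := inc_pi hT hU _ hcon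
  obtain ⟨Q1, q1, e1⟩ := Sg.ofPi hψ
  obtain ⟨Q2, q2, e2⟩ := p1
  have e1 : ∀ M : PAM, (¬ M.carrier ⊨ ψ ↔ ∃ y : M, ¬ Q1 M ((), y)) := fun M => e1 M ()
  have e2 : ∀ M : PAM, (¬ P M ↔ ∃ y : M, ¬ Q2 M ((), y)) := fun M => e2 M ()
  obtain ⟨χ, c1, c2⟩ := (wcmp q1 q2).toSigma
  obtain ⟨χ', d1, d2⟩ := (wcmp q2 q1).toPi
  have t1 : Prv T χ := by
    refine hc χ c1 ((prv_add_iff hT).2 fun M hM hφ => (c2 M).2 ?_)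
    have hm := (prv_add_iff hT).1 h1 M hM hφ
    obtain ⟨x, hx⟩ := (e2 M).1 (p3 M hM)
    refine ⟨x, hx, fun y _ => ?_⟩
    by_contra hy
    exact (e1 M).2 ⟨y, hy⟩ hm
  have t2 : Prv T χ' := by
    refine (prv_iff hT).2 fun M hM => (d2 M).2 ?_
    rintro ⟨y, hy, hy'⟩
    obtain ⟨x, hx, hx'⟩ := (c2 M).1 ((prv_iff hT).1 t1 M hM)
    rcases le_total y x with h | h
    · exact hy (hx' y h)
    · exact hx (hy' x h)
  have t3 : Prv U χ' := hs ⟨d1, t2⟩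
  refine h2 ((prv_iff hU).2 fun M hM => ?_)
  by_contra hm
  obtain ⟨y, hy⟩ := (e1 M).1 hm
  refine (d2 M).1 ((prv_iff hU).1 t3 M hM) ⟨y, hy, fun x _ => ?_⟩
  by_contra hx
  exact (e2 M).2 ⟨x, hx⟩ (p2 M hM)

theorem model_not {M : PAM} {φ : Snt} : M.carrier ⊨ (∼φ : Snt) ↔ ¬ M.carrier ⊨ φ := Sentence.realize_not _

theorem single (n : ℕ) {T : Thy} (hT : ExtPA T) (rT : RET T) {π : Snt} (hπ : π ∈ PiS (n + 1)) (h : ¬ Prv T π) :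
    ∃ θ ∈ PiS (n + 1), ConsIn (SigmaS (n + 1)) (add T (∼π)) θ ∧ ¬ Prv (add T (∼π)) θ := by
  have hS : Sg (n + 1) (fun M => M.carrier ⊨ (∼π : Snt)) := by
    simp only [model_not]; exact Sg.ofPi hπ
  have hE := extPA_add hT (∼π)
  have hC : Con (add T (∼π) ∪ ThIn (PiS (n + 1)) (add T (∼π))) := by
    rw [con_union_iff hE]
    rw [prv_iff hT] at h
    push Not at h
    obtain ⟨M, hM, hM'⟩ := h
    have hm : M.carrier ⊨ add T (∼π) := model_add.2 ⟨hM, model_not.2 hM'⟩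
    exact ⟨M, hm, fun φ hφ => (prv_iff hE).1 hφ.2 M hm⟩
  obtain ⟨θ, h1, h2, -, h3⟩ := caseA n hE hE (rT.add hS) (rT.add hS) hC hC
  exact ⟨θ, h1, h2, fun h => h3 (Or.inl h)⟩

theorem consB {n : ℕ} {T : Thy} (hT : ExtPA T) {φ π θ : Snt}
    (hφ : ∀ M : PAM, M.carrier ⊨ T → (M.carrier ⊨ φ ↔ (M.carrier ⊨ π ∨ M.carrier ⊨ θ)))
    (h1 : ConsIn (SigmaS (n + 1)) (add T (∼π)) θ) (h2 : ¬ Prv (add T (∼π)) θ) :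
    ConsIn (SigmaS (n + 1)) T φ ∧ ¬ Prv T φ := by
  have hE := extPA_add hT (∼π)
  constructor
  · intro σ hσ h
    rw [prv_add_iff hT] at h
    have h3 : Prv (add T (∼π)) σ := by
      refine h1 σ hσ ((prv_add_iff hE).2 fun M hM hθ => ?_)
      exact h M (model_add.1 hM).1 ((hφ M (model_add.1 hM).1).2 (Or.inr hθ))
    rw [prv_add_iff hT] at h3
    rw [prv_iff hT]
    intro M hM
    by_cases hp : M.carrier ⊨ π
    · exact h M hM ((hφ M hM).2 (Or.inl hp))
    · exact h3 M hM (model_not.2 hp)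
  · intro h
    apply h2
    rw [prv_add_iff hT]
    intro M hM hp
    rcases (hφ M hM).1 ((prv_iff hT).1 h M hM) with h3 | h3
    · exact absurd h3 (model_not.1 hp)
    · exact h3

theorem caseB (n : ℕ) {T U : Thy} (hT : ExtPA T) (hU : ExtPA U) (rT : RET T) (rU : RET U)
    (h1 : ¬ ThIn (PiS (n + 1)) T ⊆ Th U) (h2 : ¬ ThIn (PiS (n + 1)) U ⊆ Th T) :
    ∃ φ ∈ PiS (n + 1), ConsIn (SigmaS (n + 1)) T φ ∧ ConsIn (SigmaS (n + 1)) U φ ∧ φ ∉ Th T ∪ Th U := by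
  obtain ⟨πT, ⟨a1, a2⟩, a3⟩ := Set.not_subset.1 h1
  obtain ⟨πU, ⟨b1, b2⟩, b3⟩ := Set.not_subset.1 h2
  obtain ⟨θ1, c1, c2, c3⟩ := single n hU rU a1 a3
  obtain ⟨θ2, d1, d2, d3⟩ := single n hT rT b1 b3
  have hS := ((Sg.ofPi a1).and (Sg.ofPi c1)).or ((Sg.ofPi b1).and (Sg.ofPi d1))
  obtain ⟨φ, hφ, hφ'⟩ := hS.toPi
  have e1 := consB hT (φ := φ) (fun M hM => by
    have := (prv_iff hT).1 a2 M hM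
    rw [hφ']; tauto) d2 d3
  have e2 := consB hU (φ := φ) (fun M hM => by
    have := (prv_iff hU).1 b2 M hM
    rw [hφ']; tauto) c2 c3
  refine ⟨φ, hφ, e1.1, e2.1, ?_⟩
  rintro (h | h)
  · exact e1.2 h
  · exact e2.2 h

theorem con_of_sub {T S : Thy} (hE : ExtPA T) (hC : Con T) (h : S ⊆ Th T) : Con (T ∪ S) := by
  rw [con_union_iff hE]
  obtain ⟨M, hM⟩ := (con_iff hE).1 hC
  exact ⟨M, hM, fun φ hφ => (prv_iff hE).1 (h hφ) M hM⟩

theorem one_two (n : ℕ) {T U : Thy} (hT : GoodThy T) (hU : GoodThy U) (h : Bpair (n + 1) T U) :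
    ∃ φ ∈ PiS (n + 1), ConsIn (SigmaS (n + 1)) T φ ∧ ConsIn (SigmaS (n + 1)) U φ ∧ φ ∉ Th T ∪ Th U := by
  obtain ⟨cT, oT, eT⟩ := hT
  obtain ⟨cU, oU, eU⟩ := hU
  have rT := cT.ret eT
  have rU := cU.ret eU
  obtain ⟨h1, h2⟩ := h
  by_cases k1 : ThIn (PiS (n + 1)) T ⊆ Th U
  · refine caseA n eT eU rT rU ?_ (con_of_sub eU oU k1)
    exact h1.resolve_left (not_not.2 k1)
  · by_cases k2 : ThIn (PiS (n + 1)) U ⊆ Th T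
    · refine caseA n eT eU rT rU (con_of_sub eT oT k2) ?_
      exact h2.resolve_left (not_not.2 k2)
    · exact caseB n eT eU rT rU k1 k2

theorem two_three (n : ℕ) {T U : Thy} (hT : ExtPA T) (hU : ExtPA U)
    (h : ∃ φ ∈ PiS n, ConsIn (SigmaS n) T φ ∧ ConsIn (SigmaS n) U φ ∧ φ ∉ Th T ∪ Th U) :
    ∃ φ ∈ SigAndPiS n, ConsIn (SigmaS n) T φ ∧ ConsIn (SigmaS n) U φ ∧ φ ∉ Th T ∪ Th U := by
  obtain ⟨φ, h1, h2, h3, h4⟩ := h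
  obtain ⟨σ, s1, s2⟩ := (Sg.const n True).toSigma
  have e : ∀ M : PAM, M.carrier ⊨ (σ ⊓ φ : Snt) ↔ M.carrier ⊨ φ := by
    intro M
    have : M.carrier ⊨ (σ ⊓ φ : Snt) ↔ M.carrier ⊨ σ ∧ M.carrier ⊨ φ := Formula.realize_inf
    rw [this, s2]; simp
  have key : ∀ {T : Thy}, ExtPA T → ConsIn (SigmaS n) T φ → ConsIn (SigmaS n) T (σ ⊓ φ) := by
    intro T hT h γ hγ hp
    refine h γ hγ ?_
    rw [prv_add_iff hT] at hp ⊢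
    simpa only [e] using hp
  refine ⟨σ ⊓ φ, ⟨σ, s1, φ, h1, rfl⟩, key hT h2, key hU h3, ?_⟩
  rintro (h | h)
  · exact h4 (Or.inl ((prv_iff hT).2 fun M hM => (e M).1 ((prv_iff hT).1 h M hM)))
  · exact h4 (Or.inr ((prv_iff hU).2 fun M hM => (e M).1 ((prv_iff hU).1 h M hM)))

theorem three_four (n : ℕ) {T U : Thy} (hT : ExtPA T) (hU : ExtPA U)
    (h : ∃ φ ∈ SigAndPiS n, ConsIn (SigmaS n) T φ ∧ ConsIn (SigmaS n) U φ ∧ φ ∉ Th T ∪ Th U) :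
    ∃ φ ψ : Snt, (ConsIn (SigmaS n) T φ ∧ ConsIn (SigmaS n) U φ) ∧ ψ ∈ PiS n ∧
         Prv (add T φ) ψ ∧ Prv (add U φ) ψ ∧ ¬ Prv T ψ ∧ ¬ Prv U ψ := by
  obtain ⟨_, ⟨σ, s1, π, p1, rfl⟩, h2, h3, h4⟩ := h
  have e : ∀ M : PAM, M.carrier ⊨ (σ ⊓ π : Snt) ↔ M.carrier ⊨ σ ∧ M.carrier ⊨ π := fun M => Formula.realize_inf
  have key : ∀ {T : Thy}, ExtPA T → ConsIn (SigmaS n) T (σ ⊓ π) → Prv (add T (σ ⊓ π)) π ∧ (Prv T π → Prv T (σ ⊓ π)) := by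
    intro T hT h
    have h1 : Prv T σ := h σ s1 ((prv_add_iff hT).2 fun M _ hM => ((e M).1 hM).1)
    refine ⟨(prv_add_iff hT).2 fun M _ hM => ((e M).1 hM).2, fun hp => (prv_iff hT).2 fun M hM => (e M).2
      ⟨(prv_iff hT).1 h1 M hM, (prv_iff hT).1 hp M hM⟩⟩
  exact ⟨σ ⊓ π, π, ⟨h2, h3⟩, p1, (key hT h2).1, (key hU h3).1, fun h => h4 (Or.inl ((key hT h2).2 h)),
    fun h => h4 (Or.inr ((key hU h3).2 h))⟩

/-- Theorem 4.6: characterization of simultaneous (non-trivial/exact)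
`Σ_n`-conservativity via `B_n`-pairs. -/
theorem stmt_4 (T U : Thy) (hT : GoodThy T) (hU : GoodThy U) (n : ℕ) (hn : 1 ≤ n) :
    List.TFAE
      [Bpair n T U,
       ∃ φ ∈ PiS n, ConsIn (SigmaS n) T φ ∧ ConsIn (SigmaS n) U φ ∧ φ ∉ Th T ∪ Th U,
       ∃ φ ∈ SigAndPiS n, ConsIn (SigmaS n) T φ ∧ ConsIn (SigmaS n) U φ ∧ φ ∉ Th T ∪ Th U,
       ∃ φ ψ : Snt, (ConsIn (SigmaS n) T φ ∧ ConsIn (SigmaS n) U φ) ∧ ψ ∈ PiS n ∧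
         Prv (add T φ) ψ ∧ Prv (add U φ) ψ ∧ ¬ Prv T ψ ∧ ¬ Prv U ψ] := by
  obtain ⟨m, rfl⟩ : ∃ m, n = m + 1 := ⟨n - 1, by omega⟩
  have eT := hT.2.2
  have eU := hU.2.2
  tfae_have 1 → 2 := one_two m hT hU
  tfae_have 2 → 3 := two_three (m + 1) eT eU
  tfae_have 3 → 4 := three_four (m + 1) eT eU
  tfae_have 4 → 1 := by
    rintro ⟨φ, ψ, ⟨c1, c2⟩, hψ, p1, p2, u1, u2⟩
    exact ⟨half eT eU c1 hψ p1 u2, half eU eT c2 hψ p2 u1⟩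
  tfae_finish

end Guaspari
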